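/- arXiv:1007.1314 — 4 statements merged into one kernel-verified Lean document; each statement's English description precedes it below -/
import Mathlib

section
/- Principal ideal theorem over rank-1 valuation rings: let R be a valuation ring of rank 1, let A be a finitely generated R-algebra, let f ∈ A, and let p be a prime ideal of A minimal over the principal ideal (f). Then for every minimal prime q of A with q ⊆ p, the height of the image of p in A/q is at most 1. (Every irreducible component of V(f) has codimension at most 1 in each irreducible component of Spec A that contains it.) -/
/-- The height of an ideal of a commutative ring: for a prime ideal `p`, this is the
supremum of the lengths `r` of chains of primes `p₀ ⊊ p₁ ⊊ ⋯ ⊊ p_r = p`. -/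
noncomputable def primeHt {A : Type*} [CommRing A] (p : Ideal A) : ℕ∞ :=
  ⨆ (h : p.IsPrime), Order.height (⟨p, h⟩ : PrimeSpectrum A)

open Polynomial

theorem mvPoly_isIntegrallyClosed {R σ : Type*} [CommRing R] [IsDomain R] [IsIntegrallyClosed R] :
    IsIntegrallyClosed (MvPolynomial σ R) := by
  let K := FractionRing R
  let _ : Algebra (MvPolynomial σ R) (MvPolynomial σ K) := MvPolynomial.algebraMvPolynomial
  have : IsIntegrallyClosed (MvPolynomial σ K) := UniqueFactorizationMonoid.instIsIntegrallyClosed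
  suffices IsIntegrallyClosedIn (MvPolynomial σ R) (MvPolynomial σ K) from
    .of_isIntegrallyClosed_of_isIntegrallyClosedIn _ (MvPolynomial σ K)
  refine isIntegrallyClosedIn_iff.mpr
    ⟨MvPolynomial.map_injective _ (IsFractionRing.injective _ _), ?_⟩
  intro p hp
  have h := MvPolynomial.isIntegral_iff_isIntegral_coeff.mp hp
  have : p ∈ Set.range (MvPolynomial.map (σ := σ) (algebraMap R K)) := by
    rw [MvPolynomial.mem_range_map_iff_coeffs_subset]
    intro x hx
    obtain ⟨n, hn, rfl⟩ := MvPolynomial.mem_coeffs_iff.mp hx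
    exact IsIntegrallyClosed.isIntegral_iff.mp (h n)
  exact this

theorem quasiFiniteAt_of_isolated {S B : Type*} [CommRing S] [CommRing B] [Algebra S B]
    [Algebra.FiniteType S B] (p : Ideal B) [hp : p.IsPrime]
    (h1 : ∀ J : Ideal B, J.IsPrime → J ≤ p → J.under S = p.under S → J = p)
    (h2 : ∀ J : Ideal B, J.IsPrime → p ≤ J → J.under S = p.under S → J = p) :
    Algebra.QuasiFiniteAt S p := by
  let x : PrimeSpectrum B := ⟨p, hp⟩
  apply Algebra.QuasiFiniteAt.of_isOpen_singleton_fiber x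
  let P := x.comap (algebraMap S B)
  let e := PrimeSpectrum.preimageHomeomorphFiber S B P
  let y : (PrimeSpectrum.comap (algebraMap S B) ⁻¹' {P} : Set _) := ⟨x, rfl⟩
  change IsOpen {y}
  rw [← e.isOpen_image, Set.image_singleton]
  have : IsNoetherianRing (P.asIdeal.Fiber B) :=
    Algebra.FiniteType.isNoetherianRing P.asIdeal.ResidueField _
  have : IsJacobsonRing (P.asIdeal.Fiber B) :=
    isJacobsonRing_of_finiteType (A := P.asIdeal.ResidueField)
  rw [(PrimeSpectrum.isOpen_singleton_tfae_of_isNoetherian_of_isJacobsonRing (e y)).out 0 2 rfl rfl]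
  constructor
  · rw [← Set.image_singleton, e.isClosed_image]
    have : ({y} : Set _) = Subtype.val ⁻¹' (PrimeSpectrum.zeroLocus (p : Set B)) := by
      ext ⟨z, hz⟩
      simp only [Set.mem_singleton_iff, Set.mem_preimage, PrimeSpectrum.mem_zeroLocus,
        SetLike.coe_subset_coe]
      constructor
      · intro h
        have : z = x := congrArg Subtype.val h
        subst this; exact le_rfl
      · intro h
        have h3 : z = x := PrimeSpectrum.ext (h2 z.asIdeal z.2 h congr(($hz).asIdeal))
        exact Subtype.ext h3
    rw [this]
    exact (PrimeSpectrum.isClosed_zeroLocus _).preimage continuous_subtype_val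
  · intro a b hab ha
    obtain rfl : a = e y := ha
    obtain ⟨⟨z, hz⟩, rfl⟩ := e.surjective b
    have h3 : (⟨z, hz⟩ : (PrimeSpectrum.comap (algebraMap S B) ⁻¹' {P} : Set _)) ⤳ y := by
      simpa using hab.map e.symm.continuous
    have h4 : z ⤳ x := h3.map continuous_subtype_val
    rw [← PrimeSpectrum.le_iff_specializes] at h4
    have : z = x := PrimeSpectrum.ext (h1 z.asIdeal z.2 h4 congr(($hz).asIdeal))
    subst this
    rfl

/-- In a free module over a valuation ring, every nonzero element is a multiple of a
primitive one. -/
theorem exists_primitive {R M : Type*} [CommRing R] [IsDomain R] [ValuationRing R]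
    [AddCommGroup M] [Module R M] [Module.Free R M] (x : M) (hx : x ≠ 0) :
    ∃ (c : R) (y : M), x = c • y ∧ ∀ I : Ideal R, I ≠ ⊤ → y ∉ I • (⊤ : Submodule R M) := by
  classical
  let b := Module.Free.chooseBasis R M
  have hne : (b.repr x).support.Nonempty := by
    rw [Finsupp.support_nonempty_iff]; simpa using hx
  have key : ∀ s : Finset (Module.Free.ChooseBasisIndex R M), s.Nonempty →
      ∃ i ∈ s, ∀ j ∈ s, b.repr x i ∣ b.repr x j := by
    intro s hs
    induction hs using Finset.Nonempty.cons_induction with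
    | singleton a => exact ⟨a, by simp⟩
    | cons a s ha hs ih =>
      obtain ⟨i, hi, h⟩ := ih
      rcases ValuationRing.dvd_total (b.repr x i) (b.repr x a) with h' | h'
      · exact ⟨i, by simp [hi], by simpa using ⟨h', h⟩⟩
      · exact ⟨a, by simp, by simpa using fun j hj => h'.trans (h j hj)⟩
  obtain ⟨i, hi, h⟩ := key _ hne
  have h' : ∀ j, ∃ d, b.repr x j = b.repr x i * d := by
    intro j
    by_cases hj : j ∈ (b.repr x).support
    · exact h j hj
    · exact ⟨0, by simpa using hj⟩
  choose d hd using h'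
  have hi0 : b.repr x i ≠ 0 := by simpa using hi
  let g : Module.Free.ChooseBasisIndex R M →₀ R :=
    Finsupp.onFinset (b.repr x).support d (fun j hj => by
      rw [Finsupp.mem_support_iff, hd j]; exact mul_ne_zero hi0 hj)
  refine ⟨b.repr x i, b.repr.symm g, ?_, ?_⟩
  · apply b.repr.injective
    ext j
    simp [g, ← hd j]
  · intro I hI hmem
    have hle : I • (⊤ : Submodule R M) ≤ Submodule.comap (b.coord i) I := by
      rw [Submodule.smul_le]
      intro r hr n _
      simp only [Submodule.mem_comap, map_smul, smul_eq_mul]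
      exact I.mul_mem_right _ hr
    have h1 := hle hmem
    have h2 : g i = 1 := by
      have := hd i
      simp only [g, Finsupp.onFinset_apply]
      exact (mul_left_cancel₀ hi0 (by rw [← this, mul_one]))
    simp only [Submodule.mem_comap, Module.Basis.coord_apply, LinearEquiv.apply_symm_apply, h2] at h1
    exact hI ((Ideal.eq_top_iff_one I).mpr h1)

theorem indep_lift {R M B : Type*} [CommRing R] [IsDomain R] [ValuationRing R]
    [AddCommGroup M] [Module R M] [Module.Free R M] [CommRing B] [Algebra R B]
    (φ : M →ₗ[R] B) (p q : Ideal B) [p.IsPrime] [q.IsPrime] (hqp : q ≤ p)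
    (h : ∀ x, φ x ∈ p → x ∈ (p.under R) • (⊤ : Submodule R M)) :
    ∀ x, φ x ∈ q → x ∈ (q.under R) • (⊤ : Submodule R M) := by
  intro x hx
  by_cases hx0 : x = 0
  · rw [hx0]; exact zero_mem _
  obtain ⟨c, y, rfl, hy⟩ := exists_primitive (R := R) x hx0
  have h1 : φ y ∉ q := fun h' => hy _ (Ideal.IsPrime.ne_top inferInstance) (h y (hqp h'))
  rw [map_smul, Algebra.smul_def] at hx
  have h2 : c ∈ q.under R := (Ideal.IsPrime.mem_or_mem ‹_› hx).resolve_right h1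
  exact Submodule.smul_mem_smul h2 trivial

/-- adjoining `f ∈ p \ q` when `p` and `q` have the same trace. -/
theorem indep_adjoin {R P B : Type*} [CommRing R] [CommRing P] [CommRing B] [Algebra R P]
    [Algebra R B] [Algebra P B] [IsScalarTower R P B] (f : B) (p q : Ideal B) [q.IsPrime]
    (hqp : q ≤ p) (hfp : f ∈ p) (hfq : f ∉ q) (hR : p.under R = q.under R)
    (h : ∀ x : P, algebraMap P B x ∈ p → x ∈ (p.under R) • (⊤ : Submodule R P)) :
    ∀ x : P[X], aeval f x ∈ q → x ∈ (q.under R) • (⊤ : Submodule R P[X]) := by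
  intro x
  induction hn : x.natDegree using Nat.strong_induction_on generalizing x with
  | _ n ih =>
  intro hx
  have hx' : aeval f x = aeval f x.divX * f + algebraMap P B (x.coeff 0) := by
    conv_lhs => rw [← x.divX_mul_X_add]
    simp
  have h0 : x.coeff 0 ∈ (q.under R) • (⊤ : Submodule R P) := by
    rw [← hR]
    apply h
    have : algebraMap P B (x.coeff 0) = aeval f x - aeval f x.divX * f := by rw [hx']; ring
    rw [this]
    exact p.sub_mem (hqp hx) (p.mul_mem_left _ hfp)
  have h0q : algebraMap P B (x.coeff 0) ∈ q := by
    have hle : (q.under R) • (⊤ : Submodule R P) ≤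
        (q.restrictScalars R).comap (IsScalarTower.toAlgHom R P B).toLinearMap := by
      rw [Submodule.smul_le]
      intro r hr n _
      simp only [Submodule.mem_comap, map_smul, Submodule.restrictScalars_mem]
      rw [Algebra.smul_def]
      exact q.mul_mem_right _ hr
    exact hle h0
  have hC : C (x.coeff 0) ∈ (q.under R) • (⊤ : Submodule R P[X]) :=
    Submodule.smul_top_le_comap_smul_top (q.under R)
      ((CAlgHom : P →ₐ[R] P[X]).toLinearMap) h0
  by_cases hd : n = 0
  · subst hd
    rw [eq_C_of_natDegree_eq_zero hn]; exact hC
  have hdiv : x.divX ∈ (q.under R) • (⊤ : Submodule R P[X]) := by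
    refine ih _ ?_ x.divX rfl ?_
    · rw [natDegree_divX_eq_natDegree_tsub_one]; omega
    · have : aeval f x.divX * f ∈ q := by
        have := q.sub_mem hx h0q
        rwa [hx', add_sub_cancel_right] at this
      exact (Ideal.IsPrime.mem_or_mem ‹_› this).resolve_right hfq
  rw [← x.divX_mul_X_add]
  refine add_mem ?_ hC
  exact Submodule.smul_top_le_comap_smul_top (q.under R)
      (LinearMap.mulRight R (X : P[X])) hdiv

theorem core_main {P B : Type*} [CommRing P] [IsDomain P] [IsIntegrallyClosed P]
    [CommRing B] [IsDomain B] [Algebra P[X] B] (f : B) (hX : algebraMap P[X] B X = f)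
    (p q : Ideal B) [p.IsPrime] [q.IsPrime] (hqp : q < p) (hq0 : q ≠ ⊥) (hfp : f ∈ p)
    (hmin : ∀ J : Ideal B, J.IsPrime → f ∈ J → J ≤ p → J = p)
    (hZ : Algebra.ZariskisMainProperty P[X] p) :
    ¬ Function.Injective (algebraMap P[X] B) := by
  intro hinj
  have hfq : f ∉ q := fun h => hqp.ne (hmin q ‹_› h hqp.le)
  obtain ⟨r, hrp, hri, hr⟩ := Algebra.zariskisMainProperty_iff.mp hZ
  have hr0 : r ≠ 0 := fun h => hrp (h ▸ p.zero_mem)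
  obtain ⟨x, hxq, hx0⟩ := Submodule.exists_mem_ne_zero_of_ne_bot hq0
  obtain ⟨m, hm⟩ := hr x
  have hne := Ideal.comap_ne_bot_of_integral_mem (I := q) (R := P[X])
    (mul_ne_zero (pow_ne_zero m hr0) hx0) (q.mul_mem_left _ hxq) hm
  obtain ⟨G, hG, hG0⟩ := Submodule.exists_mem_ne_zero_of_ne_bot hne
  obtain ⟨G', hGG', hnd⟩ := exists_eq_pow_rootMultiplicity_mul_and_not_dvd G hG0 0
  simp only [C_0, sub_zero] at hGG' hnd
  have hG'q : algebraMap P[X] B G' ∈ q := by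
    rw [hGG', Ideal.mem_comap, map_mul, map_pow, hX] at hG
    exact (Ideal.IsPrime.mem_or_mem ‹_› hG).resolve_left
      fun h => hfq (Ideal.IsPrime.mem_of_pow_mem ‹_› _ h)
  let A := integralClosure P[X] B
  have : FaithfulSMul P[X] B := (faithfulSMul_iff_algebraMap_injective _ _).mpr hinj
  have hinjA : Function.Injective (algebraMap P[X] A) := by
    intro a b hab
    exact hinj (congrArg Subtype.val hab)
  have : FaithfulSMul P[X] A := (faithfulSMul_iff_algebraMap_injective _ _).mpr hinjA
  have hXprime : (Ideal.span {(X : P[X])}).IsPrime :=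
    (Ideal.span_singleton_prime X_ne_zero).mpr prime_X
  have hle : Ideal.span {(X : P[X])} ≤ p.under P[X] := by
    rw [Ideal.span_singleton_le_iff_mem, Ideal.under_def, Ideal.mem_comap, hX]; exact hfp
  obtain ⟨Q, hQle, hQ, hQover⟩ := Ideal.exists_ideal_le_liesOver_of_le (p := Ideal.span {(X : P[X])})
    (q := p.under P[X]) (p.under A) hle
  let rA : A := ⟨r, hri⟩
  have hrQ : rA ∉ Q := fun h => hrp (hQle h)
  have hmap : ∀ b ∈ Q.map (algebraMap A B), ∃ m : ℕ, ∃ a ∈ Q, r ^ m * b = algebraMap A B a := by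
    intro b hb
    refine Submodule.span_induction ?_ ?_ ?_ ?_ hb
    · rintro _ ⟨a, ha, rfl⟩
      exact ⟨0, a, ha, by simp⟩
    · exact ⟨0, 0, Q.zero_mem, by simp⟩
    · rintro u v _ _ ⟨m, a, ha, h⟩ ⟨n, c, hc, h'⟩
      refine ⟨m + n, rA ^ n * a + rA ^ m * c,
        Q.add_mem (Q.mul_mem_left _ ha) (Q.mul_mem_left _ hc), ?_⟩
      rw [map_add, map_mul, map_mul, ← h, ← h', map_pow, map_pow]
      change _ = r ^ n * _ + r ^ m * _
      ring
    · rintro c u _ ⟨m, a, ha, h⟩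
      obtain ⟨n, hn⟩ := hr c
      refine ⟨n + m, ⟨r ^ n * c, hn⟩ * a, Q.mul_mem_left _ ha, ?_⟩
      rw [map_mul, ← h, smul_eq_mul]
      change _ = (r ^ n * c) * _
      ring
  have hcm : (Q.map (algebraMap A B)).comap (algebraMap A B) = Q := by
    refine le_antisymm ?_ Ideal.le_comap_map
    intro c hc
    obtain ⟨m, a, ha, h⟩ := hmap _ hc
    have h2 : rA ^ m * c = a := Subtype.ext h
    exact (Ideal.IsPrime.mem_or_mem hQ (h2 ▸ ha)).resolve_left
      fun h => hrQ (Ideal.IsPrime.mem_of_pow_mem hQ _ h)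
  obtain ⟨J, hJ, hJQ⟩ := (Ideal.comap_map_eq_self_iff_of_isPrime Q).mp hcm
  have hJp : J ≤ p := by
    intro b hb
    obtain ⟨n, hn⟩ := hr b
    have h1 : (⟨r ^ n * b, hn⟩ : A) ∈ Q := by
      rw [← hJQ]; exact J.mul_mem_left _ hb
    have h2 : r ^ n * b ∈ p := hQle h1
    exact (Ideal.IsPrime.mem_or_mem ‹_› h2).resolve_left
      fun h => hrp (Ideal.IsPrime.mem_of_pow_mem ‹_› _ h)
  have hJX : J.comap (algebraMap P[X] B) = Ideal.span {(X : P[X])} := by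
    rw [IsScalarTower.algebraMap_eq P[X] A B, ← Ideal.comap_comap, hJQ, hQover.over]
  have hfJ : f ∈ J := by
    rw [← hX, ← Ideal.mem_comap, hJX]; exact Ideal.mem_span_singleton_self _
  obtain rfl := hmin J hJ hfJ hJp
  apply hnd
  rw [← Ideal.mem_span_singleton, ← hJX]
  exact hqp.le hG'q

theorem core_alg {R P B : Type*} [CommRing R] [IsDomain R] [ValuationRing R]
    [CommRing P] [IsDomain P] [IsIntegrallyClosed P] [Algebra R P] [Module.Free R P]
    [CommRing B] [IsDomain B] [Algebra R B] [Algebra.FiniteType R B] [Algebra P B]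
    [IsScalarTower R P B] (hinjR : Function.Injective (algebraMap R B)) (f : B)
    (p q : Ideal B) [p.IsPrime] [q.IsPrime] (hqp : q < p) (hq0 : q ≠ ⊥) (hfp : f ∈ p)
    (hmin : ∀ J : Ideal B, J.IsPrime → f ∈ J → J ≤ p → J = p)
    (hR : p.under R = q.under R ∨ q.under R = ⊥)
    (hind : ∀ x : P, algebraMap P B x ∈ p → x ∈ (p.under R) • (⊤ : Submodule R P))
    (hmax : ∀ J : Ideal B, J.IsPrime → p ≤ J →
      (∀ x : P, algebraMap P B x ∈ J → algebraMap P B x ∈ p) → J = p) : False := by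
  have hfq : f ∉ q := fun h => hqp.ne (hmin q ‹_› h hqp.le)
  let _ : Algebra P[X] B := (aeval f : P[X] →ₐ[P] B).toAlgebra
  have hmapdef : ∀ x : P[X], algebraMap P[X] B x = aeval f x := fun _ => rfl
  have : IsScalarTower P P[X] B := .of_algebraMap_eq fun x => by simp [hmapdef]
  have : IsScalarTower R P[X] B := .of_algebraMap_eq fun x => by
    rw [IsScalarTower.algebraMap_apply R P P[X], ← IsScalarTower.algebraMap_apply P P[X] B,
      ← IsScalarTower.algebraMap_apply R P B]
  have : Algebra.FiniteType P[X] B := .of_restrictScalars_finiteType R _ _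
  have hX : algebraMap P[X] B X = f := by simp [hmapdef]
  have hqf : Algebra.QuasiFiniteAt P[X] p := by
    apply quasiFiniteAt_of_isolated
    · intro J hJ hle hu
      refine hmin J hJ ?_ hle
      have : (X : P[X]) ∈ p.under P[X] := by
        rw [Ideal.under_def, Ideal.mem_comap, hX]; exact hfp
      rw [← hu, Ideal.under_def, Ideal.mem_comap, hX] at this
      exact this
    · intro J hJ hle hu
      refine hmax J hJ hle fun x hx => ?_
      rw [IsScalarTower.algebraMap_apply P P[X] B] at hx ⊢
      have h : algebraMap P P[X] x ∈ J.under P[X] := hx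
      rw [hu] at h
      exact h
  have hZ : Algebra.ZariskisMainProperty P[X] p := .of_finiteType p
  refine core_main f hX p q hqp hq0 hfp hmin hZ ?_
  rw [injective_iff_map_eq_zero]
  rcases hR with hR | hR
  · have h1 := indep_adjoin (R := R) (P := P) f p q hqp.le hfp hfq hR hind
    have : Module.Free R P[X] := .trans (S := P)
    have h2 := indep_lift (R := R) (IsScalarTower.toAlgHom R P[X] B).toLinearMap q ⊥ bot_le h1
    intro x hx
    have h3 := h2 x hx
    have h4 : (⊥ : Ideal B).under R = ⊥ := by
      rw [Ideal.under_def, ← RingHom.ker_eq_comap_bot]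
      exact (RingHom.injective_iff_ker_eq_bot _).mp hinjR
    rw [h4] at h3
    simpa using h3
  · by_contra hcon
    push Not at hcon
    obtain ⟨G, hG, hG0⟩ := hcon
    have halg : IsAlgebraic P f := ⟨G, hG0, hG⟩
    obtain ⟨r, hrp, hri, hr⟩ := Algebra.zariskisMainProperty_iff.mp hZ
    have hr0 : r ≠ 0 := fun h => hrp (h ▸ p.zero_mem)
    obtain ⟨x, hxq, hx0⟩ := Submodule.exists_mem_ne_zero_of_ne_bot hq0
    obtain ⟨m, hm⟩ := hr x
    have hy : IsAlgebraic P (r ^ m * x) := by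
      let D := Algebra.adjoin P {f}
      let fD : D := ⟨f, Algebra.self_mem_adjoin_singleton P f⟩
      let _ : Algebra P[X] D := (aeval fD : P[X] →ₐ[P] D).toAlgebra
      have : IsScalarTower P[X] D B := .of_algebraMap_eq fun x => by
        change aeval f x = D.val (aeval fD x)
        rw [← aeval_algHom_apply]
        rfl
      have h1 : IsIntegral D (r ^ m * x) := hm.tower_top
      have h2 : Algebra.IsAlgebraic P D :=
        (Subalgebra.isAlgebraic_iff _).mp (Algebra.isAlgebraic_adjoin_singleton_iff.mpr halg)
      exact h1.isAlgebraic.restrictScalars P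
    have hne := Ideal.comap_ne_bot_of_algebraic_mem (I := q) (R := P)
      (mul_ne_zero (pow_ne_zero m hr0) hx0) (q.mul_mem_left _ hxq) hy
    obtain ⟨g, hg, hg0⟩ := Submodule.exists_mem_ne_zero_of_ne_bot hne
    have h2 := indep_lift (R := R) (IsScalarTower.toAlgHom R P B).toLinearMap p q hqp.le hind g hg
    rw [hR] at h2
    simp at h2
    exact hg0 h2

theorem key {R B : Type*} [CommRing R] [IsDomain R] [ValuationRing R]
    [CommRing B] [IsDomain B] [Algebra R B] [Algebra.FiniteType R B]
    (hinjR : Function.Injective (algebraMap R B))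
    (hdim : ∀ I : Ideal R, I.IsPrime → I ≠ ⊥ → I.IsMaximal) (f : B)
    (p q : Ideal B) [p.IsPrime] [q.IsPrime] (hqp : q < p) (hq0 : q ≠ ⊥) (hfp : f ∈ p)
    (hmin : ∀ J : Ideal B, J.IsPrime → f ∈ J → J ≤ p → J = p) : False := by
  have hR : p.under R = q.under R ∨ q.under R = ⊥ := by
    by_cases h : q.under R = ⊥
    · exact Or.inr h
    · left
      have h1 := hdim _ inferInstance h
      exact (h1.eq_of_le (Ideal.IsPrime.ne_top inferInstance) (Ideal.comap_mono hqp.le)).symm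
  let k := R ⧸ p.under R
  have hfaith : FaithfulSMul k (B ⧸ p) := by
    rw [faithfulSMul_iff_algebraMap_injective]
    exact Ideal.algebraMap_quotient_injective
  obtain ⟨ι, x, hx⟩ := exists_isTranscendenceBasis' k (B ⧸ p)
  choose t ht using fun i => Ideal.Quotient.mk_surjective (x i)
  let P := MvPolynomial ι R
  let _ : Algebra P B := (MvPolynomial.aeval t : P →ₐ[R] B).toAlgebra
  have hmapdef : ∀ G : P, algebraMap P B G = MvPolynomial.aeval t G := fun _ => rfl
  have : IsScalarTower R P B := .of_algebraMap_eq fun r => by simp [hmapdef, P]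
  have : IsIntegrallyClosed P := mvPoly_isIntegrallyClosed
  have hcomp : ∀ G : P, Ideal.Quotient.mk p (algebraMap P B G) =
      MvPolynomial.aeval x (MvPolynomial.map (Ideal.Quotient.mk (p.under R)) G) := by
    intro G
    rw [hmapdef]
    induction G using MvPolynomial.induction_on with
    | C a =>
      simp only [MvPolynomial.map_C, MvPolynomial.algHom_C]
      rfl
    | add a b ha hb => simp only [map_add, ha, hb]
    | mul_X a i ha => simp only [map_mul, ha, MvPolynomial.map_X, MvPolynomial.aeval_X, ht]
  refine core_alg (P := P) hinjR f p q hqp hq0 hfp hmin hR ?_ ?_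
  · intro G hG
    have h1 := hcomp G
    rw [Ideal.Quotient.eq_zero_iff_mem.mpr hG] at h1
    have h2 := (injective_iff_map_eq_zero _).mp hx.1 _ h1.symm
    rw [G.as_sum]
    refine Submodule.sum_mem _ fun m _ => ?_
    have h3 : G.coeff m ∈ p.under R := by
      rw [← Ideal.Quotient.eq_zero_iff_mem, ← MvPolynomial.coeff_map, h2, MvPolynomial.coeff_zero]
    have h4 : MvPolynomial.monomial m (G.coeff m) =
        G.coeff m • (MvPolynomial.monomial m (1 : R)) := by
      rw [MvPolynomial.smul_monomial, smul_eq_mul, mul_one]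
    rw [h4]
    exact Submodule.smul_mem_smul h3 trivial
  · intro J hJ hpJ hJx
    by_contra hne
    obtain ⟨y, hyJ, hyp⟩ := SetLike.exists_of_lt (lt_of_le_of_ne hpJ (Ne.symm hne))
    have halg := hx.isAlgebraic
    have hy0 : Ideal.Quotient.mk p y ≠ 0 := by rwa [Ne, Ideal.Quotient.eq_zero_iff_mem]
    have hb := Ideal.comap_ne_bot_of_algebraic_mem (I := J.map (Ideal.Quotient.mk p))
      (R := Algebra.adjoin k (Set.range x)) hy0 (Ideal.mem_map_of_mem _ hyJ) (halg.isAlgebraic _)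
    obtain ⟨⟨d, hd⟩, hdJ, hd0⟩ := Submodule.exists_mem_ne_zero_of_ne_bot hb
    rw [Algebra.adjoin_range_eq_range_aeval] at hd
    obtain ⟨G', hG'⟩ := hd
    obtain ⟨G, rfl⟩ := MvPolynomial.map_surjective _ Ideal.Quotient.mk_surjective G'
    have hG : Ideal.Quotient.mk p (algebraMap P B G) = d := (hcomp G).trans hG'
    have hdJ' : d ∈ J.map (Ideal.Quotient.mk p) := hdJ
    rw [← hG] at hdJ'
    have hGJ : algebraMap P B G ∈ J := by
      rw [← Ideal.mem_comap, Ideal.comap_map_of_surjective _ Ideal.Quotient.mk_surjective,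
        ← RingHom.ker_eq_comap_bot, Ideal.mk_ker, sup_eq_left.mpr hpJ] at hdJ'
      exact hdJ'
    have := hJx G hGJ
    rw [← Ideal.Quotient.eq_zero_iff_mem, hG] at this
    exact hd0 (Subtype.ext this)

theorem height_le_one_of_forall {B : Type*} [CommRing B] [IsDomain B] (x : PrimeSpectrum B)
    (h : ∀ q : Ideal B, q.IsPrime → q ≠ ⊥ → q < x.asIdeal → False) : Order.height x ≤ 1 := by
  have := (Order.height_le_coe_iff (x := x) (n := 1)).mpr ?_
  · exact_mod_cast this
  intro y hy
  have : Order.height y = 0 := by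
    rw [Order.height_eq_zero, isMin_iff_forall_not_lt]
    intro z hz
    refine h y.asIdeal y.2 ?_ hy
    intro hb
    have hz' : z.asIdeal < y.asIdeal := hz
    rw [hb] at hz'
    exact not_lt_bot hz'
  rw [this]; norm_num

theorem domain_case {R B : Type*} [CommRing R] [IsDomain R] [ValuationRing R]
    (hdim : ∀ I : Ideal R, I.IsPrime → I ≠ ⊥ → I.IsMaximal)
    [CommRing B] [IsDomain B] [Algebra R B] [Algebra.FiniteType R B] (f : B)
    (x : PrimeSpectrum B) (hfp : f ∈ x.asIdeal)
    (hmin : ∀ J : Ideal B, J.IsPrime → f ∈ J → J ≤ x.asIdeal → J = x.asIdeal) :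
    Order.height x ≤ 1 := by
  by_cases hinjR : Function.Injective (algebraMap R B)
  · apply height_le_one_of_forall
    intro q hq hq0 hqp
    exact key hinjR hdim f x.asIdeal q hqp hq0 hfp hmin
  · have hker : RingHom.ker (algebraMap R B) ≠ ⊥ := fun h =>
      hinjR ((RingHom.injective_iff_ker_eq_bot _).mpr h)
    have hm := hdim _ (RingHom.ker_isPrime _) hker
    let k := R ⧸ RingHom.ker (algebraMap R B)
    let _ : Field k := Ideal.Quotient.field _
    let _ : Algebra k B := (RingHom.kerLift (algebraMap R B)).toAlgebra
    have : IsScalarTower R k B := .of_algebraMap_eq fun r => rfl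
    have : Algebra.FiniteType k B := .of_restrictScalars_finiteType R _ _
    have : IsNoetherianRing B := Algebra.FiniteType.isNoetherianRing k B
    have h := Ideal.height_le_one_of_isPrincipal_of_mem_minimalPrimes (Ideal.span {f}) x.asIdeal
      ⟨⟨x.2, by rwa [Ideal.span_singleton_le_iff_mem]⟩, fun J hJ hle =>
        (hmin J hJ.1 (by simpa [Ideal.span_singleton_le_iff_mem] using hJ.2) hle).ge⟩
    rw [PrimeSpectrum.height_eq_orderHeight] at h
    exact h

/-- **Principal ideal theorem over rank-1 valuation rings.**
Let `R` be a valuation ring of rank 1 (a valuation domain of Krull dimension 1), let `A` be a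
finitely generated `R`-algebra, let `f ∈ A`, and let `p` be a prime ideal of `A` minimal over
the principal ideal `(f)`.  Then for every minimal prime `q` of `A` with `q ⊆ p`, the height
of the image of `p` in `A ⧸ q` is at most `1`. -/
theorem principal_ideal_theorem_over_rank_one_valuation_ring
    {R A : Type*} [CommRing R] [IsDomain R] [ValuationRing R]
    (hrank : ringKrullDim R = 1)
    [CommRing A] [Algebra R A] [Algebra.FiniteType R A]
    (f : A) (p : Ideal A) (hp : p ∈ (Ideal.span {f}).minimalPrimes)
    (q : Ideal A) (hq : q ∈ minimalPrimes A) (hqp : q ≤ p) :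
    primeHt (p.map (Ideal.Quotient.mk q)) ≤ 1 := by
  have hqprime : q.IsPrime := hq.1.1
  have hpprime : p.IsPrime := hp.1.1
  have hdim : ∀ I : Ideal R, I.IsPrime → I ≠ ⊥ → I.IsMaximal := by
    intro I hI hI0
    have h1 : Ring.KrullDimLE 1 R := by
      rw [Ring.krullDimLE_iff]; exact hrank.le
    rcases Ring.krullDimLE_one_iff.mp h1 I hI with h | h
    · exfalso
      rw [IsDomain.minimalPrimes_eq_singleton_bot] at h
      exact hI0 h
    · exact h
  have hcomap : (p.map (Ideal.Quotient.mk q)).comap (Ideal.Quotient.mk q) = p := by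
    rw [Ideal.comap_map_of_surjective _ Ideal.Quotient.mk_surjective,
      ← RingHom.ker_eq_comap_bot, Ideal.mk_ker, sup_eq_left.mpr hqp]
  unfold primeHt
  refine iSup_le fun hpr => ?_
  refine domain_case (R := R) hdim (Ideal.Quotient.mk q f) _ ?_ ?_
  · exact Ideal.mem_map_of_mem _ (hp.1.2 (Ideal.mem_span_singleton_self f))
  · intro J hJ hfJ hle
    refine le_antisymm hle ?_
    change p.map (Ideal.Quotient.mk q) ≤ J
    rw [Ideal.map_le_iff_le_comap]
    refine hp.2 ⟨inferInstance, ?_⟩ ?_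
    · rw [Ideal.span_singleton_le_iff_mem]; exact hfJ
    · change J.comap (Ideal.Quotient.mk q) ≤ p
      rw [← hcomap]
      exact Ideal.comap_mono hle
end

section
/- Existence and density of closed-point lifts: let R be a valuation ring of rank 1 with maximal ideal m and fraction field K, and let A be an integral domain that is a finitely generated R-algebra whose structure map R → A is injective. Let M be a prime ideal of A containing mA whose image M/mA is a maximal ideal of A/mA (a closed point of the special fiber). Then for every nonzero g ∈ A there exists a prime ideal p of A with p ⊆ M, p ∩ R = (0), g ∉ p, and such that the extension p·(A ⊗_R K) is a maximal ideal of A ⊗_R K. In particular, the closed points of the generic fiber specializing to M are Zariski dense in the generic fiber. -/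
section Helpers

open MvPolynomial

lemma mvPoly_integrallyClosed_aux {R : Type*} [CommRing R] [IsDomain R] [IsIntegrallyClosed R]
    (n : ℕ) : IsIntegrallyClosed (MvPolynomial (Fin n) R) := by
  induction n with
  | zero => exact IsIntegrallyClosed.of_equiv (MvPolynomial.isEmptyRingEquiv R (Fin 0)).symm
  | succ n ih =>
    exact IsIntegrallyClosed.of_equiv (MvPolynomial.finSuccEquiv R n).symm.toRingEquiv

lemma extend_prime_aux {P A : Type*} [CommRing P] [CommRing A] [Algebra P A]
    (S : Subalgebra P A) (M : Ideal A) [M.IsPrime] (s : A) (hsS : s ∈ S) (hsM : s ∉ M)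
    (hs : ∀ x : A, ∃ m : ℕ, s ^ m * x ∈ S)
    (q : Ideal S) [hq : q.IsPrime] (hqM : q ≤ M.comap (algebraMap S A)) :
    ∃ p : Ideal A, p.IsPrime ∧ p ≤ M ∧ p.comap (algebraMap S A) = q := by
  have hsq : ∀ n : ℕ, (⟨s, hsS⟩ : S) ^ n ∉ q := fun n h =>
    hsM (hqM (hq.mem_of_pow_mem n h))
  let p : Ideal A :=
    { carrier := {a | ∃ n : ℕ, ∃ b : S, b ∈ q ∧ s ^ n * a = b}
      zero_mem' := ⟨0, 0, q.zero_mem, by simp⟩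
      add_mem' := by
        rintro a a' ⟨n, b, hb, h⟩ ⟨n', b', hb', h'⟩
        refine ⟨n + n', ⟨s, hsS⟩ ^ n' * b + ⟨s, hsS⟩ ^ n * b',
          q.add_mem (q.mul_mem_left _ hb) (q.mul_mem_left _ hb'), ?_⟩
        simp only [AddMemClass.coe_add, MulMemClass.coe_mul, SubmonoidClass.coe_pow, ← h, ← h']
        ring
      smul_mem' := by
        rintro c a ⟨n, b, hb, h⟩
        obtain ⟨m, hm⟩ := hs c
        refine ⟨n + m, ⟨_, hm⟩ * b, q.mul_mem_left _ hb, ?_⟩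
        simp only [MulMemClass.coe_mul, ← h, smul_eq_mul]
        ring }
  have hp : ∀ a, a ∈ p ↔ ∃ n : ℕ, ∃ b : S, b ∈ q ∧ s ^ n * a = b := fun a => Iff.rfl
  have hcom : p.comap (algebraMap S A) = q := by
    ext x
    rw [Ideal.mem_comap, hp]
    constructor
    · rintro ⟨n, b, hb, h⟩
      have : (⟨s, hsS⟩ : S) ^ n * x = b := Subtype.ext (by simpa using h)
      rw [← this] at hb
      exact (hq.mem_or_mem hb).resolve_left (hsq n)
    · intro h
      exact ⟨0, x, h, by simp⟩
  refine ⟨p, ⟨?_, ?_⟩, ?_, hcom⟩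
  · intro h
    rw [h, Ideal.comap_top] at hcom
    exact hq.ne_top hcom.symm
  · intro a a' h
    obtain ⟨n, b, hb, h⟩ := (hp _).1 h
    obtain ⟨k, hk⟩ := hs a
    obtain ⟨l, hl⟩ := hs a'
    have : (⟨s, hsS⟩ : S) ^ n * (⟨_, hk⟩ * ⟨_, hl⟩) ∈ q := by
      have e : (⟨s, hsS⟩ : S) ^ n * (⟨_, hk⟩ * ⟨_, hl⟩) = ⟨s, hsS⟩ ^ (k + l) * b := by
        apply Subtype.ext
        simp only [MulMemClass.coe_mul, SubmonoidClass.coe_pow, ← h]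
        ring
      rw [e]
      exact q.mul_mem_left _ hb
    rcases hq.mem_or_mem ((hq.mem_or_mem this).resolve_left (hsq n)) with h1 | h1
    · exact Or.inl ⟨k, _, h1, rfl⟩
    · exact Or.inr ⟨l, _, h1, rfl⟩
  · intro a ha
    obtain ⟨n, b, hb, h⟩ := (hp _).1 ha
    have : s ^ n * a ∈ M := by rw [h]; exact hqM hb
    rcases Ideal.IsPrime.mem_or_mem ‹_› this with h1 | h1
    · exact absurd (Ideal.IsPrime.mem_of_pow_mem ‹_› n h1) hsM
    · exact h1

/-- ZMT plus going down. -/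
lemma going_down_quasiFinite_aux {P A : Type*} [CommRing P] [IsDomain P] [IsIntegrallyClosed P]
    [CommRing A] [IsDomain A] [Algebra P A] [Algebra.FiniteType P A]
    (hinj : Function.Injective (algebraMap P A)) (M : Ideal A) [M.IsPrime]
    (hfin : Module.Finite P (A ⧸ (M.under P).map (algebraMap P A))) :
    ∃ s : A, s ∉ M ∧ (∀ x : A, ∃ m : ℕ, IsIntegral P (s ^ m * x)) ∧
    ∀ q : Ideal P, q.IsPrime → q ≤ M.comap (algebraMap P A) →
      ∃ p : Ideal A, p.IsPrime ∧ p ≤ M ∧ p.comap (algebraMap P A) = q ∧ s ∉ p := by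
  have hW : Algebra.WeaklyQuasiFiniteAt P M := by
    unfold Algebra.WeaklyQuasiFiniteAt Algebra.QuasiFiniteAt
    have : Algebra.QuasiFinite P (A ⧸ (M.under P).map (algebraMap P A)) := inferInstance
    exact .of_isLocalization (S := A ⧸ (M.under P).map (algebraMap P A))
      (M.map (Ideal.Quotient.mk ((M.under P).map (algebraMap P A)))).primeCompl
  obtain ⟨s, hsM, hsI, hs⟩ := Algebra.zariskisMainProperty_iff.1
    (Algebra.ZariskisMainProperty.of_finiteType_of_weaklyQuasiFiniteAt (R := P) M)
  refine ⟨s, hsM, hs, fun q hq hqM => ?_⟩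
  let S := integralClosure P A
  have : FaithfulSMul P S := by
    rw [faithfulSMul_iff_algebraMap_injective]
    intro x y h
    exact hinj (congrArg Subtype.val h)
  have hle : q ≤ (M.comap (algebraMap S A)).under P := by
    intro x hx
    exact hqM hx
  obtain ⟨Q, hQ, hQp, hQo⟩ := Ideal.exists_ideal_le_liesOver_of_le
    (q := (M.comap (algebraMap S A)).under P) (M.comap (algebraMap S A)) hle
  obtain ⟨p, hp, hpM, hpQ⟩ := extend_prime_aux S M s hsI hsM hs Q hQ
  refine ⟨p, hp, hpM, ?_, fun h => hsM (hpM h)⟩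
  rw [Ideal.over_def Q q, ← hpQ]
  rfl

lemma core_aux {R A : Type*} [CommRing R] [IsDomain R] [IsIntegrallyClosed R]
    [CommRing A] [IsDomain A] [Algebra R A] [Algebra.FiniteType R A]
    (m : Ideal R) (hm : (m : Set R).Infinite)
    (M : Ideal A) [M.IsPrime] (hmM : m.map (algebraMap R A) ≤ M)
    (n : ℕ) (y : Fin n → A) (hyM : ∀ i, y i ∈ M)
    (hinj : Function.Injective (aeval y : MvPolynomial (Fin n) R →ₐ[R] A))
    (hfin : ((Ideal.Quotient.mk (m.map (algebraMap R A))).comp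
      (aeval y : MvPolynomial (Fin n) R →ₐ[R] A).toRingHom).Finite)
    (g : A) (hg : g ≠ 0) :
    ∃ p : Ideal A, p.IsPrime ∧ p ≤ M ∧ p.comap (algebraMap R A) = ⊥ ∧ g ∉ p ∧
      ∀ q : Ideal A, q.IsPrime → p ≤ q → q.comap (algebraMap R A) = ⊥ → q = p := by
  have := mvPoly_integrallyClosed_aux (R := R) n
  let _ : Algebra (MvPolynomial (Fin n) R) A :=
    (aeval y : MvPolynomial (Fin n) R →ₐ[R] A).toRingHom.toAlgebra
  have hal : ∀ f : MvPolynomial (Fin n) R, algebraMap _ A f = aeval y f := fun f => rfl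
  have : IsScalarTower R (MvPolynomial (Fin n) R) A :=
    IsScalarTower.of_algebraMap_eq fun x => by simp [hal]
  have : Algebra.FiniteType (MvPolynomial (Fin n) R) A := .of_restrictScalars_finiteType R _ _
  have hle : m.map (algebraMap R A) ≤
      (M.under (MvPolynomial (Fin n) R)).map (algebraMap (MvPolynomial (Fin n) R) A) := by
    rw [Ideal.map_le_iff_le_comap]
    intro x hx
    rw [Ideal.mem_comap, IsScalarTower.algebraMap_apply R (MvPolynomial (Fin n) R) A]
    apply Ideal.mem_map_of_mem
    rw [Ideal.mem_comap, ← IsScalarTower.algebraMap_apply]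
    exact hmM (Ideal.mem_map_of_mem _ hx)
  have hF : Module.Finite (MvPolynomial (Fin n) R)
      (A ⧸ (M.under (MvPolynomial (Fin n) R)).map (algebraMap (MvPolynomial (Fin n) R) A)) := by
    have h1 : Module.Finite (MvPolynomial (Fin n) R) (A ⧸ m.map (algebraMap R A)) := by
      rw [← RingHom.finite_algebraMap]
      exact hfin
    exact Module.Finite.of_surjective
      (Ideal.Quotient.factorₐ (MvPolynomial (Fin n) R) hle).toLinearMap
      (Ideal.Quotient.factor_surjective hle)
  obtain ⟨s, hsM, hs, hgd⟩ := going_down_quasiFinite_aux (P := MvPolynomial (Fin n) R) hinj M hF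
  have hs0 : s ≠ 0 := fun h => hsM (h ▸ M.zero_mem)
  -- a nonzero polynomial in the ideal generated by `g`
  obtain ⟨h, hh0, hhg⟩ : ∃ h : MvPolynomial (Fin n) R, h ≠ 0 ∧
      algebraMap _ A h ∈ Ideal.span {g} := by
    obtain ⟨k, hk⟩ := hs g
    have := Ideal.comap_lt_comap_of_integral_mem_sdiff (R := MvPolynomial (Fin n) R)
      (I := (⊥ : Ideal A)) (J := Ideal.span {g}) bot_le
      (x := s ^ k * g) ⟨Ideal.mul_mem_left _ _ (Ideal.mem_span_singleton_self g), by
        simp [hs0, hg]⟩ hk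
    obtain ⟨-, h, h1, h2⟩ := SetLike.lt_iff_le_and_exists.1 this
    refine ⟨h, ?_, h1⟩
    rintro rfl
    exact h2 (Ideal.zero_mem _)
  obtain ⟨a, ham, hah⟩ : ∃ a : Fin n → R, (∀ i, a i ∈ m) ∧ eval a h ≠ 0 := by
    by_contra! H
    exact hh0 (MvPolynomial.funext_set (fun _ => (m : Set R)) (fun _ => hm) fun x hx => by
      simpa using H x fun i => hx i trivial)
  have hdiff : ∀ (J : Ideal A), (∀ i, y i - algebraMap R A (a i) ∈ J) →
      ∀ f : MvPolynomial (Fin n) R, aeval y f - algebraMap R A (eval a f) ∈ J := by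
    intro J hJ f
    have : ((Ideal.Quotient.mkₐ R J).comp (aeval y)) =
        ((Algebra.ofId R (A ⧸ J)).comp (aeval a)) := by
      ext i
      simp only [AlgHom.comp_apply, aeval_X, Ideal.Quotient.mkₐ_eq_mk]
      exact (Ideal.Quotient.eq).2 (hJ i)
    have := DFunLike.congr_fun this f
    simp only [AlgHom.comp_apply, Ideal.Quotient.mkₐ_eq_mk] at this
    exact (Ideal.Quotient.eq).1 this
  have hker : RingHom.ker (eval a) ≤ M.comap (algebraMap (MvPolynomial (Fin n) R) A) := by
    intro f hf
    have := hdiff M (fun i => M.sub_mem (hyM i) (hmM (Ideal.mem_map_of_mem _ (ham i)))) f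
    rw [(RingHom.mem_ker).1 hf, map_zero, sub_zero] at this
    exact this
  obtain ⟨p, hp, hpM, hpk, hsp⟩ := hgd (RingHom.ker (eval a)) (RingHom.ker_isPrime _) hker
  have hpk' : ∀ f : MvPolynomial (Fin n) R, aeval y f ∈ p ↔ eval a f = 0 := by
    intro f
    rw [← RingHom.mem_ker, ← hpk]
    rfl
  have hpy : ∀ i, y i - algebraMap R A (a i) ∈ p := by
    intro i
    have := (hpk' (X i - C (a i))).2 (by simp)
    simpa using this
  refine ⟨p, hp, hpM, ?_, ?_, ?_⟩
  · rw [eq_bot_iff]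
    intro r hr
    have := (hpk' (C r)).1 (by simpa using hr)
    simpa using this
  · intro hgp
    exact hah ((hpk' h).1 ((Ideal.span_singleton_le_iff_mem p).2 hgp hhg))
  · intro q hq hpq hq0
    by_contra hne
    obtain ⟨-, x, hxq, hxp⟩ := SetLike.lt_iff_le_and_exists.1 (lt_of_le_of_ne hpq (Ne.symm hne))
    obtain ⟨k, hk⟩ := hs x
    have := Ideal.comap_lt_comap_of_integral_mem_sdiff (R := MvPolynomial (Fin n) R)
      (I := p) (J := q) hpq
      (x := s ^ k * x) ⟨Ideal.mul_mem_left _ _ hxq, fun h => by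
        rcases hp.mem_or_mem h with h | h
        · exact hsp (hp.mem_of_pow_mem _ h)
        · exact hxp h⟩ hk
    obtain ⟨-, f, h1, h2⟩ := SetLike.lt_iff_le_and_exists.1 this
    apply h2
    refine (hpk' f).2 ?_
    have h3 := hdiff q (fun i => hpq (hpy i)) f
    have h4 : eval a f ∈ q.comap (algebraMap R A) := by
      have := q.sub_mem h1 h3
      rw [hal, sub_sub_cancel] at this
      exact this
    rw [hq0] at h4
    simpa using h4

lemma noether_at_point_aux {k B : Type*} [Field k] [CommRing B] [Algebra k B]
    [Algebra.FiniteType k B] (N : Ideal B) [hN : N.IsMaximal] :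
    ∃ (n : ℕ) (y : Fin n → B), (∀ i, y i ∈ N) ∧
      Function.Injective (aeval y : MvPolynomial (Fin n) k →ₐ[k] B) ∧
      (aeval y : MvPolynomial (Fin n) k →ₐ[k] B).toRingHom.Finite := by
  have : Nontrivial B := ⟨0, 1, fun h => hN.ne_top
    ((Ideal.eq_top_iff_one N).2 (h ▸ N.zero_mem))⟩
  obtain ⟨n, φ, hφ, hφi⟩ := exists_integral_inj_algHom_of_fg k B
  let _ : Field (B ⧸ N) := Ideal.Quotient.field N
  have hfinN : Module.Finite k (B ⧸ N) := finite_of_finite_type_of_isJacobsonRing k (B ⧸ N)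
  have hx : ∀ i : Fin n, ∃ h : Polynomial k, h.Monic ∧ h.natDegree ≠ 0 ∧
      Polynomial.aeval (φ (X i)) h ∈ N := by
    intro i
    have hi : IsIntegral k (Ideal.Quotient.mkₐ k N (φ (X i))) := Algebra.IsIntegral.isIntegral _
    refine ⟨_, minpoly.monic hi, (minpoly.natDegree_pos hi).ne', ?_⟩
    have := minpoly.aeval k (Ideal.Quotient.mkₐ k N (φ (X i)))
    rw [Polynomial.aeval_algHom_apply] at this
    exact Ideal.Quotient.eq_zero_iff_mem.1 this
  choose h hmon hdeg hN' using hx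
  have hxind : AlgebraicIndependent k (fun i => φ (X i)) := by
    have : (aeval fun i => φ (X i)) = φ := by ext; simp
    rw [AlgebraicIndependent, this]
    exact hφ
  have htr : ∀ i, Transcendental k (h i) := fun i => by
    have := (Polynomial.transcendental_X (R := k)).aeval (h i) (hdeg i)
    have := this (by simp [(hmon i).leadingCoeff])
    simpa using this
  have hyind := hxind.polynomial_aeval_of_transcendental htr
  let y : Fin n → B := fun i => Polynomial.aeval (φ (X i)) (h i)
  refine ⟨n, y, hN', hyind, ?_⟩
  let ψ : MvPolynomial (Fin n) k →ₐ[k] B := aeval y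
  let _ : Algebra (MvPolynomial (Fin n) k) B := ψ.toRingHom.toAlgebra
  have hal : ∀ f : MvPolynomial (Fin n) k, algebraMap _ B f = ψ f := fun f => rfl
  have : IsScalarTower k (MvPolynomial (Fin n) k) B :=
    IsScalarTower.of_algebraMap_eq fun x => by simp [hal]
  have : Algebra.FiniteType (MvPolynomial (Fin n) k) B := .of_restrictScalars_finiteType k _ _
  let S := integralClosure (MvPolynomial (Fin n) k) B
  have hXS : ∀ i, φ (X i) ∈ S := by
    intro i
    refine ⟨(h i).map (algebraMap k _) - Polynomial.C (X i), ?_, ?_⟩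
    · apply ((hmon i).map _).sub_of_left
      refine lt_of_le_of_lt Polynomial.degree_C_le ?_
      rw [(hmon i).degree_map]
      exact Polynomial.natDegree_pos_iff_degree_pos.1 (Nat.pos_of_ne_zero (hdeg i))
    · rw [← Polynomial.aeval_def, map_sub, Polynomial.aeval_map_algebraMap, Polynomial.aeval_C, hal]
      simp [ψ, y]
  have hrange : ∀ f, φ f ∈ S := by
    intro f
    have : φ f = aeval (fun i => φ (X i)) f := by
      have : (aeval fun i => φ (X i)) = φ := by ext; simp
      rw [this]
    rw [this]
    have : (aeval (fun i => φ (X i)) f : B) = ((aeval (fun i => (⟨φ (X i), hXS i⟩ : S)) f : S) : B) := by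
      have e : (aeval (fun i => φ (X i)) : MvPolynomial (Fin n) k →ₐ[k] B) =
        (S.val.restrictScalars k).comp (aeval (fun i => (⟨φ (X i), hXS i⟩ : S))) := by
        ext; simp
      rw [e]; rfl
    rw [this]
    exact SetLike.coe_mem _
  have : Algebra.IsIntegral (MvPolynomial (Fin n) k) B := by
    constructor
    intro b
    have h1 : IsIntegral S b := by
      obtain ⟨q, hq, hqb⟩ := hφi b
      let θ : MvPolynomial (Fin n) k →+* S := φ.toRingHom.codRestrict S hrange
      refine ⟨q.map θ, hq.map _, ?_⟩
      rw [Polynomial.eval₂_map]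
      exact hqb
    exact isIntegral_trans (R := MvPolynomial (Fin n) k) (A := S) b h1
  have h3 : Module.Finite (MvPolynomial (Fin n) k) B := Algebra.IsIntegral.finite
  exact h3

lemma exists_dvd_all_aux {R ι : Type*} [CommRing R] [IsDomain R] [ValuationRing R] (c : ι → R)
    (s : Finset ι) (hs : s.Nonempty) : ∃ i ∈ s, ∀ j ∈ s, c i ∣ c j := by
  induction hs using Finset.Nonempty.cons_induction with
  | singleton a => exact ⟨a, by simp, by simp⟩
  | cons a s ha hs ih =>
    obtain ⟨i, hi, h⟩ := ih
    rcases ValuationRing.dvd_total (c a) (c i) with h1 | h1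
    · refine ⟨a, by simp, ?_⟩
      intro j hj
      rcases Finset.mem_cons.1 hj with rfl | hj
      · exact dvd_rfl
      · exact h1.trans (h j hj)
    · refine ⟨i, by simp [hi], ?_⟩
      intro j hj
      rcases Finset.mem_cons.1 hj with rfl | hj
      · exact h1
      · exact h j hj

lemma primitive_aux {R σ : Type*} [CommRing R] [IsDomain R] [ValuationRing R]
    (f : MvPolynomial σ R) (hf : f ≠ 0) :
    ∃ (c : R) (f' : MvPolynomial σ R) (i : σ →₀ ℕ), c ≠ 0 ∧ f = C c * f' ∧ f'.coeff i = 1 := by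
  obtain ⟨i, hi, h⟩ := exists_dvd_all_aux (fun i => f.coeff i) f.support
    (MvPolynomial.support_nonempty.2 hf)
  have hc : f.coeff i ≠ 0 := MvPolynomial.mem_support_iff.1 hi
  obtain ⟨f', hf'⟩ := (MvPolynomial.C_dvd_iff_dvd_coeff (f.coeff i) f).2 (by
    intro j
    by_cases hj : j ∈ f.support
    · exact h j hj
    · rw [MvPolynomial.notMem_support_iff.1 hj]; exact dvd_zero _)
  refine ⟨f.coeff i, f', i, hc, hf', ?_⟩
  have := congrArg (MvPolynomial.coeff i) hf'
  rw [MvPolynomial.coeff_C_mul] at this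
  exact mul_left_cancel₀ hc (by rw [← this, mul_one])

lemma lift_noether_aux {R A : Type*} [CommRing R] [IsDomain R] [ValuationRing R]
    [CommRing A] [IsDomain A] [Algebra R A] [Algebra.FiniteType R A]
    (hinj : Function.Injective (algebraMap R A))
    (M : Ideal A)
    (hmM : (IsLocalRing.maximalIdeal R).map (algebraMap R A) ≤ M)
    (hMmax : (M.map (Ideal.Quotient.mk
        ((IsLocalRing.maximalIdeal R).map (algebraMap R A)))).IsMaximal) :
    ∃ (n : ℕ) (y : Fin n → A), (∀ i, y i ∈ M) ∧
      Function.Injective (aeval y : MvPolynomial (Fin n) R →ₐ[R] A) ∧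
      ((Ideal.Quotient.mk ((IsLocalRing.maximalIdeal R).map (algebraMap R A))).comp
      (aeval y : MvPolynomial (Fin n) R →ₐ[R] A).toRingHom).Finite := by
  set m := IsLocalRing.maximalIdeal R with hm
  let _ : Field (R ⧸ m) := Ideal.Quotient.field m
  let B := A ⧸ m.map (algebraMap R A)
  have : Algebra.FiniteType R B := inferInstance
  have : Algebra.FiniteType (R ⧸ m) B := .of_restrictScalars_finiteType R _ _
  obtain ⟨n, z, hzN, hzi, hzf⟩ := noether_at_point_aux (k := R ⧸ m) (B := B)
    (M.map (Ideal.Quotient.mk (m.map (algebraMap R A))))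
  choose y hy using fun i => Ideal.Quotient.mk_surjective (z i)
  have hcomp : (Ideal.Quotient.mk (m.map (algebraMap R A))).comp
      (aeval y : MvPolynomial (Fin n) R →ₐ[R] A).toRingHom =
      (aeval z : MvPolynomial (Fin n) (R ⧸ m) →ₐ[R ⧸ m] B).toRingHom.comp
        (MvPolynomial.map (Ideal.Quotient.mk m)) := by
    apply MvPolynomial.ringHom_ext
    · intro r
      simp
      rfl
    · intro i
      simp [hy]
  refine ⟨n, y, ?_, ?_, ?_⟩
  · intro i
    have := hzN i
    rw [← hy i, ← Ideal.mem_comap, Ideal.comap_map_of_surjective _ Ideal.Quotient.mk_surjective,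
      ← RingHom.ker_eq_comap_bot, Ideal.mk_ker, sup_eq_left.2 hmM] at this
    exact this
  · rw [injective_iff_map_eq_zero]
    intro f hf0
    by_contra hf
    obtain ⟨c, f', i, hc, rfl, hi⟩ := primitive_aux f hf
    rw [map_mul, aeval_C] at hf0
    have hf1 : aeval y f' = 0 := (mul_eq_zero.1 hf0).resolve_left
      fun h => hc (hinj (by rw [h, map_zero]))
    have h2 := DFunLike.congr_fun hcomp f'
    have h3 : aeval z (MvPolynomial.map (Ideal.Quotient.mk m) f') = 0 := by
      refine Eq.trans h2.symm ?_
      simp [hf1]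
    have h4 := (injective_iff_map_eq_zero _).1 hzi _ h3
    have h5 := congrArg (MvPolynomial.coeff i) h4
    rw [MvPolynomial.coeff_map, hi] at h5
    simp at h5
  · rw [hcomp]
    exact hzf.comp (RingHom.Finite.of_surjective _
      (MvPolynomial.map_surjective _ Ideal.Quotient.mk_surjective))

lemma maximal_infinite_aux {R : Type*} [CommRing R] [IsDomain R] [IsLocalRing R]
    (hrank : ringKrullDim R = 1) : (IsLocalRing.maximalIdeal R : Set R).Infinite := by
  have hnf : ¬ IsField R := fun h => by
    have := ringKrullDim_eq_zero_of_isField h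
    rw [this] at hrank
    exact zero_ne_one hrank
  obtain ⟨t, htm, ht0⟩ := Submodule.exists_mem_ne_zero_of_ne_bot
    (fun h => hnf (IsLocalRing.isField_iff_maximalIdeal_eq.2 h))
  intro hfin
  have : Infinite R := by
    by_contra h
    rw [not_infinite_iff_finite] at h
    exact hnf (Finite.isField_of_domain R)
  refine Set.infinite_of_injective_forall_mem (f := fun r : R => t * r)
    (mul_right_injective₀ ht0) (fun r => Ideal.mul_mem_right r _ htm) hfin

lemma map_maximal_aux {R A : Type*} [CommRing R] [IsDomain R]
    [CommRing A] [IsDomain A] [Algebra R A]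
    (p : Ideal A) (hp : p.IsPrime) (hp0 : p.comap (algebraMap R A) = ⊥)
    (hmax : ∀ q : Ideal A, q.IsPrime → p ≤ q → q.comap (algebraMap R A) = ⊥ → q = p) :
    (p.map (Algebra.TensorProduct.includeRight :
        A →ₐ[R] TensorProduct R (FractionRing R) A)).IsMaximal := by
  let T := TensorProduct R (FractionRing R) A
  let _ : Algebra A T := Algebra.TensorProduct.rightAlgebra
  let S := Algebra.algebraMapSubmonoid A (nonZeroDivisors R)
  have hloc : IsLocalization S T :=
    IsLocalization.tensorRight (FractionRing R) (nonZeroDivisors R)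
  have hmap : p.map (Algebra.TensorProduct.includeRight :
        A →ₐ[R] TensorProduct R (FractionRing R) A) = p.map (algebraMap A T) := rfl
  rw [hmap]
  have key : ∀ q : Ideal A, q.comap (algebraMap R A) = ⊥ ↔ Disjoint (S : Set A) (q : Set A) := by
    intro q
    rw [Set.disjoint_left]
    constructor
    · rintro h _ ⟨r, hr, rfl⟩ hq
      have : r ∈ q.comap (algebraMap R A) := hq
      rw [h] at this
      exact nonZeroDivisors.ne_zero hr (by simpa using this)
    · intro h
      rw [eq_bot_iff]
      intro r hr
      by_contra h0
      exact h ⟨r, mem_nonZeroDivisors_of_ne_zero (by simpa using h0), rfl⟩ hr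
  have hpd := (key p).1 hp0
  have hpm : (p.map (algebraMap A T)).IsPrime := IsLocalization.isPrime_of_isPrime_disjoint S T p hp hpd
  obtain ⟨Q, hQ, hle⟩ := Ideal.exists_le_maximal _ hpm.ne_top
  have hQp := hQ.isPrime
  have h1 := (IsLocalization.isPrime_iff_isPrime_disjoint S T Q).1 hQp
  have h2 := hmax _ h1.1 (Ideal.map_le_iff_le_comap.1 hle) ((key _).2 h1.2)
  have h3 : p.map (algebraMap A T) = Q := by
    rw [← h2]
    exact IsLocalization.map_under S T Q
  rw [h3]
  exact hQ

end Helpers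


/-- **Existence and density of closed-point lifts.**
Let `R` be a valuation ring of rank 1 (a valuation domain of Krull dimension 1) with maximal
ideal `m` and fraction field `K`, and let `A` be an integral domain that is a finitely
generated `R`-algebra with injective structure map.  Let `M` be a prime ideal of `A`
containing `m·A` whose image in `A ⧸ mA` is maximal (a closed point of the special fiber).
Then for every nonzero `g ∈ A` there is a prime `p ⊆ M` with `p ∩ R = (0)`, `g ∉ p`, whose
extension to `A ⊗_R K` is a maximal ideal; in particular the closed points of the generic
fiber specializing to `M` are Zariski dense in the generic fiber. -/
theorem closed_point_lifts_dense_over_rank_one_valuation_ring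
    {R A : Type u} [CommRing R] [IsDomain R] [ValuationRing R]
    (hrank : ringKrullDim R = 1)
    [CommRing A] [IsDomain A] [Algebra R A] [Algebra.FiniteType R A]
    (hinj : Function.Injective (algebraMap R A))
    (M : Ideal A) (hM : M.IsPrime)
    (hmM : (IsLocalRing.maximalIdeal R).map (algebraMap R A) ≤ M)
    (hMmax : (M.map (Ideal.Quotient.mk
        ((IsLocalRing.maximalIdeal R).map (algebraMap R A)))).IsMaximal)
    (g : A) (hg : g ≠ 0) :
    ∃ p : Ideal A, p.IsPrime ∧ p ≤ M ∧ p.comap (algebraMap R A) = ⊥ ∧ g ∉ p ∧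
      (p.map (Algebra.TensorProduct.includeRight :
        A →ₐ[R] TensorProduct R (FractionRing R) A)).IsMaximal := by
  have hMp := hM
  obtain ⟨n, y, hyM, hyi, hyf⟩ := lift_noether_aux hinj M hmM hMmax
  obtain ⟨p, hp, hpM, hp0, hgp, hmax⟩ := core_aux (IsLocalRing.maximalIdeal R)
    (maximal_infinite_aux hrank) M hmM n y hyM hyi hyf g hg
  exact ⟨p, hp, hpM, hp0, hgp, map_maximal_aux p hp hp0 hmax⟩
end

section
/- Principle of continuity over rank-1 valuation rings (affine case): let R be a valuation ring of rank 1 with maximal ideal m, fraction field K and residue field k = R/m, and let A be a smooth R-algebra. Let I, I' be ideals of A such that A/I and A/I' are flat R-modules and A/(I + I') is a finitely generated R-module. Write A_K = A ⊗_R K, A_k = A ⊗_R k, and let I_K, I'_K (resp. I_k, I'_k) denote the extensions of I, I' to A_K (resp. A_k). Then for every i ≥ 0 the A_K-module Tor_i^{A_K}(A_K/I_K, A_K/I'_K) is a finite-dimensional K-vector space, the A_k-module Tor_i^{A_k}(A_k/I_k, A_k/I'_k) is a finite-dimensional k-vector space, both vanish for all sufficiently large i, and the intersection numbers agree: Σ_i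 (−1)^i dim_K Tor_i^{A_K}(A_K/I_K, A_K/I'_K) = Σ_i (−1)^i dim_k Tor_i^{A_k}(A_k/I_k, A_k/I'_k). -/
open CategoryTheory

/-- `torObj B I J i` is the `i`-th Tor module `Tor_i^B (B/I, B/J)`, as an object of the
category of `B`-modules (computed as the left derived functor of the tensor product). -/
noncomputable def torObj (B : Type u) [CommRing B] (I J : Ideal B) (i : ℕ) : ModuleCat.{u} B :=
  ((Tor (ModuleCat.{u} B) i).obj (ModuleCat.of B (B ⧸ I))).obj (ModuleCat.of B (B ⧸ J))

/-- The dimension over `K` of a module over a `K`-algebra `B`, via restriction of scalars. -/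
noncomputable def finrankRestrict (K B : Type u) [CommRing K] [CommRing B] [Algebra K B]
    (M : ModuleCat.{u} B) : ℕ :=
  letI : Module K M := Module.compHom M (algebraMap K B)
  Module.finrank K M

/-- Finite dimensionality over `K` of a module over a `K`-algebra `B`,
via restriction of scalars. -/
def finiteRestrict (K B : Type u) [CommRing K] [CommRing B] [Algebra K B]
    (M : ModuleCat.{u} B) : Prop :=
  letI : Module K M := Module.compHom M (algebraMap K B)
  Module.Finite K M

namespace PoC

section flatness

variable {R : Type u} [CommRing R]

theorem pure_inj_aux {Q P U : Type u} [AddCommGroup Q] [Module R Q] [AddCommGroup P] [Module R P]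
    [AddCommGroup U] [Module R U] [Module.Flat R P] (j : U →ₗ[R] P) (π : P →ₗ[R] Q)
    (hj : Function.Injective j) (hjπ : Function.Exact j π) (hπ : Function.Surjective π)
    {X Y Z : Type u}
    [AddCommGroup X] [Module R X] [AddCommGroup Y] [Module R Y] [AddCommGroup Z] [Module R Z]
    (f : X →ₗ[R] Y) (g : Y →ₗ[R] Z) (hf : Function.Injective f) (hfg : Function.Exact f g)
    (hg : Function.Surjective g) [Module.Flat R Z] :
    Function.Injective (f.lTensor Q) := by
  rw [injective_iff_map_eq_zero]
  intro u hu
  obtain ⟨p, rfl⟩ := LinearMap.rTensor_surjective X hπ u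
  have h1 : (π.rTensor Y) (f.lTensor P p) = 0 := by
    rw [← hu, ← LinearMap.comp_apply, ← LinearMap.comp_apply, LinearMap.rTensor_comp_lTensor,
      LinearMap.lTensor_comp_rTensor]
  obtain ⟨w, hw⟩ := (rTensor_exact Y hjπ hπ _).1 h1
  have h2 : (j.rTensor Z) (g.lTensor U w) = 0 := by
    have : (j.rTensor Z) (g.lTensor U w) = g.lTensor P (j.rTensor Y w) := by
      rw [← LinearMap.comp_apply, ← LinearMap.comp_apply, LinearMap.rTensor_comp_lTensor,
        LinearMap.lTensor_comp_rTensor]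
    rw [this, hw]
    exact (lTensor_exact P hfg hg).apply_apply_eq_zero p
  have h3 : g.lTensor U w = 0 :=
    (injective_iff_map_eq_zero _).1
      (Module.Flat.rTensor_preserves_injective_linearMap (M := Z) j hj) _ h2
  obtain ⟨x, hx⟩ := (lTensor_exact U hfg hg _).1 h3
  have h4 : f.lTensor P (j.rTensor X x) = f.lTensor P p := by
    rw [← hw, ← hx, ← LinearMap.comp_apply, ← LinearMap.comp_apply, LinearMap.rTensor_comp_lTensor,
        LinearMap.lTensor_comp_rTensor]
  have h5 := Module.Flat.lTensor_preserves_injective_linearMap (M := P) f hf h4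
  rw [← h5]
  exact (rTensor_exact X hjπ hπ).apply_apply_eq_zero x

theorem pure_inj_ker {Q P : Type u} [AddCommGroup Q] [Module R Q] [AddCommGroup P] [Module R P]
    [Module.Flat R P] (π : P →ₗ[R] Q) (hπ : Function.Surjective π)
    {X Y Z : Type u}
    [AddCommGroup X] [Module R X] [AddCommGroup Y] [Module R Y] [AddCommGroup Z] [Module R Z]
    (f : X →ₗ[R] Y) (g : Y →ₗ[R] Z) (hf : Function.Injective f) (hfg : Function.Exact f g)
    (hg : Function.Surjective g) [Module.Flat R Z] :
    Function.Injective (f.lTensor Q) :=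
  pure_inj_aux (LinearMap.ker π).subtype π (Submodule.injective_subtype _)
    (LinearMap.exact_subtype_ker_map π) hπ f g hf hfg hg

/-- Tensoring a short exact sequence with flat cokernel stays injective. -/
theorem pure_inj (Q : Type u) [AddCommGroup Q] [Module R Q] {X Y Z : Type u}
    [AddCommGroup X] [Module R X] [AddCommGroup Y] [Module R Y] [AddCommGroup Z] [Module R Z]
    (f : X →ₗ[R] Y) (g : Y →ₗ[R] Z) (hf : Function.Injective f) (hfg : Function.Exact f g)
    (hg : Function.Surjective g) [Module.Flat R Z] :
    Function.Injective (f.lTensor Q) :=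
  pure_inj_ker (P := Q →₀ R)
    (Finsupp.linearCombination R id)
    (Finsupp.linearCombination_id_surjective R Q) f g hf hfg hg

theorem flat_left {X Y Z : Type u}
    [AddCommGroup X] [Module R X] [AddCommGroup Y] [Module R Y] [AddCommGroup Z] [Module R Z]
    (f : X →ₗ[R] Y) (g : Y →ₗ[R] Z) (hf : Function.Injective f) (hfg : Function.Exact f g)
    (hg : Function.Surjective g) [Module.Flat R Y] [Module.Flat R Z] :
    Module.Flat R X := by
  rw [Module.Flat.iff_rTensor_preserves_injective_linearMap]
  intro U P _ _ _ _ i hi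
  have h1 : Function.Injective ((i.rTensor Y) ∘ₗ (f.lTensor U)) := 
    (Module.Flat.rTensor_preserves_injective_linearMap (M := Y) i hi).comp
      (pure_inj U f g hf hfg hg)
  rw [LinearMap.rTensor_comp_lTensor, ← LinearMap.lTensor_comp_rTensor] at h1
  exact Function.Injective.of_comp h1

theorem flat_mid {X Y Z : Type u}
    [AddCommGroup X] [Module R X] [AddCommGroup Y] [Module R Y] [AddCommGroup Z] [Module R Z]
    (f : X →ₗ[R] Y) (g : Y →ₗ[R] Z) (hf : Function.Injective f) (hfg : Function.Exact f g)
    (hg : Function.Surjective g) [Module.Flat R X] [Module.Flat R Z] :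
    Module.Flat R Y := by
  rw [Module.Flat.iff_rTensor_preserves_injective_linearMap]
  intro U P _ _ _ _ i hi
  rw [injective_iff_map_eq_zero]
  intro u hu
  have h2 : (i.rTensor Z) (g.lTensor U u) = 0 := by
    have : (i.rTensor Z) (g.lTensor U u) = g.lTensor P (i.rTensor Y u) := by
      rw [← LinearMap.comp_apply, ← LinearMap.comp_apply, LinearMap.rTensor_comp_lTensor,
        LinearMap.lTensor_comp_rTensor]
    rw [this, hu, map_zero]
  have h3 : g.lTensor U u = 0 :=
    (injective_iff_map_eq_zero _).1
      (Module.Flat.rTensor_preserves_injective_linearMap (M := Z) i hi) _ h2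
  obtain ⟨x, rfl⟩ := (lTensor_exact U hfg hg _).1 h3
  have h4 : f.lTensor P (i.rTensor X x) = 0 := by
    rw [← hu, ← LinearMap.comp_apply, ← LinearMap.comp_apply, LinearMap.rTensor_comp_lTensor,
        LinearMap.lTensor_comp_rTensor]
  have h5 := (injective_iff_map_eq_zero _).1 (pure_inj P f g hf hfg hg) _ h4
  have h6 := (injective_iff_map_eq_zero _).1
    (Module.Flat.rTensor_preserves_injective_linearMap (M := X) i hi) _ h5
  rw [h6, map_zero]

/-- Exactness is preserved by tensoring, if the last cokernel is flat. -/
theorem exact_lTensor (Q : Type u) [AddCommGroup Q] [Module R Q] {X Y Z : Type u}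
    [AddCommGroup X] [Module R X] [AddCommGroup Y] [Module R Y] [AddCommGroup Z] [Module R Z]
    (f : X →ₗ[R] Y) (g : Y →ₗ[R] Z) (hfg : Function.Exact f g)
    [Module.Flat R (Z ⧸ LinearMap.range g)] :
    Function.Exact (f.lTensor Q) (g.lTensor Q) := by
  have hinj : Function.Injective ((LinearMap.range g).subtype.lTensor Q) :=
    pure_inj Q _ (LinearMap.range g).mkQ (Submodule.injective_subtype _)
      (LinearMap.exact_subtype_mkQ _) (Submodule.mkQ_surjective _)
  have hex : Function.Exact f g.rangeRestrict := by
    intro y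
    rw [← hfg y]
    exact Subtype.ext_iff
  have h := lTensor_exact Q hex g.surjective_rangeRestrict
  intro y
  have hy : g.lTensor Q y =
      (LinearMap.range g).subtype.lTensor Q (g.rangeRestrict.lTensor Q y) := by
    rw [← LinearMap.comp_apply, ← LinearMap.lTensor_comp]
    rfl
  rw [← h y, hy]
  exact ⟨fun h => hinj (h.trans (map_zero _).symm), fun h => by rw [h, map_zero]⟩

/-- Schanuel: if `N` has a flat resolution of length one then kernels of flat covers are flat. -/
theorem flat_ker_of_resolution {G' G F N : Type u}
    [AddCommGroup G'] [Module R G'] [AddCommGroup G] [Module R G]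
    [AddCommGroup F] [Module R F] [AddCommGroup N] [Module R N]
    [Module.Flat R G'] [Module.Flat R G] [Module.Flat R F]
    (i : G' →ₗ[R] G) (p : G →ₗ[R] N) (hi : Function.Injective i) (hip : Function.Exact i p)
    (hp : Function.Surjective p) (q : F →ₗ[R] N) (hq : Function.Surjective q) :
    Module.Flat R (LinearMap.ker q) := by
  let E : Submodule R (F × G) := LinearMap.ker (q.coprod (-p))
  have hE : ∀ x : F × G, x ∈ E ↔ q x.1 = p x.2 := by
    intro x
    simp [E, LinearMap.mem_ker, ← sub_eq_add_neg, sub_eq_zero]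
  -- G' → E → F
  let a : G' →ₗ[R] E := LinearMap.codRestrict E (LinearMap.inr R F G ∘ₗ i) (by
    intro c
    rw [hE]
    simpa using (hip.apply_apply_eq_zero c).symm)
  let b : E →ₗ[R] F := LinearMap.fst R F G ∘ₗ E.subtype
  have hE_flat : Module.Flat R E := by
    refine flat_mid a b ?_ ?_ ?_
    · intro x y hxy
      have := congrArg (fun z : E => z.1.2) hxy
      exact hi this
    · rintro ⟨⟨x, y⟩, hxy⟩
      rw [hE] at hxy
      constructor
      · intro h
        have hx : x = 0 := h
        subst hx
        simp only [map_zero] at hxy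
        obtain ⟨c, hc⟩ := (hip y).1 hxy.symm
        exact ⟨c, Subtype.ext (Prod.ext rfl hc)⟩
      · rintro ⟨c, hc⟩
        have := congrArg (fun z : E => z.1.1) hc
        exact this.symm
    · intro x
      obtain ⟨y, hy⟩ := hp (q x)
      exact ⟨⟨(x, y), (hE _).2 hy.symm⟩, rfl⟩
  let a' : LinearMap.ker q →ₗ[R] E :=
    LinearMap.codRestrict E (LinearMap.inl R F G ∘ₗ (LinearMap.ker q).subtype) (by
      intro c
      rw [hE]
      simp)
  let b' : E →ₗ[R] G := LinearMap.snd R F G ∘ₗ E.subtype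
  refine flat_left a' b' ?_ ?_ ?_
  · intro x y hxy
    have := congrArg (fun z : E => z.1.1) hxy
    exact Subtype.ext this
  · rintro ⟨⟨x, y⟩, hxy⟩
    rw [hE] at hxy
    constructor
    · intro h
      have hy : y = 0 := h
      subst hy
      simp only [map_zero] at hxy
      exact ⟨⟨x, hxy⟩, Subtype.ext rfl⟩
    · rintro ⟨c, hc⟩
      have := congrArg (fun z : E => z.1.2) hc
      exact this.symm
  · intro y
    obtain ⟨x, hx⟩ := hq (p y)
    exact ⟨⟨(x, y), (hE _).2 hx⟩, rfl⟩

end flatness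

end PoC

namespace PoC

section weakdim

open TensorProduct

/-- `WD S n`: every `n`-th syzygy of flat modules is flat (weak dimension at most `n`). -/
def WD (S : Type u) [CommRing S] (n : ℕ) : Prop :=
  ∀ (F : ℕ → Type u) [∀ i, AddCommGroup (F i)] [∀ i, Module S (F i)] [∀ i, Module.Flat S (F i)]
    (d : ∀ i, F (i + 1) →ₗ[S] F i), (∀ i, Function.Exact (d (i + 1)) (d i)) →
    Module.Flat S (F n ⧸ LinearMap.range (d n))

theorem WD.succ {S : Type u} [CommRing S] {n : ℕ} (h : WD S n) : WD S (n + 1) := by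
  intro F _ _ _ d hd
  exact h (fun i => F (i + 1)) (fun i => d (i + 1)) (fun i => hd (i + 1))

theorem WD.mono {S : Type u} [CommRing S] {n m : ℕ} (h : WD S n) (hnm : n ≤ m) : WD S m := by
  induction hnm with
  | refl => exact h
  | step _ ih => exact ih.succ

theorem WD.field {k : Type u} [Field k] : WD k 0 := by
  intro F _ _ _ d hd
  infer_instance

theorem WD.over {S B : Type u} [CommRing S] [CommRing B] [Algebra S B] {n : ℕ} (h : WD S n)
    (F : ℕ → Type u) [∀ i, AddCommGroup (F i)] [∀ i, Module B (F i)] [∀ i, Module S (F i)]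
    [∀ i, IsScalarTower S B (F i)] [∀ i, Module.Flat S (F i)]
    (d : ∀ i, F (i + 1) →ₗ[B] F i) (hd : ∀ i, Function.Exact (d (i + 1)) (d i)) :
    Module.Flat S (F n ⧸ LinearMap.range (d n)) := by
  have h1 := h F (fun i => (d i).restrictScalars S) (fun i => hd i)
  have h2 : Module.Flat S (F n ⧸ (LinearMap.range (d n)).restrictScalars S) := h1
  exact Module.Flat.of_linearEquiv
    (Submodule.Quotient.restrictScalarsEquiv S (LinearMap.range (d n))).symm

theorem WD.transfer {S B : Type u} [CommRing S] [CommRing B] [Algebra S B] [Module.Flat S B]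
    [Algebra.FormallyUnramified S B] [Algebra.EssFiniteType S B] {n : ℕ} (h : WD S n) :
    WD B n := by
  intro F _ _ _ d hd
  let : ∀ i, Module S (F i) := fun i => Module.compHom (F i) (algebraMap S B)
  have : ∀ i, IsScalarTower S B (F i) := fun i =>
    ⟨fun s b x => by rw [Algebra.smul_def, mul_smul]; rfl⟩
  have : ∀ i, Module.Flat S (F i) := fun i => Module.Flat.trans S B (F i)
  have := h.over F d hd
  exact Algebra.FormallyUnramified.flat_of_restrictScalars S B _

theorem WD.of_ringEquiv {S B : Type u} [CommRing S] [CommRing B] (e : S ≃+* B) {n : ℕ}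
    (h : WD S n) : WD B n := by
  let := e.toRingHom.toAlgebra
  let e' : S ≃ₐ[S] B := AlgEquiv.ofRingEquiv (f := e) (fun _ => rfl)
  have : Algebra.Etale S B := Algebra.Etale.of_equiv e'
  exact h.transfer

section poly

variable {S : Type u} [CommRing S] (N : Type u) [AddCommGroup N] [Module S N]
  [Module (Polynomial S) N] [IsScalarTower S (Polynomial S) N]

open Polynomial

noncomputable def polyX : N →ₗ[S] N := (LinearMap.lsmul S[X] N X).restrictScalars S

noncomputable def polyP : S[X] ⊗[S] N →ₗ[S[X]] N := LinearMap.liftBaseChange S[X] LinearMap.id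

noncomputable def polyI : S[X] ⊗[S] N →ₗ[S[X]] S[X] ⊗[S] N :=
  LinearMap.lsmul S[X] _ X - (polyX N).baseChange S[X]

noncomputable def polyC (k : ℕ) : S[X] ⊗[S] N →ₗ[S] N :=
  (TensorProduct.lid S N).toLinearMap ∘ₗ (Polynomial.lcoeff S k).rTensor N

variable {N}

theorem polyP_tmul (p : S[X]) (x : N) : polyP N (p ⊗ₜ x) = p • x := by
  simp [polyP]

theorem polyI_tmul (p : S[X]) (x : N) :
    polyI N (p ⊗ₜ x) = (X * p) ⊗ₜ x - p ⊗ₜ ((X : S[X]) • x) := by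
  simp [polyI, polyX, TensorProduct.smul_tmul']

theorem polyC_tmul (k : ℕ) (p : S[X]) (x : N) : polyC N k (p ⊗ₜ x) = p.coeff k • x := by
  simp [polyC]

theorem polyC_polyI (k : ℕ) (y : S[X] ⊗[S] N) :
    polyC N (k + 1) (polyI N y) = polyC N k y - (X : S[X]) • polyC N (k + 1) y := by
  induction y with
  | zero => simp
  | add a b ha hb => rw [map_add, map_add, ha, hb, map_add, map_add, smul_add]; abel
  | tmul p x =>
    rw [polyI_tmul, map_sub, polyC_tmul, polyC_tmul, polyC_tmul, polyC_tmul, coeff_X_mul,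
      smul_comm]

theorem polyC_sum (y : S[X] ⊗[S] N) :
    ∃ n, ∀ m, n ≤ m → y = ∑ k ∈ Finset.range m, ((X : S[X]) ^ k) ⊗ₜ[S] polyC N k y := by
  induction y with
  | zero => exact ⟨0, fun m _ => by simp⟩
  | add a b ha hb =>
    obtain ⟨n, hn⟩ := ha
    obtain ⟨n', hn'⟩ := hb
    refine ⟨max n n', fun m hm => ?_⟩
    simp only [map_add, TensorProduct.tmul_add, Finset.sum_add_distrib]
    rw [← hn m (le_trans (le_max_left _ _) hm), ← hn' m (le_trans (le_max_right _ _) hm)]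
  | tmul p x =>
    refine ⟨p.natDegree + 1, fun m hm => ?_⟩
    conv_lhs => rw [p.as_sum_range' m hm]
    rw [TensorProduct.sum_tmul]
    refine Finset.sum_congr rfl fun k _ => ?_
    rw [polyC_tmul, TensorProduct.tmul_smul, TensorProduct.smul_tmul', smul_X_eq_monomial]

theorem polyI_injective : Function.Injective (polyI (S := S) N) := by
  rw [injective_iff_map_eq_zero]
  intro y hy
  obtain ⟨n, hn⟩ := polyC_sum y
  have h1 : ∀ k, n ≤ k → polyC N k y = 0 := by
    intro k hk
    have h := hn (k + 1) (by omega)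
    rw [Finset.sum_range_succ, ← hn k hk] at h
    have h' : ((X : S[X]) ^ k) ⊗ₜ[S] polyC N k y = 0 := by simpa using h.symm
    have := congrArg (polyC N k) h'
    rw [polyC_tmul] at this
    simpa using this
  have h2 : ∀ k, polyC N k y = (X : S[X]) • polyC N (k + 1) y := by
    intro k
    have := polyC_polyI k y
    rw [hy, map_zero] at this
    exact (sub_eq_zero.1 this.symm)
  have h3 : ∀ j k, n ≤ k + j → polyC N k y = 0 := by
    intro j
    induction j with
    | zero => exact fun k hk => h1 k hk
    | succ j ih => intro k hk; rw [h2, ih (k + 1) (by omega), smul_zero]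
  rw [hn n le_rfl]
  refine Finset.sum_eq_zero fun k _ => ?_
  rw [h3 n k (by omega), TensorProduct.tmul_zero]

theorem polyI_mod (y : S[X] ⊗[S] N) :
    y - (1 : S[X]) ⊗ₜ polyP N y ∈ LinearMap.range (polyI N) := by
  induction y with
  | zero => simp
  | add a b ha hb =>
    rw [map_add, TensorProduct.tmul_add, add_sub_add_comm]
    exact add_mem ha hb
  | tmul p x =>
    rw [polyP_tmul]
    induction p using Polynomial.induction_on' generalizing x with
    | add p q hp hq =>
      rw [TensorProduct.add_tmul, add_smul, TensorProduct.tmul_add, add_sub_add_comm]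
      exact add_mem (hp x) (hq x)
    | monomial n a =>
      induction n generalizing x with
      | zero =>
        rw [monomial_zero_left, ← Polynomial.algebraMap_eq, algebraMap_smul,
          TensorProduct.tmul_smul, TensorProduct.smul_tmul', Algebra.algebraMap_eq_smul_one,
          sub_self]
        exact zero_mem _
      | succ n ih =>
        have h1 : (monomial (n + 1) a : S[X]) = X * monomial n a := by
          rw [X_mul_monomial]
        have h2 := ih ((X : S[X]) • x)
        have h3 : polyI N (monomial n a ⊗ₜ x) ∈ LinearMap.range (polyI N) := ⟨_, rfl⟩
        rw [polyI_tmul, ← h1] at h3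
        have := add_mem h3 h2
        rwa [smul_smul, mul_comm, ← h1, sub_add_sub_cancel] at this

theorem polyI_exact : Function.Exact (polyI (S := S) N) (polyP N) := by
  intro y
  constructor
  · intro h
    have := polyI_mod y
    rwa [h, TensorProduct.tmul_zero, sub_zero] at this
  · rintro ⟨z, rfl⟩
    induction z with
    | zero => simp
    | add a b ha hb => rw [map_add, map_add, ha, hb, add_zero]
    | tmul p x => rw [polyI_tmul, map_sub, polyP_tmul, polyP_tmul, smul_smul, mul_comm, sub_self]

theorem polyP_surjective : Function.Surjective (polyP (S := S) N) := fun x =>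
  ⟨1 ⊗ₜ x, by rw [polyP_tmul, one_smul]⟩

end poly

theorem WD.polynomial {S : Type u} [CommRing S] {n : ℕ} (h : WD S n) :
    WD (Polynomial S) (n + 1) := by
  intro F _ _ _ d hd
  let : ∀ i, Module S (F i) := fun i => Module.compHom (F i) (algebraMap S (Polynomial S))
  have : ∀ i, IsScalarTower S (Polynomial S) (F i) := fun i =>
    ⟨fun s b x => by rw [Algebra.smul_def, mul_smul]; rfl⟩
  have : ∀ i, Module.Flat S (F i) := fun i => Module.Flat.trans S (Polynomial S) (F i)
  have := h.over F d hd
  have h1 := flat_ker_of_resolution (R := Polynomial S)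
    (polyI (F n ⧸ LinearMap.range (d n))) (polyP (S := S) _) polyI_injective polyI_exact
    polyP_surjective (LinearMap.range (d n)).mkQ (Submodule.mkQ_surjective _)
  rw [Submodule.ker_mkQ] at h1
  have e := (Function.Exact.linearEquivOfSurjective (f := d (n + 1))
    (g := (d n).rangeRestrict) (by
      intro y
      rw [← hd n y]
      exact Subtype.ext_iff) (d n).surjective_rangeRestrict)
  exact Module.Flat.of_linearEquiv e

theorem WD.mvPolynomial {k : Type u} [Field k] (n : ℕ) : WD (MvPolynomial (Fin n) k) n := by
  induction n with
  | zero => exact WD.field.of_ringEquiv (MvPolynomial.isEmptyRingEquiv k (Fin 0)).symm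
  | succ n ih => exact ih.polynomial.of_ringEquiv (MvPolynomial.finSuccEquiv k n).symm.toRingEquiv

theorem WD.of_span {B : Type u} [CommRing B] {n : ℕ} (s : Set B) (hs : Ideal.span s = ⊤)
    (h : ∀ r ∈ s, WD (Localization.Away r) n) : WD B n := by
  intro F _ _ _ d hd
  refine Module.flat_of_isLocalized_span B (F n ⧸ LinearMap.range (d n)) s hs
    (fun r => Localization.Away r.1 ⊗[B] (F n ⧸ LinearMap.range (d n)))
    (fun r => TensorProduct.mk B (Localization.Away r.1) (F n ⧸ LinearMap.range (d n)) 1) ?_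
  intro r
  have h1 := h r.1 r.2 (fun i => Localization.Away r.1 ⊗[B] F i)
    (fun i => (d i).baseChange (Localization.Away r.1))
    (fun i => Module.Flat.lTensor_exact (Localization.Away r.1) (hd i))
  have e := Function.Exact.linearEquivOfSurjective
    (f := (d n).baseChange (Localization.Away r.1))
    (g := (LinearMap.range (d n)).mkQ.baseChange (Localization.Away r.1))
    (lTensor_exact (Localization.Away r.1) (LinearMap.exact_map_mkQ_range (d n))
      (Submodule.mkQ_surjective _))
    (LinearMap.lTensor_surjective _ (Submodule.mkQ_surjective _))
  have := Module.Flat.of_linearEquiv e.symm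
  exact Module.Flat.trans B (Localization.Away r.1) _

theorem WD.smooth (k B : Type u) [Field k] [CommRing B] [Algebra k B] [Algebra.Smooth k B] :
    ∃ n, WD B n := by
  obtain ⟨s, hs, h⟩ := Algebra.Smooth.exists_span_eq_top_isStandardSmooth k B
  obtain ⟨t, hts, ht⟩ := (Ideal.span_eq_top_iff_finite s).1 hs
  have h1 : ∀ r ∈ s, ∃ n, WD (Localization.Away r) n := by
    intro r hr
    have := h r hr
    obtain ⟨n, φ, hgC, hg⟩ := RingHom.IsStandardSmooth.exists_etale_mvPolynomial
      (f := algebraMap k (Localization.Away r)) (by simpa [RingHom.isStandardSmooth_algebraMap])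
    algebraize [φ]
    exact ⟨n, (WD.mvPolynomial (k := k) n).transfer⟩
  choose! g hg using h1
  exact ⟨t.sup g, WD.of_span (t : Set B) ht fun r hr =>
    (hg r (hts hr)).mono (Finset.le_sup (f := g) hr)⟩

end weakdim

end PoC

namespace PoC

section nagata

variable {R : Type u} [CommRing R] [IsDomain R] [ValuationRing R]

theorem flat_iff_tf {M : Type u} [AddCommGroup M] [Module R M] :
    Module.Flat R M ↔ ∀ r : R, r ≠ 0 → ∀ x : M, r • x = 0 → x = 0 := by
  rw [Module.Flat.flat_iff_torsion_eq_bot_of_isBezout, ← Submodule.isTorsionFree_iff_torsion_eq_bot,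
    Module.isTorsionFree_iff_smul_eq_zero]
  constructor
  · intro h r hr x hx
    exact ((h r x hx).resolve_left hr)
  · intro h r x hx
    by_cases hr : r = 0
    · exact Or.inl hr
    · exact Or.inr (h r hr x hx)

theorem tf_of_flat {M : Type u} [AddCommGroup M] [Module R M] [h : Module.Flat R M]
    {r : R} (hr : r ≠ 0) {x : M} (hx : r • x = 0) : x = 0 := flat_iff_tf.1 h r hr x hx

theorem flat_of_injective {M M' : Type u} [AddCommGroup M] [Module R M] [AddCommGroup M']
    [Module R M'] [Module.Flat R M'] (f : M →ₗ[R] M') (hf : Function.Injective f) :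
    Module.Flat R M := by
  rw [flat_iff_tf]
  intro r hr x hx
  apply hf
  rw [map_zero]
  exact tf_of_flat hr (by rw [← map_smul, hx, map_zero])

theorem sat_fg {P : Type u} [AddCommGroup P] [Module R P] [Module.Finite R P] (P0 : Submodule R P)
    (h : ∀ r : R, r ≠ 0 → ∀ x : P, r • x ∈ P0 → x ∈ P0) : P0.FG := by
  have h1 : Module.Flat R (P ⧸ P0) := by
    rw [flat_iff_tf]
    intro r hr x hx
    obtain ⟨y, rfl⟩ := Submodule.mkQ_surjective _ x
    rw [← map_smul] at hx
    simp only [Submodule.mkQ_apply, Submodule.Quotient.mk_eq_zero] at hx ⊢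
    exact h r hr y hx
  have h2 : Module.Free R (P ⧸ P0) := Module.free_of_flat_of_isLocalRing
  have h3 := Module.finitePresentation_of_projective R (P ⧸ P0)
  have := Module.FinitePresentation.fg_ker (P0.mkQ) (Submodule.mkQ_surjective _)
  rwa [Submodule.ker_mkQ] at this

open MvPolynomial

/-- common divisor of elements of the maximal ideal -/
theorem exists_common_divisor (s : Finset R) (hs : ∀ c ∈ s, c ∈ IsLocalRing.maximalIdeal R) :
    ∃ a ∈ IsLocalRing.maximalIdeal R, ∀ c ∈ s, a ∣ c := by
  classical
  induction s using Finset.induction_on with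
  | empty => exact ⟨0, zero_mem _, by simp⟩
  | insert c s _ ih =>
    obtain ⟨a, ha, h⟩ := ih fun c hc => hs c (Finset.mem_insert_of_mem hc)
    rcases ValuationRing.dvd_total a c with h1 | h1
    · exact ⟨a, ha, fun b hb => by
        rcases Finset.mem_insert.1 hb with rfl | hb
        · exact h1
        · exact h b hb⟩
    · exact ⟨c, hs c (Finset.mem_insert_self _ _), fun b hb => by
        rcases Finset.mem_insert.1 hb with rfl | hb
        · exact dvd_rfl
        · exact h1.trans (h b hb)⟩

variable {σ : Type} [Finite σ]

/-- the Rees map -/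
noncomputable def rees (k : Type u) [CommRing k] (σ : Type) :
    MvPolynomial (Option σ) k →ₐ[k] Polynomial (MvPolynomial σ k) :=
  MvPolynomial.aeval fun o => o.elim Polynomial.X fun i => Polynomial.C (X i) * Polynomial.X

theorem rees_totalDegree {k : Type u} [CommRing k] {σ : Type} (p : MvPolynomial (Option σ) k)
    (e : ℕ) : ((rees k σ p).coeff e).totalDegree ≤ e := by
  induction p using MvPolynomial.induction_on generalizing e with
  | C a =>
    have : rees k σ (C a) = Polynomial.C (C a) := by
      rw [← MvPolynomial.algebraMap_eq, AlgHom.commutes]; rfl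
    rw [this, Polynomial.coeff_C]
    split_ifs <;> simp
  | add p q hp hq =>
    rw [map_add, Polynomial.coeff_add]
    exact (totalDegree_add _ _).trans (max_le (hp e) (hq e))
  | mul_X p o hp =>
    rw [map_mul]
    cases o with
    | none =>
      have : rees k σ (X none) = Polynomial.X := by simp [rees]
      rw [this]
      cases e with
      | zero => simp
      | succ e => rw [Polynomial.coeff_mul_X]; exact (hp e).trans (Nat.le_succ e)
    | some i =>
      have : rees k σ (X (some i)) = Polynomial.C (X i) * Polynomial.X := by simp [rees]
      rw [this, ← mul_assoc]
      cases e with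
      | zero => simp
      | succ e =>
        rw [Polynomial.coeff_mul_X, Polynomial.coeff_mul_C]
        refine (totalDegree_mul _ _).trans (Nat.add_le_add (hp e) ?_)
        exact (totalDegree_monomial_le _ _).trans (by simp [Finsupp.sum_single_index])

theorem rees_map {k k' : Type u} [CommRing k] [CommRing k'] (f : k →+* k') {σ : Type}
    (p : MvPolynomial (Option σ) k) :
    (rees k σ p).map (MvPolynomial.map f) = rees k' σ (MvPolynomial.map f p) := by
  induction p using MvPolynomial.induction_on with
  | C a =>
    have : ∀ (k : Type u) [CommRing k] (a : k), rees k σ (C a) = Polynomial.C (C a) := by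
      intro k _ a
      rw [← MvPolynomial.algebraMap_eq, AlgHom.commutes]; rfl
    rw [this, MvPolynomial.map_C, this, Polynomial.map_C, MvPolynomial.map_C]
  | add p q hp hq => rw [map_add, Polynomial.map_add, hp, hq, map_add, map_add]
  | mul_X p o hp =>
    rw [map_mul, Polynomial.map_mul, hp, map_mul, map_mul]
    congr 1
    cases o <;> simp [rees]

theorem rees_exists {k : Type u} [CommRing k] {σ : Type} (p : MvPolynomial σ k) (d : ℕ)
    (hp : p.totalDegree ≤ d) :
    ∃ w, rees k σ w = Polynomial.C p * Polynomial.X ^ d := by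
  refine ⟨∑ α ∈ p.support, C (p.coeff α) * X none ^ (d - α.degree) *
    α.prod fun i n => X (some i) ^ n, ?_⟩
  conv_rhs => rw [← MvPolynomial.support_sum_monomial_coeff p]
  rw [map_sum, map_sum, Finset.sum_mul]
  refine Finset.sum_congr rfl fun α hα => ?_
  have h1 : α.degree ≤ d := by
    refine le_trans ?_ hp
    exact le_totalDegree hα
  have h2 : rees k σ (C (p.coeff α)) = Polynomial.C (C (p.coeff α)) := by
    rw [← MvPolynomial.algebraMap_eq, AlgHom.commutes]; rfl
  have h3 : rees k σ (X none) = Polynomial.X := by simp [rees]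
  have h4 : ∀ i, rees k σ (X (some i)) = Polynomial.C (X i) * Polynomial.X := by simp [rees]
  rw [map_mul, map_mul, h2, map_pow, h3, Finsupp.prod, map_prod]
  simp only [map_pow, h4, mul_pow]
  rw [Finset.prod_mul_distrib, Finset.prod_pow_eq_pow_sum, monomial_eq, Finsupp.prod]
  have h5 : ∑ i ∈ α.support, α i = α.degree := rfl
  rw [h5, map_mul, map_prod]
  simp only [map_pow]
  conv_rhs => rw [← Nat.sub_add_cancel h1, pow_add]
  ring

variable {m : ℕ}

/-- vectors of bounded degree -/
noncomputable def degLE (R : Type u) [CommRing R] (σ : Type) (m d : ℕ) :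
    Submodule R (Fin m → MvPolynomial σ R) :=
  Submodule.pi Set.univ fun _ => restrictTotalDegree σ R d

theorem mem_degLE {R : Type u} [CommRing R] {σ : Type} {m d : ℕ} {v : Fin m → MvPolynomial σ R} :
    v ∈ degLE R σ m d ↔ ∀ i, (v i).totalDegree ≤ d := by
  simp [degLE, Submodule.mem_pi, mem_restrictTotalDegree]

theorem degLE_fg (R : Type u) [CommRing R] (σ : Type) [Finite σ] (m d : ℕ) :
    (degLE R σ m d).FG := by
  refine Submodule.fg_pi ?_
  intro i
  have hfin : Set.Finite {n : σ →₀ ℕ | (n.sum fun _ e => e) ≤ d} := by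
    have := Finsupp.finite_of_degree_le (σ := σ) d
    exact this
  have : Finite {n : σ →₀ ℕ | (n.sum fun _ e => e) ≤ d} := hfin
  exact Module.Finite.iff_fg.1 (Module.Finite.of_basis
    (basisRestrictSupport R {n : σ →₀ ℕ | (n.sum fun _ e => e) ≤ d}))

variable (N : Submodule (MvPolynomial σ R) (Fin m → MvPolynomial σ R))

noncomputable def filt (N : Submodule (MvPolynomial σ R) (Fin m → MvPolynomial σ R)) (d : ℕ) :
    Submodule R (Fin m → MvPolynomial σ R) :=
  N.restrictScalars R ⊓ degLE R σ m d

theorem filt_fg (hN : ∀ r : R, r ≠ 0 → ∀ v, r • v ∈ N → v ∈ N) (d : ℕ) : (filt N d).FG := by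
  have h0 : Module.Finite R (degLE R σ m d) := Module.Finite.iff_fg.2 (degLE_fg R σ m d)
  have h1 := sat_fg ((N.restrictScalars R).comap (degLE R σ m d).subtype) (by
    intro r hr x hx
    exact hN r hr _ hx)
  have h2 := h1.map (degLE R σ m d).subtype
  rw [Submodule.map_comap_subtype, inf_comm] at h2
  exact h2

theorem filt_residue (hN : ∀ r : R, r ≠ 0 → ∀ v, r • v ∈ N → v ∈ N) (d : ℕ)
    (v : Fin m → MvPolynomial σ R) (hv : v ∈ filt N d)
    (h0 : ∀ i, MvPolynomial.map (IsLocalRing.residue R) (v i) = 0) :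
    v ∈ IsLocalRing.maximalIdeal R • filt N d := by
  classical
  obtain ⟨a, ha, hdvd⟩ := exists_common_divisor
    (Finset.univ.biUnion fun i => (v i).support.image (fun α => (v i).coeff α)) (by
      intro c hc
      simp only [Finset.mem_biUnion, Finset.mem_image] at hc
      obtain ⟨i, _, α, _, rfl⟩ := hc
      have := congrArg (coeff α) (h0 i)
      rw [coeff_map, coeff_zero] at this
      exact (IsLocalRing.residue_eq_zero_iff _).1 this)
  have h1 : ∀ i, C a ∣ v i := by
    intro i
    rw [C_dvd_iff_dvd_coeff]
    intro α
    by_cases h : α ∈ (v i).support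
    · exact hdvd _ (Finset.mem_biUnion.2 ⟨i, Finset.mem_univ _, Finset.mem_image.2 ⟨α, h, rfl⟩⟩)
    · rw [notMem_support_iff.1 h]; exact dvd_zero _
  choose w hw using h1
  have hvw : v = a • w := by
    funext i
    rw [hw i, Pi.smul_apply, smul_eq_C_mul]
  by_cases ha0 : a = 0
  · rw [hvw, ha0, zero_smul]; exact zero_mem _
  rw [hvw]
  refine Submodule.smul_mem_smul ha ⟨?_, ?_⟩
  · exact hN a ha0 w (hvw ▸ hv.1)
  · have h2 := mem_degLE.1 hv.2
    refine mem_degLE.2 fun i => ?_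
    refine le_trans (le_of_eq ?_) (h2 i)
    rw [hw i, ← smul_eq_C_mul]
    unfold totalDegree
    rw [support_smul_eq ha0]

theorem totalDegree_map_le' {k k' : Type u} [CommRing k] [CommRing k'] (f : k →+* k') {σ : Type}
    (p : MvPolynomial σ k) : (MvPolynomial.map f p).totalDegree ≤ p.totalDegree :=
  Finset.sup_mono (support_map_subset _ _)

set_option maxHeartbeats 1000000 in
theorem nagata (hN : ∀ r : R, r ≠ 0 → ∀ v, r • v ∈ N → v ∈ N) : N.FG := by
  classical
  let k := IsLocalRing.ResidueField R
  let ρ : MvPolynomial σ R →+* MvPolynomial σ k := MvPolynomial.map (IsLocalRing.residue R)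
  let G : Set (Fin m → MvPolynomial (Option σ) k) :=
    {w | ∃ d, ∃ n ∈ filt N d, ∀ i, rees k σ (w i) = Polynomial.C (ρ (n i)) * Polynomial.X ^ d}
  have hG : (Submodule.span (MvPolynomial (Option σ) k) G).FG := IsNoetherian.noetherian _
  obtain ⟨t, htG, ht⟩ := (Submodule.fg_span_iff_fg_span_finset_subset G).1 hG
  have hex : ∀ w, ∃ d n, w ∈ G → (n ∈ filt N d ∧
      ∀ i, rees k σ (w i) = Polynomial.C (ρ (n i)) * Polynomial.X ^ d) := by
    intro w
    by_cases h : w ∈ G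
    · obtain ⟨d, n, hn, h'⟩ := h
      exact ⟨d, n, fun _ => ⟨hn, h'⟩⟩
    · exact ⟨0, 0, fun h' => (h h').elim⟩
  choose dd nn hdn using hex
  let N' := Submodule.span (MvPolynomial σ R) (nn '' (t : Set (Fin m → MvPolynomial (Option σ) k)))
  have hNN2 : N' ≤ N := by
    refine Submodule.span_le.2 ?_
    rintro _ ⟨w, hw, rfl⟩
    exact (hdn w (htG hw)).1.1
  have key : ∀ d, filt N d ≤ N'.restrictScalars R := by
    intro d
    refine Submodule.le_of_le_smul_of_le_jacobson_bot (I := IsLocalRing.maximalIdeal R)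
      (filt_fg N hN d) (IsLocalRing.jacobson_eq_maximalIdeal _ bot_ne_top).ge ?_
    intro n hn
    have h1 : ∀ i, ∃ w, rees k σ w = Polynomial.C (ρ (n i)) * Polynomial.X ^ d := by
      intro i
      refine rees_exists _ _ (le_trans ?_ (mem_degLE.1 hn.2 i))
      exact totalDegree_map_le' _ _
    choose w hw using h1
    have hwG : w ∈ Submodule.span (MvPolynomial (Option σ) k)
        (t : Set (Fin m → MvPolynomial (Option σ) k)) := by
      rw [← ht]
      exact Submodule.subset_span ⟨d, n, hn, hw⟩
    obtain ⟨p, hp⟩ := Submodule.mem_span_finset'.1 hwG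
    have hlift : ∀ u : t, ∃ q : MvPolynomial (Option σ) R,
        MvPolynomial.map (IsLocalRing.residue R) q = p u := fun u =>
      MvPolynomial.map_surjective _ IsLocalRing.residue_surjective _
    choose q hq using hlift
    let c : t → MvPolynomial σ R := fun u =>
      if dd u ≤ d then (rees R σ (q u)).coeff (d - dd u) else 0
    have hc : ∀ i, ρ (n i) = ∑ u : t, ρ (c u) * ρ (nn u i) := by
      intro i
      have h2 := congrArg (fun f => (rees k σ (f i)).coeff d) hp
      simp only [Finset.sum_apply, Pi.smul_apply, smul_eq_mul, map_sum, map_mul,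
        Polynomial.finsetSum_coeff] at h2
      rw [hw, Polynomial.coeff_C_mul_X_pow, if_pos rfl] at h2
      rw [← h2]
      refine Finset.sum_congr rfl fun u _ => ?_
      rw [(hdn u (htG u.2)).2 i, ← mul_assoc, Polynomial.coeff_mul_X_pow', ← hq u, ← rees_map]
      simp only [c]
      split_ifs with h
      · rw [Polynomial.coeff_mul_C, Polynomial.coeff_map]
      · rw [map_zero, zero_mul]
    let n' : Fin m → MvPolynomial σ R := ∑ u : t, c u • nn u
    have hnN2 : n' ∈ N' := Submodule.sum_mem _ fun u _ => Submodule.smul_mem _ _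
      (Submodule.subset_span ⟨u, u.2, rfl⟩)
    have hn'd : n' ∈ filt N d := by
      refine ⟨hNN2 hnN2, ?_⟩
      refine Submodule.sum_mem _ fun u _ => mem_degLE.2 fun i => ?_
      simp only [c, Pi.smul_apply, smul_eq_mul]
      split_ifs with h
      · refine (totalDegree_mul _ _).trans ?_
        have h3 := rees_totalDegree (q u) (d - dd u)
        have h4 := mem_degLE.1 (hdn u (htG u.2)).1.2 i
        omega
      · simp
    have hdiff : n - n' ∈ IsLocalRing.maximalIdeal R • filt N d := by
      refine filt_residue N hN d _ (sub_mem hn hn'd) fun i => ?_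
      have : MvPolynomial.map (IsLocalRing.residue R) (n i) = _ := hc i
      rw [Pi.sub_apply, map_sub, this]
      simp only [n', Finset.sum_apply, Pi.smul_apply, smul_eq_mul, map_sum, map_mul]
      exact sub_self _
    have : n = n' + (n - n') := by abel
    rw [this]
    exact Submodule.add_mem_sup hnN2 hdiff
  have hNN' : N = N' := by
    refine le_antisymm (fun n hn => ?_) hNN2
    refine key (Finset.univ.sup fun i => (n i).totalDegree) ⟨hn, mem_degLE.2 fun i => ?_⟩
    exact Finset.le_sup (f := fun i => (n i).totalDegree) (Finset.mem_univ i)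
  rw [hNN']
  exact Submodule.fg_span (t.finite_toSet.image _)

end nagata

end PoC

namespace PoC

section dims

open TensorProduct

/-- homology `Z / (B ∩ Z)` -/
abbrev Hm {R Y : Type*} [CommRing R] [AddCommGroup Y] [Module R Y] (Z B : Submodule R Y) :=
  Z ⧸ B.submoduleOf Z

theorem finrank_exact {Q U V W : Type u} [Field Q] [AddCommGroup U] [Module Q U]
    [AddCommGroup V] [Module Q V] [AddCommGroup W] [Module Q W] (i : U →ₗ[Q] V) (p : V →ₗ[Q] W)
    (hi : Function.Injective i) (hip : Function.Exact i p) (hp : Function.Surjective p)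
    [Module.Finite Q U] [Module.Finite Q W] :
    Module.Finite Q V ∧ Module.finrank Q V = Module.finrank Q U + Module.finrank Q W := by
  have h : Module.Finite Q V := Module.Finite.of_exact hip hp
  refine ⟨h, ?_⟩
  have h1 := LinearMap.finrank_range_add_finrank_ker p
  rw [LinearMap.range_eq_top.2 hp, finrank_top, hip.linearMap_ker_eq,
    LinearMap.finrank_range_of_inj hi] at h1
  omega

theorem lemB {Q TB TZ TX TB' Y : Type u} [Field Q] [AddCommGroup TB] [Module Q TB]
    [AddCommGroup TZ] [Module Q TZ] [AddCommGroup TX] [Module Q TX]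
    [AddCommGroup TB'] [Module Q TB'] [AddCommGroup Y] [Module Q Y]
    (β : TB →ₗ[Q] TZ) (γ : TZ →ₗ[Q] TX) (π : TX →ₗ[Q] TB') (δ : TB' →ₗ[Q] Y)
    (hγ : Function.Injective γ) (hγπ : Function.Exact γ π) (hπ : Function.Surjective π)
    [Module.Finite Q (TZ ⧸ LinearMap.range β)] [Module.Finite Q (LinearMap.ker δ)] :
    Module.Finite Q (Hm (LinearMap.ker (δ ∘ₗ π)) (LinearMap.range (γ ∘ₗ β))) ∧
    Module.finrank Q (Hm (LinearMap.ker (δ ∘ₗ π)) (LinearMap.range (γ ∘ₗ β))) =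
      Module.finrank Q (TZ ⧸ LinearMap.range β) + Module.finrank Q (LinearMap.ker δ) := by
  let K := LinearMap.ker (δ ∘ₗ π)
  let γ' : TZ →ₗ[Q] K := γ.codRestrict K (fun z => by
    simp [K, hγπ.apply_apply_eq_zero])
  let i : (TZ ⧸ LinearMap.range β) →ₗ[Q] Hm K (LinearMap.range (γ ∘ₗ β)) :=
    Submodule.mapQ _ _ γ' (by
      rintro _ ⟨b, rfl⟩
      exact ⟨b, rfl⟩)
  let π' : K →ₗ[Q] LinearMap.ker δ := (π ∘ₗ K.subtype).codRestrict _ (fun x => x.2)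
  let p : Hm K (LinearMap.range (γ ∘ₗ β)) →ₗ[Q] LinearMap.ker δ :=
    Submodule.liftQ _ π' (by
      rintro ⟨x, hx⟩ ⟨b, hb⟩
      have hb : γ (β b) = x := hb
      refine LinearMap.mem_ker.2 (Subtype.ext ?_)
      change π x = 0
      rw [← hb, hγπ.apply_apply_eq_zero])
  refine finrank_exact i p ?_ ?_ ?_
  · rw [injective_iff_map_eq_zero]
    intro z hz
    obtain ⟨z, rfl⟩ := Submodule.mkQ_surjective _ z
    have : γ' z ∈ (LinearMap.range (γ ∘ₗ β)).submoduleOf K := by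
      rw [← Submodule.Quotient.mk_eq_zero]
      exact hz
    obtain ⟨b, hb⟩ := this
    rw [Submodule.mkQ_apply, Submodule.Quotient.mk_eq_zero]
    exact ⟨b, hγ hb⟩
  · intro x
    obtain ⟨⟨x, hx⟩, rfl⟩ := Submodule.mkQ_surjective _ x
    constructor
    · intro h
      have h : π x = 0 := congrArg Subtype.val h
      obtain ⟨z, rfl⟩ := (hγπ x).1 h
      exact ⟨Submodule.Quotient.mk z, rfl⟩
    · rintro ⟨z, hz⟩
      obtain ⟨z, rfl⟩ := Submodule.mkQ_surjective _ z
      rw [← hz]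
      refine Subtype.ext ?_
      exact hγπ.apply_apply_eq_zero z
  · rintro ⟨y, hy⟩
    obtain ⟨x, rfl⟩ := hπ y
    exact ⟨Submodule.Quotient.mk ⟨x, hy⟩, rfl⟩

variable {R : Type u} [CommRing R] [IsDomain R] [ValuationRing R]

theorem lemA {B Z : Type u} [AddCommGroup B] [Module R B] [AddCommGroup Z] [Module R Z]
    [Module.Flat R Z] (f : B →ₗ[R] Z) (hf : Function.Injective f)
    [Module.FinitePresentation R (Z ⧸ LinearMap.range f)] :
    ∃ e : ℤ, ∀ (Q : Type u) [Field Q] [Algebra R Q],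
      Module.Finite Q (LinearMap.ker (f.baseChange Q)) ∧
      Module.Finite Q ((Q ⊗[R] Z) ⧸ LinearMap.range (f.baseChange Q)) ∧
      (Module.finrank Q ((Q ⊗[R] Z) ⧸ LinearMap.range (f.baseChange Q)) : ℤ) =
        e + Module.finrank Q (LinearMap.ker (f.baseChange Q)) := by
  obtain ⟨m, q, hq⟩ := Module.Finite.exists_fin' R (Z ⧸ LinearMap.range f)
  obtain ⟨φ, hφ⟩ := Module.projective_lifting_property (LinearMap.range f).mkQ q
    (Submodule.mkQ_surjective _)
  have hNfg : (LinearMap.ker q).FG := Module.FinitePresentation.fg_ker q hq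
  have hNfin : Module.Finite R (LinearMap.ker q) := Module.Finite.iff_fg.2 hNfg
  have hNflat : Module.Flat R (LinearMap.ker q) :=
    flat_of_injective (LinearMap.ker q).subtype (Submodule.injective_subtype _)
  have hNfree : Module.Free R (LinearMap.ker q) := Module.free_of_flat_of_isLocalRing
  have hφ' : ∀ v, (LinearMap.range f).mkQ (φ v) = q v := fun v => LinearMap.congr_fun hφ v
  let ef := LinearEquiv.ofInjective f hf
  let a : LinearMap.ker q →ₗ[R] B := ef.symm.toLinearMap ∘ₗ
    (φ ∘ₗ (LinearMap.ker q).subtype).codRestrict (LinearMap.range f) (fun v => by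
      have : (LinearMap.range f).mkQ (φ v.1) = 0 := by rw [hφ', v.2]
      simpa using this)
  have ha : ∀ v, f (a v) = φ v.1 := by
    intro v
    have : ef (a v) = _ := ef.apply_symm_apply _
    exact congrArg Subtype.val this
  let s : LinearMap.ker q →ₗ[R] (Fin m → R) := (LinearMap.ker q).subtype
  let P : LinearMap.ker q →ₗ[R] B × (Fin m → R) :=
    LinearMap.inl R _ _ ∘ₗ a + LinearMap.inr R _ _ ∘ₗ s
  have hPapp : ∀ v, P v = (a v, v.1) := fun v => by simp [P, s]
  let Ψ : B × (Fin m → R) →ₗ[R] Z := f.coprod (-φ)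
  have hΨ : ∀ b v, Ψ (b, v) = f b - φ v := fun b v => by simp [Ψ, sub_eq_add_neg]
  have hPinj : Function.Injective P := by
    intro x y h
    rw [hPapp, hPapp] at h
    exact Subtype.ext (congrArg Prod.snd h)
  have hPΨ : Function.Exact P Ψ := by
    rintro ⟨b, v⟩
    rw [hΨ]
    constructor
    · intro h
      have h1 : q v = 0 := by
        rw [← hφ', ← sub_eq_zero.1 h]
        simp
      refine ⟨⟨v, h1⟩, ?_⟩
      rw [hPapp]
      refine Prod.ext (hf ?_) rfl
      rw [ha]
      exact (sub_eq_zero.1 h).symm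
    · rintro ⟨x, hx⟩
      rw [hPapp] at hx
      obtain ⟨rfl, rfl⟩ := Prod.mk.inj hx
      rw [ha, sub_self]
  have hΨsurj : Function.Surjective Ψ := by
    intro z
    obtain ⟨v, hv⟩ := hq ((LinearMap.range f).mkQ z)
    rw [← hφ'] at hv
    have : z - φ v ∈ LinearMap.range f := by
      rw [← Submodule.Quotient.mk_eq_zero, Submodule.Quotient.mk_sub, sub_eq_zero]
      exact hv.symm
    obtain ⟨b, hb⟩ := this
    exact ⟨(b, -v), by rw [hΨ, hb, map_neg]; abel⟩
  refine ⟨(m : ℤ) - Module.finrank R (LinearMap.ker q), ?_⟩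
  intro Q _ _
  let θ := s.baseChange Q
  have hTP : Function.Injective (P.lTensor Q) := pure_inj Q P Ψ hPinj hPΨ hΨsurj
  have hTE : Function.Exact (P.lTensor Q) (Ψ.lTensor Q) := lTensor_exact Q hPΨ hΨsurj
  have hPl : ∀ x, P.lTensor Q x = (LinearMap.inl R B (Fin m → R)).lTensor Q (a.lTensor Q x) +
      (LinearMap.inr R B (Fin m → R)).lTensor Q (s.lTensor Q x) := by
    intro x
    simp only [P]
    rw [LinearMap.lTensor_add, LinearMap.add_apply, LinearMap.lTensor_comp_apply,
      LinearMap.lTensor_comp_apply, LinearMap.lTensor_comp_apply]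
  have hfst : ∀ x, (LinearMap.fst R B (Fin m → R)).lTensor Q (P.lTensor Q x) = a.lTensor Q x := by
    intro x
    rw [← LinearMap.comp_apply, ← LinearMap.lTensor_comp]
    congr 2
    ext v
    simp [hPapp]
  have hsnd : ∀ x, (LinearMap.snd R B (Fin m → R)).lTensor Q (P.lTensor Q x) = s.lTensor Q x := by
    intro x
    rw [← LinearMap.comp_apply, ← LinearMap.lTensor_comp]
    congr 2
    ext v
    simp [hPapp, s]
  have hfa : ∀ x, f.lTensor Q (a.lTensor Q x) = φ.lTensor Q (s.lTensor Q x) := by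
    intro x
    rw [← LinearMap.comp_apply, ← LinearMap.lTensor_comp, ← LinearMap.comp_apply,
      ← LinearMap.lTensor_comp]
    congr 2
    ext v
    simp [ha, s]
  -- ker θ ≃ ker β
  let κ : LinearMap.ker θ →ₗ[Q] LinearMap.ker (f.baseChange Q) :=
    LinearMap.restrict (a.baseChange Q) (by
      intro x hx
      have hx : s.lTensor Q x = 0 := hx
      change f.lTensor Q (a.lTensor Q x) = 0
      rw [hfa, hx, map_zero])
  have hκ : Function.Bijective κ := by
    constructor
    · rw [injective_iff_map_eq_zero]
      rintro ⟨x, hx⟩ h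
      have hx : s.lTensor Q x = 0 := hx
      have h : a.lTensor Q x = 0 := congrArg Subtype.val h
      refine Subtype.ext (hTP ?_)
      change P.lTensor Q x = P.lTensor Q 0
      rw [hPl, h, hx, map_zero, map_zero, map_zero, add_zero]
    · rintro ⟨b, hb⟩
      have hb : f.lTensor Q b = 0 := hb
      have h1 : Ψ.lTensor Q ((LinearMap.inl R B (Fin m → R)).lTensor Q b) = 0 := by
        rw [← hb, ← LinearMap.comp_apply, ← LinearMap.lTensor_comp]
        congr 2
        ext v
        simp [hΨ]
      obtain ⟨x, hx⟩ := (hTE _).1 h1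
      have h2 := hsnd x
      have h3 := hfst x
      rw [hx, ← LinearMap.comp_apply, ← LinearMap.lTensor_comp] at h2 h3
      rw [LinearMap.snd_comp_inl, LinearMap.lTensor_zero] at h2
      rw [LinearMap.fst_comp_inl, LinearMap.lTensor_id] at h3
      exact ⟨⟨x, h2.symm⟩, Subtype.ext h3.symm⟩
  let κe := LinearEquiv.ofBijective κ hκ
  -- cokernels
  have c1 := Function.Exact.linearEquivOfSurjective (f := f.baseChange Q)
    (g := (LinearMap.range f).mkQ.baseChange Q)
    (lTensor_exact Q (LinearMap.exact_map_mkQ_range f) (Submodule.mkQ_surjective _))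
    (LinearMap.lTensor_surjective _ (Submodule.mkQ_surjective _))
  have c2 := Function.Exact.linearEquivOfSurjective (f := θ)
    (g := q.baseChange Q)
    (lTensor_exact Q (LinearMap.exact_subtype_ker_map q) hq)
    (LinearMap.lTensor_surjective _ hq)
  have ce := c1.trans c2.symm
  refine ⟨Module.Finite.equiv κe, Module.Finite.equiv ce.symm, ?_⟩
  rw [ce.finrank_eq, ← κe.finrank_eq]
  have r1 := LinearMap.finrank_range_add_finrank_ker θ
  have r2 := Submodule.finrank_quotient_add_finrank (LinearMap.range θ)
  rw [Module.finrank_baseChange] at r1 r2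
  rw [Module.finrank_fin_fun] at r2
  omega

/-- The dimension count for one complex. -/
theorem dim_count (X : ℕ → Type u) [∀ j, AddCommGroup (X j)] [∀ j, Module R (X j)]
    [∀ j, Module.Flat R (X j)] (d : ∀ j, X (j + 1) →ₗ[R] X j)
    (hd : ∀ j, LinearMap.range (d (j + 1)) ≤ LinearMap.ker (d j)) [Subsingleton (X 0)]
    (hH : ∀ j, Module.FinitePresentation R
      (Hm (LinearMap.ker (d j)) (LinearMap.range (d (j + 1))))) :
    ∃ e : ℕ → ℤ, ∀ (Q : Type u) [Field Q] [Algebra R Q], ∃ t : ℕ → ℕ, t 0 = 0 ∧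
      ∀ j, Module.Finite Q (Hm (LinearMap.ker ((d j).baseChange Q))
          (LinearMap.range ((d (j + 1)).baseChange Q))) ∧
        (Module.finrank Q (Hm (LinearMap.ker ((d j).baseChange Q))
          (LinearMap.range ((d (j + 1)).baseChange Q))) : ℤ) = e j + t (j + 1) + t j ∧
        t j ≤ Module.finrank Q (Hm (LinearMap.ker ((d j).baseChange Q))
          (LinearMap.range ((d (j + 1)).baseChange Q))) := by
  have hfl : ∀ j (P : Submodule R (X j)), Module.Flat R P := fun j P =>
    flat_of_injective P.subtype (Submodule.injective_subtype _)
  have hA : ∀ j, ∃ e : ℤ, ∀ (Q : Type u) [Field Q] [Algebra R Q],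
      Module.Finite Q (LinearMap.ker ((Submodule.inclusion (hd j)).baseChange Q)) ∧
      Module.Finite Q ((Q ⊗[R] (LinearMap.ker (d j))) ⧸
        LinearMap.range ((Submodule.inclusion (hd j)).baseChange Q)) ∧
      (Module.finrank Q ((Q ⊗[R] (LinearMap.ker (d j))) ⧸
        LinearMap.range ((Submodule.inclusion (hd j)).baseChange Q)) : ℤ) =
        e + Module.finrank Q (LinearMap.ker ((Submodule.inclusion (hd j)).baseChange Q)) := by
    intro j
    have := hfl _ (LinearMap.ker (d j))
    have h2 : LinearMap.range (Submodule.inclusion (hd j)) =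
        (LinearMap.range (d (j + 1))).submoduleOf (LinearMap.ker (d j)) :=
      Submodule.range_inclusion _ _ _
    have : Module.FinitePresentation R
        (LinearMap.ker (d j) ⧸ LinearMap.range (Submodule.inclusion (hd j))) := by
      rw [h2]; exact hH j
    exact lemA _ (Submodule.inclusion_injective _)
  choose e he using hA
  refine ⟨e, fun Q _ _ => ?_⟩
  let δ : ∀ j, Q ⊗[R] LinearMap.range (d j) →ₗ[Q] Q ⊗[R] X j := fun j =>
    (LinearMap.range (d j)).subtype.baseChange Q
  let γ : ∀ j, Q ⊗[R] LinearMap.ker (d j) →ₗ[Q] Q ⊗[R] X (j + 1) := fun j =>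
    (LinearMap.ker (d j)).subtype.baseChange Q
  let β := fun j => (Submodule.inclusion (hd j)).baseChange Q
  let π : ∀ j, Q ⊗[R] X (j + 1) →ₗ[Q] Q ⊗[R] LinearMap.range (d j) := fun j =>
    (d j).rangeRestrict.baseChange Q
  have hex : ∀ j, Function.Exact (LinearMap.ker (d j)).subtype (d j).rangeRestrict := by
    intro j y
    rw [← LinearMap.exact_subtype_ker_map (d j) y]
    exact Subtype.ext_iff
  have hγ : ∀ j, Function.Injective (γ j) := by
    intro j
    have := hfl _ (LinearMap.range (d j))
    exact pure_inj Q _ (d j).rangeRestrict (Submodule.injective_subtype _) (hex j)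
      (d j).surjective_rangeRestrict
  have hγπ : ∀ j, Function.Exact (γ j) (π j) := fun j =>
    lTensor_exact Q (hex j) (d j).surjective_rangeRestrict
  have hπ : ∀ j, Function.Surjective (π j) := fun j =>
    LinearMap.lTensor_surjective _ (d j).surjective_rangeRestrict
  have hδπ : ∀ j, δ j ∘ₗ π j = (d j).baseChange Q := by
    intro j
    rw [← LinearMap.baseChange_comp]
    rfl
  have hγβ : ∀ j, γ j ∘ₗ β j = δ (j + 1) := by
    intro j
    rw [← LinearMap.baseChange_comp]
    rfl
  have hrange : ∀ j, LinearMap.range (γ j ∘ₗ β j) = LinearMap.range ((d (j + 1)).baseChange Q) := by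
    intro j
    rw [hγβ, ← hδπ, LinearMap.range_comp_of_range_eq_top _ (LinearMap.range_eq_top.2 (hπ _))]
  have hker : ∀ j, LinearMap.ker (δ (j + 1)) = LinearMap.ker (β j) := by
    intro j
    rw [← hγβ, LinearMap.ker_comp_of_ker_eq_bot _ (LinearMap.ker_eq_bot.2 (hγ j))]
  have hsub : Subsingleton (Q ⊗[R] LinearMap.range (d 0)) := by
    have : Subsingleton (LinearMap.range (d 0)) := inferInstance
    refine ⟨fun x y => ?_⟩
    have : ∀ x : Q ⊗[R] LinearMap.range (d 0), x = 0 := by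
      intro x
      induction x with
      | zero => rfl
      | add a b ha hb => rw [ha, hb, add_zero]
      | tmul a b => rw [Subsingleton.elim b 0, TensorProduct.tmul_zero]
    rw [this x, this y]
  have hfin : ∀ j, Module.Finite Q (LinearMap.ker (δ j)) := by
    intro j
    cases j with
    | zero => infer_instance
    | succ j => rw [hker]; exact (he j Q).1
  refine ⟨fun j => Module.finrank Q (LinearMap.ker (δ j)), ?_, fun j => ?_⟩
  · exact Module.finrank_zero_of_subsingleton
  · have h1 := (he j Q).2.1
    have h2 := hfin j
    have h3 := lemB (β j) (γ j) (π j) (δ j) (hγ j) (hγπ j) (hπ j)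
    rw [hδπ, hrange] at h3
    refine ⟨h3.1, ?_, by rw [h3.2]; exact Nat.le_add_left _ _⟩
    rw [h3.2]
    push_cast
    rw [(he j Q).2.2, hker]

/-- Telescoping. -/
theorem telescope (h e : ℕ → ℤ) (t : ℕ → ℕ) (ht : t 0 = 0)
    (hh : ∀ j, h j = e j + t (j + 1) + t j) (N : ℕ) :
    ∑ i ∈ Finset.range N, (-1 : ℤ) ^ i * h i =
      ∑ i ∈ Finset.range N, (-1 : ℤ) ^ i * e i - (-1 : ℤ) ^ N * t N := by
  induction N with
  | zero => simp [ht]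
  | succ N ih =>
    rw [Finset.sum_range_succ, ih, Finset.sum_range_succ, hh, pow_succ]
    ring

end dims

end PoC

namespace PoC

section coh

theorem fp_quot {S A M : Type*} [CommRing S] [CommRing A] [Algebra S A] [AddCommGroup M]
    [Module S M] [Module A M] [IsScalarTower S A M] (hs : Function.Surjective (algebraMap S A))
    [Module.FinitePresentation S M] : Module.FinitePresentation A M := by
  have : Module.Finite S A := Module.Finite.of_surjective (Algebra.linearMap S A) hs
  have : Module.Finite A M := Module.Finite.of_restrictScalars_finite S A M
  obtain ⟨n, q, hq⟩ := Module.Finite.exists_fin' A M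
  refine Module.finitePresentation_of_surjective q hq ?_
  have h := Module.FinitePresentation.fg_ker (q.restrictScalars S) hq
  have h2 : LinearMap.ker (q.restrictScalars S) = (LinearMap.ker q).restrictScalars S := rfl
  rw [h2] at h
  exact Submodule.FG.of_restrictScalars S h

variable {R : Type u} [CommRing R] [IsDomain R] [ValuationRing R]

theorem fp_poly {n : ℕ} {M : Type u} [AddCommGroup M] [Module R M]
    [Module (MvPolynomial (Fin n) R) M] [IsScalarTower R (MvPolynomial (Fin n) R) M]
    [Module.Finite (MvPolynomial (Fin n) R) M] [Module.Flat R M] :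
    Module.FinitePresentation (MvPolynomial (Fin n) R) M := by
  obtain ⟨m, q, hq⟩ := Module.Finite.exists_fin' (MvPolynomial (Fin n) R) M
  refine Module.finitePresentation_of_surjective q hq (nagata _ ?_)
  intro r hr v hv
  rw [LinearMap.mem_ker] at hv ⊢
  rw [LinearMap.map_smul_of_tower] at hv
  exact tf_of_flat hr hv

variable {A : Type u} [CommRing A] [Algebra R A] [Algebra.FiniteType R A]

theorem fp_of_flat {M : Type u} [AddCommGroup M] [Module R M] [Module A M] [IsScalarTower R A M]
    [Module.Finite A M] [Module.Flat R M] : Module.FinitePresentation A M := by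
  obtain ⟨n, f, hf⟩ := Algebra.FiniteType.iff_quotient_mvPolynomial''.1
    (inferInstance : Algebra.FiniteType R A)
  let _ : Algebra (MvPolynomial (Fin n) R) A := f.toRingHom.toAlgebra
  let _ : Module (MvPolynomial (Fin n) R) M := Module.compHom M f.toRingHom
  have h1 : IsScalarTower (MvPolynomial (Fin n) R) A M := ⟨fun s a x => by
    change (f s * a) • x = f s • (a • x)
    rw [mul_smul]⟩
  have h2 : IsScalarTower R (MvPolynomial (Fin n) R) M := ⟨fun r s x => by
    change (f (r • s)) • x = r • (f s • x)
    rw [map_smul, smul_assoc]⟩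
  have : Module.Finite (MvPolynomial (Fin n) R) A :=
    Module.Finite.of_surjective (Algebra.linearMap (MvPolynomial (Fin n) R) A) hf
  have : Module.Finite (MvPolynomial (Fin n) R) M := Module.Finite.trans A M
  have := fp_poly (R := R) (n := n) (M := M)
  exact fp_quot (S := MvPolynomial (Fin n) R) hf

theorem fg_ker_of_flat {X M : Type u} [AddCommGroup M] [Module R M] [Module A M]
    [IsScalarTower R A M] [AddCommGroup X] [Module A X] [Module.Finite A X] [Module.Flat R M]
    (g : X →ₗ[A] M) : (LinearMap.ker g).FG := by
  have : Module.Flat R (LinearMap.range g) :=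
    flat_of_injective ((LinearMap.range g).subtype.restrictScalars R)
      (Submodule.injective_subtype _)
  have : Module.FinitePresentation A (LinearMap.range g) := fp_of_flat (R := R)
  have := Module.FinitePresentation.fg_ker g.rangeRestrict g.surjective_rangeRestrict
  rwa [LinearMap.ker_rangeRestrict] at this

end coh

section mat

variable {A : Type u} [CommRing A]

/-- The map `M^n → M^m` given by a matrix. -/
def matMap (M : Type v) [AddCommGroup M] [Module A M] {m n : ℕ} (D : Matrix (Fin m) (Fin n) A) :
    (Fin n → M) →ₗ[A] (Fin m → M) where
  toFun v i := ∑ j, D i j • v j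
  map_add' v w := by ext i; simp [Finset.sum_add_distrib]
  map_smul' a v := by ext i; simp [Finset.smul_sum, smul_smul, mul_comm]

theorem matMap_apply (M : Type v) [AddCommGroup M] [Module A M] {m n : ℕ}
    (D : Matrix (Fin m) (Fin n) A) (v : Fin n → M) (i : Fin m) :
    matMap M D v i = ∑ j, D i j • v j := rfl

theorem matMap_mul (M : Type v) [AddCommGroup M] [Module A M] {m n p : ℕ}
    (D : Matrix (Fin m) (Fin n) A) (E : Matrix (Fin n) (Fin p) A) (v : Fin p → M) :
    matMap M (D * E) v = matMap M D (matMap M E v) := by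
  ext i
  simp only [matMap_apply, Matrix.mul_apply, Finset.sum_smul, Finset.smul_sum, smul_smul]
  rw [Finset.sum_comm]

theorem matMap_add (M : Type v) [AddCommGroup M] [Module A M] {m n : ℕ}
    (D E : Matrix (Fin m) (Fin n) A) (v : Fin n → M) :
    matMap M (D + E) v = matMap M D v + matMap M E v := by
  ext i
  simp [matMap_apply, add_smul, Finset.sum_add_distrib]

theorem matMap_smul_one (M : Type v) [AddCommGroup M] [Module A M] {n : ℕ}
    (x : A) (v : Fin n → M) :
    matMap M (x • (1 : Matrix (Fin n) (Fin n) A)) v = x • v := by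
  ext i
  simp [matMap_apply, Matrix.one_apply]

theorem matMap_zero (M : Type v) [AddCommGroup M] [Module A M] {m n : ℕ} (v : Fin n → M) :
    matMap M (0 : Matrix (Fin m) (Fin n) A) v = 0 := by
  ext i
  simp [matMap_apply]

theorem matMap_mulVec {m n : ℕ} (D : Matrix (Fin m) (Fin n) A) (v : Fin n → A) :
    matMap A D v = D.mulVec v := by
  ext i
  simp [matMap_apply, Matrix.mulVec, dotProduct]

/-- columnwise lifting -/
theorem mat_lift {m n p : ℕ} (D : Matrix (Fin m) (Fin n) A) (E : Matrix (Fin m) (Fin p) A)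
    (h : ∀ j, ∃ v, matMap A D v = fun i => E i j) : ∃ S : Matrix (Fin n) (Fin p) A, D * S = E := by
  choose v hv using h
  refine ⟨Matrix.of fun i j => v j i, ?_⟩
  ext i j
  have := congrFun (hv j) i
  rw [matMap_apply] at this
  rw [← this, Matrix.mul_apply]
  rfl

theorem exists_matrix {m : ℕ} (N : Submodule A (Fin m → A)) (hN : N.FG) :
    ∃ (n : ℕ) (D : Matrix (Fin m) (Fin n) A), LinearMap.range (matMap A D) = N := by
  obtain ⟨n, s, hs⟩ := Submodule.fg_iff_exists_fin_generating_family.1 hN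
  refine ⟨n, Matrix.of fun i j => s j i, ?_⟩
  rw [← hs]
  ext x
  rw [Submodule.mem_span_range_iff_exists_fun]
  refine exists_congr fun v => ?_
  have : (matMap A (Matrix.of fun i j => s j i : Matrix (Fin m) (Fin n) A)) v = ∑ i, v i • s i := by
    ext i
    simp [matMap_apply, mul_comm]
  rw [this]

variable {k : ℕ → ℕ} (D : ∀ i, Matrix (Fin (k i)) (Fin (k (i + 1))) A)

/-- the null homotopy of multiplication by `x` -/
theorem homotopy {P : Type v} [AddCommGroup P] [Module A P] (ε : (Fin (k 0) → A) →ₗ[A] P)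
    (h0 : Function.Exact (matMap A (D 0)) ε)
    (hex : ∀ i, Function.Exact (matMap A (D (i + 1))) (matMap A (D i))) (x : A)
    (hx : ∀ p : P, x • p = 0) :
    (∃ S : Matrix (Fin (k 1)) (Fin (k 0)) A, D 0 * S = x • 1) ∧
    ∀ i, ∃ (S : Matrix (Fin (k (i + 1))) (Fin (k i)) A)
      (S' : Matrix (Fin (k (i + 2))) (Fin (k (i + 1))) A),
      D (i + 1) * S' + S * D i = x • 1 := by
  have hDD : ∀ i, D i * D (i + 1) = 0 := by
    intro i
    ext a b
    have := (hex i).apply_apply_eq_zero (Pi.single b 1)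
    rw [matMap_mulVec, matMap_mulVec, Matrix.mulVec_mulVec, Matrix.mulVec_single_one] at this
    exact congrFun this a
  have hl : ∀ (i p : ℕ) (E : Matrix (Fin (k (i + 1))) (Fin p) A), D i * E = 0 →
      ∃ S : Matrix (Fin (k (i + 2))) (Fin p) A, D (i + 1) * S = E := by
    intro i p E hE
    refine mat_lift _ _ fun j => (hex i _).1 ?_
    ext a
    exact congrFun (congrFun hE a) j
  have b0 : ∃ S : Matrix (Fin (k 1)) (Fin (k 0)) A, D 0 * S = x • 1 := by
    refine mat_lift _ _ fun j => (h0 _).1 ?_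
    have : (fun i => (x • (1 : Matrix (Fin (k 0)) (Fin (k 0)) A)) i j) = x • Pi.single j 1 := by
      ext i
      simp [Matrix.one_apply, Pi.single_apply]
    rw [this, map_smul, hx]
  refine ⟨b0, fun i => ?_⟩
  induction i with
  | zero =>
    obtain ⟨S, hS⟩ := b0
    obtain ⟨S', hS'⟩ := hl 0 _ (x • 1 - S * D 0) (by
      rw [Matrix.mul_sub, ← Matrix.mul_assoc, hS]
      simp)
    exact ⟨S, S', by rw [hS']; abel⟩
  | succ i ih =>
    obtain ⟨S, S', h⟩ := ih
    obtain ⟨S'', hS''⟩ := hl (i + 1) _ (x • 1 - S' * D (i + 1)) (by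
      rw [Matrix.mul_sub, ← Matrix.mul_assoc, eq_sub_of_add_eq h, Matrix.sub_mul, Matrix.mul_assoc S, hDD]
      simp)
    exact ⟨S', S'', by rw [hS'']; abel⟩

end mat

end PoC

namespace PoC

section res

variable {R : Type u} [CommRing R] [IsDomain R] [ValuationRing R]
variable {A : Type u} [CommRing A] [Algebra R A] [Algebra.FiniteType R A]

theorem flat_pi (n : ℕ) (M : Type u) [AddCommGroup M] [Module R M] [Module.Flat R M] :
    Module.Flat R (Fin n → M) :=
  flat_iff_tf.2 fun _ hr _ hx => funext fun i => tf_of_flat hr (congrFun hx i)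

variable (R) in
/-- Existence of a resolution of `P` by finite free modules. -/
theorem exists_resolution [Module.Flat R A] (P : Type u) [AddCommGroup P] [Module R P]
    [Module A P] [IsScalarTower R A P] [Module.Finite A P] [Module.Flat R P] :
    ∃ (k : ℕ → ℕ) (D : ∀ i, Matrix (Fin (k i)) (Fin (k (i + 1))) A)
      (ε : (Fin (k 0) → A) →ₗ[A] P), Function.Surjective ε ∧
      Function.Exact (matMap A (D 0)) ε ∧
      ∀ i, Function.Exact (matMap A (D (i + 1))) (matMap A (D i)) := by
  obtain ⟨k0, ε, hε⟩ := Module.Finite.exists_fin' A P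
  have hfg : ∀ (m n : ℕ) (D : Matrix (Fin m) (Fin n) A), (LinearMap.ker (matMap A D)).FG :=
    fun m n D => have := flat_pi (R := R) m A
      fg_ker_of_flat (R := R) _
  let St := {p : Σ k : ℕ, Submodule A (Fin k → A) // p.2.FG}
  have hnext : ∀ s : St, ∃ (n : ℕ) (D : Matrix (Fin s.1.1) (Fin n) A),
      LinearMap.range (matMap A D) = s.1.2 := fun s => exists_matrix s.1.2 s.2
  choose nn DD hD using hnext
  let step : St → St := fun s => ⟨⟨nn s, LinearMap.ker (matMap A (DD s))⟩, hfg _ _ _⟩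
  let s0 : St := ⟨⟨k0, LinearMap.ker ε⟩, fg_ker_of_flat (R := R) ε⟩
  let σ : ℕ → St := fun i => Nat.rec s0 (fun _ s => step s) i
  refine ⟨fun i => (σ i).1.1, fun i => DD (σ i), ε, hε, ?_, ?_⟩
  · rw [LinearMap.exact_iff]
    exact (hD s0).symm
  · intro i
    rw [LinearMap.exact_iff]
    exact (hD (σ (i + 1))).symm

theorem kill0 {A : Type u} [CommRing A] {M : Type v} [AddCommGroup M] [Module A M] {m n : ℕ}
    (D : Matrix (Fin m) (Fin n) A) (S : Matrix (Fin n) (Fin m) A) (x : A) (h : D * S = x • 1)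
    (v : Fin m → M) : x • v ∈ LinearMap.range (matMap M D) :=
  ⟨matMap M S v, by rw [← matMap_mul, h, matMap_smul_one]⟩

theorem kill1 {A : Type u} [CommRing A] {M : Type v} [AddCommGroup M] [Module A M] {l m n : ℕ}
    (D : Matrix (Fin m) (Fin n) A) (S : Matrix (Fin n) (Fin m) A)
    (D0 : Matrix (Fin l) (Fin m) A) (S0 : Matrix (Fin m) (Fin l) A)
    (x : A) (h : D * S + S0 * D0 = x • 1)
    (v : Fin m → M) (hv : matMap M D0 v = 0) : x • v ∈ LinearMap.range (matMap M D) :=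
  ⟨matMap M S v, by rw [← matMap_smul_one, ← h, matMap_add, matMap_mul, matMap_mul, hv, map_zero,
    add_zero]⟩

/-- extension of the index by zero -/
def extK (k : ℕ → ℕ) : ℕ → ℕ
  | 0 => 0
  | i + 1 => k i

/-- extension of the matrices by zero -/
def extD {A : Type u} [CommRing A] {k : ℕ → ℕ} (D : ∀ i, Matrix (Fin (k i)) (Fin (k (i + 1))) A) :
    ∀ i, Matrix (Fin (extK k i)) (Fin (extK k (i + 1))) A
  | 0 => (0 : Matrix (Fin 0) (Fin (k 0)) A)
  | i + 1 => D i

/-- Finite presentation of the homology over `R`. -/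
theorem homology_fp [Algebra.FinitePresentation R A] [Module.Flat R A] (I I' : Ideal A)
    [Module.Flat R (A ⧸ I)] [Module.Flat R (A ⧸ I')] [Module.Finite R (A ⧸ (I + I'))]
    {k : ℕ → ℕ} (D : ∀ i, Matrix (Fin (k i)) (Fin (k (i + 1))) A)
    (ε : (Fin (k 0) → A) →ₗ[A] A ⧸ I') (h0 : Function.Exact (matMap A (D 0)) ε)
    (hex : ∀ i, Function.Exact (matMap A (D (i + 1))) (matMap A (D i))) (j : ℕ) :
    LinearMap.range ((matMap (A ⧸ I) (extD D (j + 1))).restrictScalars R) ≤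
      LinearMap.ker ((matMap (A ⧸ I) (extD D j)).restrictScalars R) ∧
    Module.FinitePresentation R
      (Hm (LinearMap.ker ((matMap (A ⧸ I) (extD D j)).restrictScalars R))
        (LinearMap.range ((matMap (A ⧸ I) (extD D (j + 1))).restrictScalars R))) := by
  have hDD : ∀ i, D i * D (i + 1) = 0 := by
    intro i
    ext a b
    have := (hex i).apply_apply_eq_zero (Pi.single b 1)
    rw [matMap_mulVec, matMap_mulVec, Matrix.mulVec_mulVec, Matrix.mulVec_single_one] at this
    exact congrFun this a
  have hkill : ∀ x ∈ I', ∀ v : Fin (extK k (j + 1)) → A ⧸ I, matMap (A ⧸ I) (extD D j) v = 0 →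
      x • v ∈ LinearMap.range (matMap (A ⧸ I) (extD D (j + 1))) := by
    intro x hx v hv
    have hh := homotopy D ε h0 hex x (fun p => by
      obtain ⟨p, rfl⟩ := Ideal.Quotient.mk_surjective p
      rw [← Ideal.Quotient.mk_eq_mk, ← Submodule.Quotient.mk_smul, Submodule.Quotient.mk_eq_zero]
      exact I'.mul_mem_right _ hx)
    cases j with
    | zero =>
      obtain ⟨S, hS⟩ := hh.1
      exact kill0 (D 0) S x hS v
    | succ j =>
      obtain ⟨S, S', hS⟩ := hh.2 j
      exact kill1 (D (j + 1)) S' (D j) S x hS v hv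
  have hle : LinearMap.range (matMap (A ⧸ I) (extD D (j + 1))) ≤
      LinearMap.ker (matMap (A ⧸ I) (extD D j)) := by
    rintro _ ⟨v, rfl⟩
    rw [LinearMap.mem_ker, ← matMap_mul]
    cases j with
    | zero =>
      ext i
      exact i.elim0
    | succ j =>
      have : extD D (j + 1) * extD D (j + 1 + 1) = 0 := hDD j
      rw [this, matMap_zero]
  refine ⟨hle, ?_⟩
  generalize hg : matMap (A ⧸ I) (extD D j) = g at *
  generalize hf : matMap (A ⧸ I) (extD D (j + 1)) = f at *
  let Z := LinearMap.ker g
  let H := Hm Z (LinearMap.range f)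
  have := flat_pi (R := R) (extK k j) (A ⧸ I)
  have := flat_pi (R := R) (extK k (j + 1)) (A ⧸ I)
  have hZfin : Module.Finite A Z := Module.Finite.iff_fg.2 (fg_ker_of_flat (R := R) g)
  have hZfl : Module.Flat R Z := flat_of_injective (Z.subtype.restrictScalars R)
      (Submodule.injective_subtype _)
  have hZ : Module.FinitePresentation A Z := fp_of_flat (R := R)
  have hHA : Module.FinitePresentation A H := by
    refine Module.finitePresentation_of_surjective (Submodule.mkQ _) (Submodule.mkQ_surjective _) ?_
    rw [Submodule.ker_mkQ]
    have h1 : (LinearMap.range f).submoduleOf Z = LinearMap.range (f.codRestrict Z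
      (fun v => hle ⟨v, rfl⟩)) := by
      ext ⟨y, hy⟩
      constructor
      · rintro ⟨v, hv⟩
        exact ⟨v, Subtype.ext hv⟩
      · rintro ⟨v, hv⟩
        exact ⟨v, congrArg Subtype.val hv⟩
    rw [h1, LinearMap.range_eq_map]
    exact Submodule.FG.map _ Module.Finite.fg_top
  have hJ : Module.IsTorsionBySet A H (I + I' : Ideal A) := by
    rintro z ⟨x, hx⟩
    obtain ⟨⟨z, hz⟩, rfl⟩ := Submodule.mkQ_surjective _ z
    obtain ⟨a, ha, b, hb, rfl⟩ := Submodule.mem_sup.1 hx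
    change (a + b) • _ = _
    rw [← map_smul, Submodule.mkQ_apply, Submodule.Quotient.mk_eq_zero]
    change (a + b) • z ∈ LinearMap.range f
    have haz : a • z = 0 := by
      ext i
      change a • z i = 0
      obtain ⟨p, hp⟩ := Ideal.Quotient.mk_surjective (z i)
      rw [← hp, ← Ideal.Quotient.mk_eq_mk, ← Submodule.Quotient.mk_smul, Submodule.Quotient.mk_eq_zero]
      exact I.mul_mem_right _ ha
    rw [add_smul, haz, zero_add]
    exact hkill b hb z hz
  let _ : Module (A ⧸ (I + I')) H := hJ.module
  have t1 : IsScalarTower A (A ⧸ (I + I')) H := hJ.isScalarTower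
  have t2 : IsScalarTower R (A ⧸ (I + I')) H := hJ.isScalarTower
  have : Module.FinitePresentation (A ⧸ (I + I')) H :=
    fp_quot (S := A) Ideal.Quotient.mk_surjective
  have hIfg : ∀ (I : Ideal A) [Module.Flat R (A ⧸ I)], I.FG := by
    intro I _
    have := fg_ker_of_flat (R := R) I.mkQ
    rwa [Submodule.ker_mkQ] at this
  have : Algebra.FinitePresentation R (A ⧸ (I + I')) :=
    Algebra.FinitePresentation.quotient (Submodule.FG.sup (hIfg I) (hIfg I'))
  have : Module.FinitePresentation R (A ⧸ (I + I')) :=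
    Module.FinitePresentation.of_finite_of_finitePresentation _ _
  exact Module.FinitePresentation.trans R H (A ⧸ (I + I'))

end res

end PoC

namespace PoC

section bc

open TensorProduct

theorem exact_transfer {X Y Z X' Y' Z' : Type*} [AddCommGroup Z] [AddCommGroup Z']
    {f : X → Y} {g : Y → Z} {f' : X' → Y'} {g' : Y' → Z'}
    (e1 : X ≃ X') (e2 : Y ≃ Y') (e3 : Z ≃+ Z') (h1 : ∀ x, f' (e1 x) = e2 (f x))
    (h2 : ∀ y, g' (e2 y) = e3 (g y)) (h : Function.Exact f g) : Function.Exact f' g' := by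
  intro y'
  obtain ⟨y, rfl⟩ := e2.surjective y'
  rw [h2, map_eq_zero_iff e3 e3.injective, h y]
  constructor
  · rintro ⟨x, rfl⟩
    exact ⟨e1 x, h1 x⟩
  · rintro ⟨x, hx⟩
    obtain ⟨x, rfl⟩ := e1.surjective x
    rw [h1] at hx
    exact ⟨x, e2.injective hx⟩

theorem Hm_equiv {Q X Y Z X' Y' Z' : Type*} [CommRing Q] [AddCommGroup X] [Module Q X]
    [AddCommGroup Y] [Module Q Y] [AddCommGroup Z] [Module Q Z]
    [AddCommGroup X'] [Module Q X'] [AddCommGroup Y'] [Module Q Y'] [AddCommGroup Z'] [Module Q Z']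
    {f : X →ₗ[Q] Y} {g : Y →ₗ[Q] Z} {f' : X' →ₗ[Q] Y'} {g' : Y' →ₗ[Q] Z'}
    (e1 : X ≃ₗ[Q] X') (e2 : Y ≃ₗ[Q] Y') (e3 : Z ≃ₗ[Q] Z') (h1 : ∀ x, f' (e1 x) = e2 (f x))
    (h2 : ∀ y, g' (e2 y) = e3 (g y)) :
    Nonempty (Hm (LinearMap.ker g) (LinearMap.range f) ≃ₗ[Q]
      Hm (LinearMap.ker g') (LinearMap.range f')) := by
  have hk : Submodule.map (e2 : Y →ₗ[Q] Y') (LinearMap.ker g) = LinearMap.ker g' := by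
    ext y'
    constructor
    · rintro ⟨y, hy, rfl⟩
      have hy : g y = 0 := hy
      change g' (e2 y) = 0
      rw [h2, hy, map_zero]
    · intro hy
      obtain ⟨y, rfl⟩ := e2.surjective y'
      have hy : g' (e2 y) = 0 := hy
      rw [h2, map_eq_zero_iff e3 e3.injective] at hy
      exact ⟨y, hy, rfl⟩
  let e := LinearEquiv.ofSubmodules e2 _ _ hk
  refine ⟨Submodule.Quotient.equiv _ _ e ?_⟩
  ext ⟨y', hy'⟩
  constructor
  · rintro ⟨⟨y, hy⟩, ⟨x, hx⟩, h⟩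
    have hx : f x = y := hx
    have h : e2 y = y' := congrArg Subtype.val h
    refine ⟨e1 x, ?_⟩
    change f' (e1 x) = y'
    rw [h1, hx, h]
  · rintro ⟨x', hx⟩
    have hx : f' x' = y' := hx
    obtain ⟨x, rfl⟩ := e1.surjective x'
    rw [h1] at hx
    subst hx
    have hk2 : f x ∈ LinearMap.ker g := by
      have : g' (e2 (f x)) = 0 := hy'
      rw [h2, map_eq_zero_iff e3 e3.injective] at this
      exact this
    exact ⟨⟨f x, hk2⟩, ⟨x, rfl⟩, rfl⟩

variable {R : Type u} [CommRing R] {A : Type u} [CommRing A] [Algebra R A]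
variable (Q : Type u) [CommRing Q] [Algebra R Q]

section theta

variable {M : Type u} [AddCommGroup M] [Module R M] [Module A M] [IsScalarTower R A M]
variable {W : Type u} [AddCommGroup W] [Module Q W] [Module (Q ⊗[R] A) W]

variable (τ : Q ⊗[R] M ≃ₗ[Q] W)

/-- the comparison on powers -/
noncomputable def Theta (n : ℕ) : Q ⊗[R] (Fin n → M) ≃ₗ[Q] (Fin n → W) :=
  (TensorProduct.piRight R Q Q (fun _ => M)).trans (LinearEquiv.piCongrRight fun _ => τ)

theorem Theta_tmul (n : ℕ) (q : Q) (v : Fin n → M) (i : Fin n) :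
    Theta Q τ n (q ⊗ₜ v) i = τ (q ⊗ₜ v i) := by
  simp [Theta]

theorem Theta_matMap
    (hτ : ∀ q a p (y : M), τ ((q * p) ⊗ₜ (a • y)) = (q ⊗ₜ a : Q ⊗[R] A) • τ (p ⊗ₜ y))
    {m n : ℕ} (D : Matrix (Fin m) (Fin n) A) (x : Q ⊗[R] (Fin n → M)) :
    matMap W (D.map (Algebra.TensorProduct.includeRight : A →ₐ[R] Q ⊗[R] A)) (Theta Q τ n x) =
      Theta Q τ m (((matMap M D).restrictScalars R).lTensor Q x) := by
  induction x with
  | zero => simp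
  | add a b ha hb => rw [map_add, map_add, ha, hb, map_add, map_add]
  | tmul q v =>
    ext i
    rw [LinearMap.lTensor_tmul, Theta_tmul, matMap_apply]
    simp only [Theta_tmul, Matrix.map_apply, Algebra.TensorProduct.includeRight_apply,
      LinearMap.restrictScalars_apply, matMap_apply, TensorProduct.tmul_sum, map_sum]
    refine Finset.sum_congr rfl fun j _ => ?_
    rw [← hτ, one_mul]

end theta

theorem exists_tau (I : Ideal A) : ∃ τ : Q ⊗[R] (A ⧸ I) ≃ₗ[Q]
    ((Q ⊗[R] A) ⧸ I.map (Algebra.TensorProduct.includeRight : A →ₐ[R] Q ⊗[R] A)),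
    ∀ q a p (y : A ⧸ I), τ ((q * p) ⊗ₜ (a • y)) = (q ⊗ₜ a : Q ⊗[R] A) • τ (p ⊗ₜ y) := by
  let φ : Q ⊗[R] A →ₐ[Q] Q ⊗[R] (A ⧸ I) :=
    Algebra.TensorProduct.map (AlgHom.id Q Q) (Ideal.Quotient.mkₐ R I)
  have hφ : Function.Surjective φ :=
    LinearMap.lTensor_surjective Q (g := (Ideal.Quotient.mkₐ R I).toLinearMap)
      (Ideal.Quotient.mkₐ_surjective R I)
  have hker : RingHom.ker φ =
      I.map (Algebra.TensorProduct.includeRight : A →ₐ[R] Q ⊗[R] A) := by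
    have := Algebra.TensorProduct.lTensor_ker (A := Q) (Ideal.Quotient.mkₐ R I)
      (Ideal.Quotient.mkₐ_surjective R I)
    rw [show RingHom.ker (Ideal.Quotient.mkₐ R I) = I from Ideal.Quotient.mkₐ_ker R I] at this
    rw [← this]
    rfl
  let e := (Ideal.quotientEquivAlgOfEq Q hker.symm).trans
    (Ideal.quotientKerAlgEquivOfSurjective hφ)
  have he : ∀ b, e (Ideal.Quotient.mk _ b) = φ b := fun b => rfl
  have hsymm : ∀ q (a : A), e.symm (q ⊗ₜ Ideal.Quotient.mk I a) = Ideal.Quotient.mk _ (q ⊗ₜ a) := by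
    intro q a
    rw [AlgEquiv.symm_apply_eq, he]
    simp [φ]
  refine ⟨e.symm.toLinearEquiv, fun q a p y => ?_⟩
  obtain ⟨y, rfl⟩ := Ideal.Quotient.mk_surjective y
  change e.symm ((q * p) ⊗ₜ Ideal.Quotient.mk I (a * y)) =
    (q ⊗ₜ a : Q ⊗[R] A) • e.symm (p ⊗ₜ Ideal.Quotient.mk I y)
  rw [hsymm, hsymm, ← Algebra.TensorProduct.tmul_mul_tmul, map_mul]
  rfl

/-- base change of the resolution -/
theorem bc_resolution {R : Type u} [CommRing R] [IsDomain R] [ValuationRing R] {A : Type u}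
    [CommRing A] [Algebra R A] [Module.Flat R A] (Q : Type u) [CommRing Q] [Algebra R Q]
    (I' : Ideal A) [Module.Flat R (A ⧸ I')] {k : ℕ → ℕ}
    (D : ∀ i, Matrix (Fin (k i)) (Fin (k (i + 1))) A)
    (ε : (Fin (k 0) → A) →ₗ[A] A ⧸ I') (hε : Function.Surjective ε)
    (h0 : Function.Exact (matMap A (D 0)) ε)
    (hex : ∀ i, Function.Exact (matMap A (D (i + 1))) (matMap A (D i))) :
    ∃ ε' : (Fin (k 0) → Q ⊗[R] A) →ₗ[Q ⊗[R] A]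
        ((Q ⊗[R] A) ⧸ I'.map (Algebra.TensorProduct.includeRight : A →ₐ[R] Q ⊗[R] A)),
      Function.Surjective ε' ∧
      Function.Exact (matMap (Q ⊗[R] A)
        ((D 0).map (Algebra.TensorProduct.includeRight : A →ₐ[R] Q ⊗[R] A))) ε' ∧
      ∀ i, Function.Exact
        (matMap (Q ⊗[R] A) ((D (i + 1)).map
          (Algebra.TensorProduct.includeRight : A →ₐ[R] Q ⊗[R] A)))
        (matMap (Q ⊗[R] A) ((D i).map
          (Algebra.TensorProduct.includeRight : A →ₐ[R] Q ⊗[R] A))) := by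
  let τ0 : Q ⊗[R] A ≃ₗ[Q] Q ⊗[R] A := LinearEquiv.refl _ _
  have hτ0 : ∀ q a p (y : A), τ0 ((q * p) ⊗ₜ (a • y)) = (q ⊗ₜ a : Q ⊗[R] A) • τ0 (p ⊗ₜ y) := by
    intro q a p y
    simp [τ0, Algebra.TensorProduct.tmul_mul_tmul]
  obtain ⟨τ, hτ⟩ := exists_tau (R := R) Q I'
  let ε' := Fintype.linearCombination (Q ⊗[R] A)
    (fun i : Fin (k 0) => τ ((1 : Q) ⊗ₜ ε (Pi.single i 1)))
  have hε' : ∀ x, ε' (Theta Q τ0 (k 0) x) = τ ((ε.restrictScalars R).lTensor Q x) := by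
    intro x
    induction x with
    | zero => simp
    | add a b ha hb => rw [map_add, map_add, ha, hb, map_add, map_add]
    | tmul q v =>
      have hv : ε v = ∑ i, v i • ε (Pi.single i 1) := by
        conv_lhs => rw [pi_eq_sum_univ' v]
        rw [map_sum]
        refine Finset.sum_congr rfl fun i _ => ?_
        rw [map_smul]
      simp only [ε', Fintype.linearCombination_apply, Theta_tmul, LinearMap.lTensor_tmul,
        LinearMap.restrictScalars_apply]
      rw [hv, TensorProduct.tmul_sum, map_sum]
      refine Finset.sum_congr rfl fun i _ => ?_
      have := hτ q (v i) 1 (ε (Pi.single i 1))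
      rw [mul_one] at this
      rw [this]
      rfl
  refine ⟨ε', ?_, ?_, ?_⟩
  · intro y
    obtain ⟨z, rfl⟩ := τ.surjective y
    obtain ⟨x, rfl⟩ := LinearMap.lTensor_surjective Q (g := ε.restrictScalars R) hε z
    exact ⟨_, hε' x⟩
  · refine exact_transfer (Theta Q τ0 (k 1)).toEquiv (Theta Q τ0 (k 0)).toEquiv τ.toAddEquiv
      (Theta_matMap Q τ0 hτ0 (D 0)) hε' ?_
    exact lTensor_exact Q (f := (matMap A (D 0)).restrictScalars R) (g := ε.restrictScalars R) h0 hε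
  · intro i
    refine exact_transfer (Theta Q τ0 _).toEquiv (Theta Q τ0 _).toEquiv (Theta Q τ0 _).toAddEquiv
      (Theta_matMap Q τ0 hτ0 (D (i + 1))) (Theta_matMap Q τ0 hτ0 (D i)) ?_
    have : Module.Flat R ((Fin (k i) → A) ⧸
        LinearMap.range ((matMap A (D i)).restrictScalars R)) := by
      cases i with
      | zero =>
        have h : LinearMap.range ((matMap A (D 0)).restrictScalars R) =
            LinearMap.ker (ε.restrictScalars R) := by
          rw [eq_comm, ← LinearMap.exact_iff]
          exact h0
        rw [h]
        exact Module.Flat.of_linearEquiv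
          (LinearMap.quotKerEquivOfSurjective (ε.restrictScalars R) hε)
      | succ i =>
        have h : LinearMap.range ((matMap A (D (i + 1))).restrictScalars R) =
            LinearMap.ker ((matMap A (D i)).restrictScalars R) := by
          rw [eq_comm, ← LinearMap.exact_iff]
          exact hex i
        rw [h]
        have := flat_pi (R := R) (k i) A
        have : Module.Flat R (LinearMap.range ((matMap A (D i)).restrictScalars R)) :=
          flat_of_injective _ (Submodule.injective_subtype _)
        exact Module.Flat.of_linearEquiv
          (LinearMap.quotKerEquivRange ((matMap A (D i)).restrictScalars R))
    exact exact_lTensor Q ((matMap A (D (i + 1))).restrictScalars R)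
      ((matMap A (D i)).restrictScalars R) (hex i)

end bc

end PoC

namespace PoC

section tor

variable {B : Type u} [CommRing B] {F : ℕ → Type u} [∀ i, AddCommGroup (F i)]
  [∀ i, Module B (F i)] (d : ∀ i, F (i + 1) →ₗ[B] F i)

/-- the chain complex -/
noncomputable def cpx (hd : ∀ i x, d i (d (i + 1) x) = 0) : ChainComplex (ModuleCat.{u} B) ℕ :=
  ChainComplex.of (fun i => ModuleCat.of B (F i)) (fun i => ModuleCat.ofHom (d i)) (fun i => by
    ext x
    exact hd i x)

theorem cpx_d (hd : ∀ i x, d i (d (i + 1) x) = 0) (i : ℕ) :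
    (cpx d hd).d (i + 1) i = ModuleCat.ofHom (d i) :=
  ChainComplex.of_d (fun i => ModuleCat.of B (F i)) (fun i => ModuleCat.ofHom (d i)) i

theorem exists_projRes [∀ i, Module.Projective B (F i)] {P : Type u} [AddCommGroup P] [Module B P]
    (ε : F 0 →ₗ[B] P) (hε : Function.Surjective ε) (h0 : Function.Exact (d 0) ε)
    (hex : ∀ i, Function.Exact (d (i + 1)) (d i)) :
    ∃ r : ProjectiveResolution (ModuleCat.of B P),
      r.complex = cpx d (fun i x => (hex i).apply_apply_eq_zero x) := by
  let C := cpx d (fun i x => (hex i).apply_apply_eq_zero x)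
  have hw : C.d 1 0 ≫ ModuleCat.ofHom ε = 0 := by
    have h1 : C.d 1 0 = ModuleCat.ofHom (d 0) := cpx_d d _ 0
    rw [h1]
    ext x
    exact h0.apply_apply_eq_zero x
  let π : C ⟶ (ChainComplex.single₀ _).obj (ModuleCat.of B P) :=
    (ChainComplex.toSingle₀Equiv C (ModuleCat.of B P)).symm ⟨ModuleCat.ofHom ε, hw⟩
  have hπ : π.f 0 = ModuleCat.ofHom ε := ChainComplex.toSingle₀Equiv_symm_apply_f_zero _ _
  have hq : QuasiIso π := ⟨fun n => by
    cases n with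
    | zero =>
      rw [ChainComplex.quasiIsoAt₀_iff, ShortComplex.quasiIso_iff_of_zeros' _ (C.shape _ _ (by simp)) rfl rfl]
      constructor
      · rw [ShortComplex.moduleCat_exact_iff]
        intro x hx
        have hx : (π.f 0).hom x = 0 := hx
        rw [hπ] at hx
        obtain ⟨y, hy⟩ := (h0 x).1 hx
        refine ⟨y, ?_⟩
        change (C.d 1 0).hom y = x
        have h1 : C.d 1 0 = ModuleCat.ofHom (d 0) := cpx_d d _ 0
        rw [h1]
        exact hy
      · change Epi (π.f 0)
        rw [hπ]
        exact (ModuleCat.epi_iff_surjective _).2 hε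
    | succ n =>
      rw [quasiIsoAt_iff_exactAt' (hL := ChainComplex.exactAt_succ_single_obj ..),
          HomologicalComplex.exactAt_iff' _ (n + 2) (n + 1) n (by simp) (by simp)]
      rw [ShortComplex.moduleCat_exact_iff]
      intro x hx
      have hx : (C.d (n + 1) n).hom x = 0 := hx
      have h1 : C.d (n + 1) n = ModuleCat.ofHom (d n) := cpx_d d _ n
      have h2 : C.d (n + 2) (n + 1) = ModuleCat.ofHom (d (n + 1)) := cpx_d d _ (n + 1)
      rw [h1] at hx
      obtain ⟨y, hy⟩ := (hex n x).1 hx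
      refine ⟨y, ?_⟩
      change (C.d (n + 2) (n + 1)).hom y = x
      rw [h2]
      exact hy⟩
  refine ⟨{ complex := C, projective := fun n => ?_, π := π, quasiIso := hq }, rfl⟩
  change Projective (ModuleCat.of B (F n))
  infer_instance

theorem homology_Hm (S : ShortComplex (ModuleCat.{u} B)) :
    Nonempty (S.homology ≃ₗ[B] Hm (LinearMap.ker S.g.hom) (LinearMap.range S.f.hom)) := by
  refine ⟨S.moduleCatHomologyIso.toLinearEquiv.trans (Submodule.quotEquivOfEq _ _ ?_)⟩
  ext ⟨y, hy⟩
  constructor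
  · rintro ⟨x, hx⟩
    exact ⟨x, congrArg Subtype.val hx⟩
  · rintro ⟨x, hx⟩
    exact ⟨x, Subtype.ext hx⟩

end tor

end PoC

namespace PoC

section tor2

variable {B : Type u} [CommRing B]

theorem matMap_tensor (N : Type u) [AddCommGroup N] [Module B N] {m n : ℕ}
    (D : Matrix (Fin m) (Fin n) B) (x : TensorProduct B N (Fin n → B)) :
    matMap N D (TensorProduct.piScalarRight B B N (Fin n) x) =
      TensorProduct.piScalarRight B B N (Fin m) ((matMap B D).lTensor N x) := by
  induction x with
  | zero => simp
  | add a b ha hb => rw [map_add, map_add, ha, hb, map_add, map_add]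
  | tmul q v =>
    ext i
    simp only [LinearMap.lTensor_tmul, TensorProduct.piScalarRight_apply,
      TensorProduct.piScalarRightHom_tmul, matMap_apply, Finset.sum_smul, smul_eq_mul, mul_smul]

theorem tor_Hm {k : ℕ → ℕ} (D : ∀ i, Matrix (Fin (k i)) (Fin (k (i + 1))) B)
    {P : Type u} [AddCommGroup P] [Module B P]
    (ε : (Fin (k 0) → B) →ₗ[B] P) (hε : Function.Surjective ε)
    (h0 : Function.Exact (matMap B (D 0)) ε)
    (hex : ∀ i, Function.Exact (matMap B (D (i + 1))) (matMap B (D i)))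
    (N : Type u) [AddCommGroup N] [Module B N] (i : ℕ) :
    Nonempty (((Tor (ModuleCat.{u} B) i).obj (ModuleCat.of B N)).obj (ModuleCat.of B P) ≃ₗ[B]
      Hm (LinearMap.ker (matMap N (extD D i))) (LinearMap.range (matMap N (extD D (i + 1))))) := by
  obtain ⟨r, hr⟩ := exists_projRes (F := fun i => Fin (k i) → B) (fun i => matMap B (D i)) ε hε h0 hex
  let G := (MonoidalCategory.tensoringLeft (ModuleCat.{u} B)).obj (ModuleCat.of B N)
  let C := (G.mapHomologicalComplex (ComplexShape.down ℕ)).obj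
    (cpx (F := fun i => Fin (k i) → B) (fun i => matMap B (D i))
      (fun i x => (hex i).apply_apply_eq_zero x))
  have e1 : (((Tor (ModuleCat.{u} B) i).obj (ModuleCat.of B N)).obj (ModuleCat.of B P)) ≅
      C.homology i := by
    have := r.isoLeftDerivedObj G i
    rw [hr] at this
    exact this
  have hCd : ∀ j, C.d (j + 1) j = G.map (ModuleCat.ofHom (matMap B (D j))) := fun j =>
    congrArg G.map (cpx_d (F := fun i => Fin (k i) → B) (fun i => matMap B (D i)) _ j)
  have hCd' : ∀ j (x : TensorProduct B N (Fin (k (j + 1)) → B)),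
      (C.d (j + 1) j).hom x = (matMap B (D j)).lTensor N x := by
    intro j x
    rw [hCd j]
    rfl
  cases i with
  | zero =>
    have e2 := C.homologyIsoSc' 1 0 0 (by simp) (by simp)
    obtain ⟨e3⟩ := homology_Hm (C.sc' 1 0 0)
    have hz : LinearMap.ker (C.sc' 1 0 0).g.hom =
        LinearMap.ker (0 : TensorProduct B N (Fin (k 0) → B) →ₗ[B] (Fin 0 → N)) := by
      have : (C.sc' 1 0 0).g = 0 := C.shape _ _ (by simp)
      rw [this]
      exact LinearMap.ker_zero.trans LinearMap.ker_zero.symm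
    rw [hz] at e3
    obtain ⟨e4⟩ := Hm_equiv (Q := B) (f := (C.sc' 1 0 0).f.hom)
      (g := (0 : TensorProduct B N (Fin (k 0) → B) →ₗ[B] (Fin 0 → N)))
      (f' := matMap N (extD D 1)) (g' := matMap N (extD D 0))
      (TensorProduct.piScalarRight B B N (Fin (k 1)))
      (TensorProduct.piScalarRight B B N (Fin (k 0))) (LinearEquiv.refl B _)
      (fun x => by
        refine (matMap_tensor N (D 0) x).trans ?_
        exact congrArg _ (hCd' 0 x).symm)
      (fun y => by ext i; exact i.elim0)
    exact ⟨(e1 ≪≫ e2).toLinearEquiv.trans (e3.trans e4)⟩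
  | succ i =>
    have e2 := C.homologyIsoSc' (i + 2) (i + 1) i (by simp) (by simp)
    obtain ⟨e3⟩ := homology_Hm (C.sc' (i + 2) (i + 1) i)
    obtain ⟨e4⟩ := Hm_equiv (Q := B) (f := (C.sc' (i + 2) (i + 1) i).f.hom)
      (g := (C.sc' (i + 2) (i + 1) i).g.hom)
      (f' := matMap N (extD D (i + 2))) (g' := matMap N (extD D (i + 1)))
      (TensorProduct.piScalarRight B B N (Fin (k (i + 2))))
      (TensorProduct.piScalarRight B B N (Fin (k (i + 1))))
      (TensorProduct.piScalarRight B B N (Fin (k i)))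
      (fun x => by
        refine (matMap_tensor N (D (i + 1)) x).trans ?_
        exact congrArg _ (hCd' (i + 1) x).symm)
      (fun x => by
        refine (matMap_tensor N (D i) x).trans ?_
        exact congrArg _ (hCd' i x).symm)
    exact ⟨(e1 ≪≫ e2).toLinearEquiv.trans (e3.trans e4)⟩

end tor2

end PoC

namespace PoC

section final

open TensorProduct

theorem Hm_restrict {Q B X Y Z : Type u} [CommRing Q] [CommRing B] [Algebra Q B]
    [AddCommGroup X] [Module Q X] [Module B X] [IsScalarTower Q B X]
    [AddCommGroup Y] [Module Q Y] [Module B Y] [IsScalarTower Q B Y]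
    [AddCommGroup Z] [Module Q Z] [Module B Z] [IsScalarTower Q B Z]
    (f : X →ₗ[B] Y) (g : Y →ₗ[B] Z) (M : ModuleCat.{u} B)
    (e : M ≃ₗ[B] Hm (LinearMap.ker g) (LinearMap.range f))
    (V : Type u) [AddCommGroup V] [Module Q V]
    (e' : V ≃ₗ[Q] Hm (LinearMap.ker (g.restrictScalars Q)) (LinearMap.range (f.restrictScalars Q))) :
    (finiteRestrict Q B M ↔ Module.Finite Q V) ∧ finrankRestrict Q B M = Module.finrank Q V := by
  letI : Module Q M := Module.compHom M (algebraMap Q B)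
  haveI : IsScalarTower Q B M := ⟨fun q b m => by
    rw [Algebra.smul_def, mul_smul]
    rfl⟩
  let a : Hm (LinearMap.ker (g.restrictScalars Q)) (LinearMap.range (f.restrictScalars Q)) ≃ₗ[Q]
      ((LinearMap.ker g) ⧸ ((LinearMap.range f).submoduleOf (LinearMap.ker g))) :=
    Submodule.Quotient.restrictScalarsEquiv Q
      ((LinearMap.range f).submoduleOf (LinearMap.ker g))
  let e2 : M ≃ₗ[Q] V := (e.restrictScalars Q).trans (a.symm.trans e'.symm)
  exact ⟨⟨fun h => haveI : Module.Finite Q M := h; Module.Finite.equiv e2,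
    fun h => Module.Finite.equiv e2.symm⟩, LinearEquiv.finrank_eq e2⟩

theorem finrankRestrict_zero (Q B : Type u) [Field Q] [CommRing B] [Algebra Q B]
    (M : ModuleCat.{u} B) (h : Subsingleton M) : finrankRestrict Q B M = 0 := by
  letI : Module Q M := Module.compHom M (algebraMap Q B)
  exact Module.finrank_zero_of_subsingleton (R := Q) (M := M)

theorem extD_map {A B : Type u} [CommRing A] [CommRing B] (φ : A → B) {k : ℕ → ℕ}
    (D : ∀ i, Matrix (Fin (k i)) (Fin (k (i + 1))) A) (j : ℕ) :
    extD (fun i => (D i).map φ) j = (extD D j).map φ := by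
  cases j with
  | zero => ext i; exact i.elim0
  | succ j => rfl

theorem Hm_subsingleton {B : Type u} [CommRing B] {n : ℕ} (hn : WD B n) {k : ℕ → ℕ}
    (D : ∀ i, Matrix (Fin (k i)) (Fin (k (i + 1))) B)
    (hex : ∀ i, Function.Exact (matMap B (D (i + 1))) (matMap B (D i)))
    (N : Type u) [AddCommGroup N] [Module B N] (i : ℕ) (hi : n + 1 ≤ i) :
    Subsingleton (Hm (LinearMap.ker (matMap N (extD D i)))
      (LinearMap.range (matMap N (extD D (i + 1))))) := by
  obtain ⟨i, rfl⟩ : ∃ l, i = l + 1 := ⟨i - 1, by omega⟩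
  have hfl := hn.mono (show n ≤ i by omega) (fun i => Fin (k i) → B) (fun i => matMap B (D i)) hex
  have h1 := exact_lTensor N (matMap B (D (i + 1))) (matMap B (D i)) (hex i)
  have h2 : Function.Exact (matMap N (D (i + 1))) (matMap N (D i)) :=
    exact_transfer (TensorProduct.piScalarRight B B N _).toEquiv
      (TensorProduct.piScalarRight B B N _).toEquiv
      (TensorProduct.piScalarRight B B N _).toAddEquiv
      (matMap_tensor N (D (i + 1))) (matMap_tensor N (D i)) h1
  refine Submodule.Quotient.subsingleton_iff.2 ?_
  refine eq_top_iff.2 ?_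
  rintro ⟨y, hy⟩ -
  exact (h2 y).1 hy

theorem main_count {R A : Type u} [CommRing R] [IsDomain R] [ValuationRing R]
    [CommRing A] [Algebra R A] [Algebra.Smooth R A]
    (I I' : Ideal A) [Module.Flat R (A ⧸ I)] [Module.Flat R (A ⧸ I')]
    [Module.Finite R (A ⧸ (I + I'))] :
    ∃ e : ℕ → ℤ, ∀ (Q : Type u) [Field Q] [Algebra R Q], ∃ N0 : ℕ,
      (∀ i, finiteRestrict Q (Q ⊗[R] A) (torObj (Q ⊗[R] A)
        (I.map (Algebra.TensorProduct.includeRight : A →ₐ[R] Q ⊗[R] A))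
        (I'.map (Algebra.TensorProduct.includeRight : A →ₐ[R] Q ⊗[R] A)) i)) ∧
      (∀ i, N0 ≤ i → Subsingleton (torObj (Q ⊗[R] A)
        (I.map (Algebra.TensorProduct.includeRight : A →ₐ[R] Q ⊗[R] A))
        (I'.map (Algebra.TensorProduct.includeRight : A →ₐ[R] Q ⊗[R] A)) i)) ∧
      ∀ N, N0 ≤ N → ∑ i ∈ Finset.range N, (-1 : ℤ) ^ i *
        (finrankRestrict Q (Q ⊗[R] A) (torObj (Q ⊗[R] A)
        (I.map (Algebra.TensorProduct.includeRight : A →ₐ[R] Q ⊗[R] A))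
        (I'.map (Algebra.TensorProduct.includeRight : A →ₐ[R] Q ⊗[R] A)) i) : ℤ) =
        ∑ i ∈ Finset.range N, (-1 : ℤ) ^ i * e i := by
  haveI : Module.Flat R A := Algebra.Smooth.flat R A
  obtain ⟨k, D, ε, hε, h0, hex⟩ := exists_resolution (R := R) (A := A) (A ⧸ I')
  have hfp := homology_fp (R := R) I I' D ε h0 hex
  haveI : ∀ j, Module.Flat R (Fin (extK k j) → A ⧸ I) := fun j => flat_pi _ _
  haveI : Subsingleton (Fin (extK k 0) → A ⧸ I) := by
    change Subsingleton (Fin 0 → A ⧸ I)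
    infer_instance
  obtain ⟨e, he⟩ := dim_count (fun j => Fin (extK k j) → A ⧸ I)
    (fun j => (matMap (A ⧸ I) (extD D j)).restrictScalars R)
    (fun j => (hfp j).1) (fun j => (hfp j).2)
  refine ⟨e, fun Q _ _ => ?_⟩
  obtain ⟨t, ht0, ht⟩ := he Q
  obtain ⟨ε', hε', h0', hex'⟩ := bc_resolution (R := R) Q I' D ε hε h0 hex
  obtain ⟨n, hn⟩ := WD.smooth Q (Q ⊗[R] A)
  have hT := tor_Hm (fun i => (D i).map (Algebra.TensorProduct.includeRight : A →ₐ[R] Q ⊗[R] A))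
    ε' hε' h0' hex'
    ((Q ⊗[R] A) ⧸ I.map (Algebra.TensorProduct.includeRight : A →ₐ[R] Q ⊗[R] A))
  have hsub : ∀ i, n + 1 ≤ i → Subsingleton (torObj (Q ⊗[R] A)
        (I.map (Algebra.TensorProduct.includeRight : A →ₐ[R] Q ⊗[R] A))
        (I'.map (Algebra.TensorProduct.includeRight : A →ₐ[R] Q ⊗[R] A)) i) := by
    intro i hi
    obtain ⟨u⟩ := hT i
    haveI := Hm_subsingleton hn _ hex'
      ((Q ⊗[R] A) ⧸ I.map (Algebra.TensorProduct.includeRight : A →ₐ[R] Q ⊗[R] A)) i hi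
    exact u.toEquiv.subsingleton
  obtain ⟨τ, hτ⟩ := exists_tau (R := R) Q I
  have hcmp : ∀ i, (finiteRestrict Q (Q ⊗[R] A) (torObj (Q ⊗[R] A)
        (I.map (Algebra.TensorProduct.includeRight : A →ₐ[R] Q ⊗[R] A))
        (I'.map (Algebra.TensorProduct.includeRight : A →ₐ[R] Q ⊗[R] A)) i)) ∧
      finrankRestrict Q (Q ⊗[R] A) (torObj (Q ⊗[R] A)
        (I.map (Algebra.TensorProduct.includeRight : A →ₐ[R] Q ⊗[R] A))
        (I'.map (Algebra.TensorProduct.includeRight : A →ₐ[R] Q ⊗[R] A)) i) =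
      Module.finrank Q (Hm (LinearMap.ker
          (((matMap (A ⧸ I) (extD D i)).restrictScalars R).baseChange Q))
          (LinearMap.range
          (((matMap (A ⧸ I) (extD D (i + 1))).restrictScalars R).baseChange Q))) := by
    intro i
    obtain ⟨u⟩ := hT i
    rw [extD_map, extD_map] at u
    obtain ⟨w⟩ := Hm_equiv
      (f := (((matMap (A ⧸ I) (extD D (i + 1))).restrictScalars R).baseChange Q))
      (g := (((matMap (A ⧸ I) (extD D i)).restrictScalars R).baseChange Q))
      (f' := (matMap ((Q ⊗[R] A) ⧸ I.map
        (Algebra.TensorProduct.includeRight : A →ₐ[R] Q ⊗[R] A)) ((extD D (i + 1)).map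
        (Algebra.TensorProduct.includeRight : A →ₐ[R] Q ⊗[R] A))).restrictScalars Q)
      (g' := (matMap ((Q ⊗[R] A) ⧸ I.map
        (Algebra.TensorProduct.includeRight : A →ₐ[R] Q ⊗[R] A)) ((extD D i).map
        (Algebra.TensorProduct.includeRight : A →ₐ[R] Q ⊗[R] A))).restrictScalars Q)
      (Theta Q τ _) (Theta Q τ _) (Theta Q τ _)
      (Theta_matMap Q τ hτ _) (Theta_matMap Q τ hτ _)
    have := Hm_restrict (Q := Q) _ _ _ u _ w
    exact ⟨this.1.2 (ht i).1, this.2⟩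
  refine ⟨n + 1, fun i => (hcmp i).1, hsub, fun N hN => ?_⟩
  have h := telescope (fun i => (finrankRestrict Q (Q ⊗[R] A) (torObj (Q ⊗[R] A)
        (I.map (Algebra.TensorProduct.includeRight : A →ₐ[R] Q ⊗[R] A))
        (I'.map (Algebra.TensorProduct.includeRight : A →ₐ[R] Q ⊗[R] A)) i) : ℤ)) e t ht0
    (fun j => by rw [(hcmp j).2]; exact (ht j).2.1) N
  have htN : t N = 0 := by
    have h1 := (ht N).2.2
    have h2 := hsub N hN
    have h3 : finrankRestrict Q (Q ⊗[R] A) (torObj (Q ⊗[R] A)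
        (I.map (Algebra.TensorProduct.includeRight : A →ₐ[R] Q ⊗[R] A))
        (I'.map (Algebra.TensorProduct.includeRight : A →ₐ[R] Q ⊗[R] A)) N) = 0 := by
      exact finrankRestrict_zero _ _ _ h2
    rw [← (hcmp N).2, h3] at h1
    omega
  rw [h, htN]
  simp

end final

end PoC

/-- **Principle of continuity over rank-1 valuation rings (affine case).**
Let `R` be a valuation ring of rank 1 with maximal ideal `m`, fraction field `K` and residue
field `k = R/m`, and let `A` be a smooth `R`-algebra.  Let `I`, `I'` be ideals of `A` with
`A/I` and `A/I'` flat over `R` and `A/(I+I')` a finitely generated `R`-module.  Then all the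
Tor modules `Tor_i^{A_K}(A_K/I_K, A_K/I'_K)` and `Tor_i^{A_k}(A_k/I_k, A_k/I'_k)` are
finite-dimensional over `K` resp. `k`, they vanish for large `i`, and the alternating sums of
their dimensions (the intersection numbers) agree. -/
theorem principle_of_continuity_over_rank_one_valuation_ring
    {R A : Type u} [CommRing R] [IsDomain R] [ValuationRing R]
    (hrank : ringKrullDim R = 1)
    [CommRing A] [Algebra R A]
    [Algebra.FormallySmooth R A] [Algebra.FinitePresentation R A]
    (I I' : Ideal A)
    (hIflat : Module.Flat R (A ⧸ I)) (hI'flat : Module.Flat R (A ⧸ I'))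
    (hfin : Module.Finite R (A ⧸ (I + I'))) :
    ∃ N : ℕ,
      (∀ i : ℕ,
        finiteRestrict (FractionRing R) (TensorProduct R (FractionRing R) A)
          (torObj (TensorProduct R (FractionRing R) A)
            (I.map (Algebra.TensorProduct.includeRight :
              A →ₐ[R] TensorProduct R (FractionRing R) A))
            (I'.map (Algebra.TensorProduct.includeRight :
              A →ₐ[R] TensorProduct R (FractionRing R) A)) i)) ∧
      (∀ i : ℕ,
        finiteRestrict (R ⧸ IsLocalRing.maximalIdeal R)
          (TensorProduct R (R ⧸ IsLocalRing.maximalIdeal R) A)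
          (torObj (TensorProduct R (R ⧸ IsLocalRing.maximalIdeal R) A)
            (I.map (Algebra.TensorProduct.includeRight :
              A →ₐ[R] TensorProduct R (R ⧸ IsLocalRing.maximalIdeal R) A))
            (I'.map (Algebra.TensorProduct.includeRight :
              A →ₐ[R] TensorProduct R (R ⧸ IsLocalRing.maximalIdeal R) A)) i)) ∧
      (∀ i : ℕ, N ≤ i →
        Subsingleton
          (torObj (TensorProduct R (FractionRing R) A)
            (I.map (Algebra.TensorProduct.includeRight :
              A →ₐ[R] TensorProduct R (FractionRing R) A))
            (I'.map (Algebra.TensorProduct.includeRight :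
              A →ₐ[R] TensorProduct R (FractionRing R) A)) i) ∧
        Subsingleton
          (torObj (TensorProduct R (R ⧸ IsLocalRing.maximalIdeal R) A)
            (I.map (Algebra.TensorProduct.includeRight :
              A →ₐ[R] TensorProduct R (R ⧸ IsLocalRing.maximalIdeal R) A))
            (I'.map (Algebra.TensorProduct.includeRight :
              A →ₐ[R] TensorProduct R (R ⧸ IsLocalRing.maximalIdeal R) A)) i)) ∧
      (∑ i ∈ Finset.range N, (-1 : ℤ) ^ i *
          (finrankRestrict (FractionRing R) (TensorProduct R (FractionRing R) A)
            (torObj (TensorProduct R (FractionRing R) A)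
              (I.map (Algebra.TensorProduct.includeRight :
                A →ₐ[R] TensorProduct R (FractionRing R) A))
              (I'.map (Algebra.TensorProduct.includeRight :
                A →ₐ[R] TensorProduct R (FractionRing R) A)) i) : ℤ) =
        ∑ i ∈ Finset.range N, (-1 : ℤ) ^ i *
          (finrankRestrict (R ⧸ IsLocalRing.maximalIdeal R)
            (TensorProduct R (R ⧸ IsLocalRing.maximalIdeal R) A)
            (torObj (TensorProduct R (R ⧸ IsLocalRing.maximalIdeal R) A)
              (I.map (Algebra.TensorProduct.includeRight :
                A →ₐ[R] TensorProduct R (R ⧸ IsLocalRing.maximalIdeal R) A))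
              (I'.map (Algebra.TensorProduct.includeRight :
                A →ₐ[R] TensorProduct R (R ⧸ IsLocalRing.maximalIdeal R) A)) i) : ℤ)) := by
  haveI : Algebra.Smooth R A := { }
  obtain ⟨e, he⟩ := PoC.main_count (R := R) I I'
  obtain ⟨N1, a1, b1, c1⟩ := he (FractionRing R)
  letI : Field (R ⧸ IsLocalRing.maximalIdeal R) := Ideal.Quotient.field _
  obtain ⟨N2, a2, b2, c2⟩ := he (R ⧸ IsLocalRing.maximalIdeal R)
  refine ⟨max N1 N2, a1, a2, fun i hi => ⟨b1 i (le_trans (le_max_left _ _) hi),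
    b2 i (le_trans (le_max_right _ _) hi)⟩, ?_⟩
  exact (c1 _ (le_max_left _ _)).trans (c2 _ (le_max_right _ _)).symm
end

section
/- Let R be a valuation ring of rank 1 with maximal ideal m and fraction field K, and let A be an integral domain that is a finitely generated R-algebra whose structure map R → A is injective. Let f ∈ A be an element that becomes a unit in A ⊗_R K (so the locally principal subscheme V(f) does not meet the generic fiber of Spec A over Spec R). Then every prime ideal of A minimal over (f) is a minimal prime over the extended ideal mA; that is, every irreducible component of V(f) is an irreducible component of the special fiber Spec(A/mA). -/
universe u

theorem core_dvd {P A : Type*} [CommRing P] [IsDomain P] [IsIntegrallyClosed P] [CommRing A]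
    [IsDomain A] [Algebra P A] [Module.IsTorsionFree P A] (a b : P) (ha : a ≠ 0) (hb : b ≠ 0)
    (hab : ∀ (i : ℕ) (x y : P), b ^ i * x = a ^ i * y → a ^ i ∣ x)
    (u v w f : A) (hu : IsIntegral P u) (hv : IsIntegral P v)
    (h1 : u * f = a • w) (h2 : b • u = a • v) : ∃ d : ℕ, f ∣ w ^ d := by
  have e1 := IsIntegrallyClosed.minpoly_smul hb hu
  have e2 := IsIntegrallyClosed.minpoly_smul ha hv
  rw [h2, e2] at e1
  have hdeg : (minpoly P v).natDegree = (minpoly P u).natDegree := by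
    have := congrArg Polynomial.natDegree e1
    simpa using this
  set d := (minpoly P u).natDegree with hd
  have hc : ∀ i, ∃ c, (minpoly P u).coeff i = a ^ (d - i) * c := by
    intro i
    have := congrArg (fun q => Polynomial.coeff q i) e1
    simp only [Polynomial.coeff_scaleRoots, hdeg] at this
    obtain ⟨c, hc⟩ := hab (d - i) ((minpoly P u).coeff i) ((minpoly P v).coeff i)
      (by rw [mul_comm, ← hd] at *; rw [← this, mul_comm])
    exact ⟨c, hc⟩
  choose c hc using hc
  have hcd : c d = 1 := by
    have h := hc d
    have hm : (minpoly P u).coeff d = 1 := (minpoly.monic hu).coeff_natDegree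
    rw [hm] at h
    simpa using h.symm
  have h0 : ∑ i ∈ Finset.range (d + 1), (algebraMap P A ((minpoly P u).coeff i)) * u ^ i = 0 := by
    have := minpoly.aeval P u
    rwa [Polynomial.aeval_eq_sum_range, Finset.sum_congr rfl
      (fun i _ => Algebra.smul_def _ _)] at this
  have hA : algebraMap P A a ≠ 0 := by
    simpa using ha
  rw [Algebra.smul_def] at h1
  have key : ∑ i ∈ Finset.range (d + 1), algebraMap P A (c i) * w ^ i * f ^ (d - i) = 0 := by
    have : (algebraMap P A a) ^ d *
      ∑ i ∈ Finset.range (d + 1), algebraMap P A (c i) * w ^ i * f ^ (d - i) = f ^ d *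
       ∑ i ∈ Finset.range (d + 1), (algebraMap P A ((minpoly P u).coeff i)) * u ^ i := by
      rw [Finset.mul_sum, Finset.mul_sum]
      refine Finset.sum_congr rfl fun i hi => ?_
      have hi' : i ≤ d := by simpa [Nat.lt_succ_iff] using hi
      obtain ⟨j, hj⟩ := Nat.exists_eq_add_of_le hi'
      rw [hc i, map_mul, map_pow, hj, Nat.add_sub_cancel_left]
      have h3 : u ^ i * f ^ i = (algebraMap P A a) ^ i * w ^ i := by
        rw [← mul_pow, h1, mul_pow]
      linear_combination (- (algebraMap P A a) ^ j * algebraMap P A (c i) * f ^ j) * h3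
    rw [h0, mul_zero] at this
    exact (mul_eq_zero.mp this).resolve_left (pow_ne_zero _ hA)
  refine ⟨d, ?_⟩
  rw [Finset.sum_range_succ, hcd] at key
  have hw : w ^ d = - ∑ i ∈ Finset.range d, algebraMap P A (c i) * w ^ i * f ^ (d - i) := by
    simp at key
    linear_combination key
  rw [hw]
  refine (Finset.dvd_sum fun i hi => ?_).neg_right
  exact Dvd.dvd.mul_left (dvd_pow_self _ (by simp at hi; omega)) _

theorem mvpoly_intClosed {R : Type u} [CommRing R] [IsDomain R] [IsIntegrallyClosed R] (n : ℕ) :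
    IsIntegrallyClosed (MvPolynomial (Fin n) R) := by
  induction n with
  | zero => exact IsIntegrallyClosed.of_equiv (MvPolynomial.isEmptyAlgEquiv R (Fin 0)).symm.toRingEquiv
  | succ n ih => exact IsIntegrallyClosed.of_equiv (MvPolynomial.finSuccEquiv R n).symm.toRingEquiv

theorem exists_content {R : Type u} [CommRing R] [IsDomain R] [ValuationRing R] {σ : Type*}
    (a : MvPolynomial σ R) (ha : a ≠ 0) : ∃ (c : R) (a1 : MvPolynomial σ R), c ≠ 0 ∧
      a = MvPolynomial.C c * a1 ∧
      MvPolynomial.map (Ideal.Quotient.mk (IsLocalRing.maximalIdeal R)) a1 ≠ 0 := by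
  classical
  have hs : a.support.Nonempty := by simpa [Finset.nonempty_iff_ne_empty] using ha
  have : ∃ i ∈ a.support, ∀ j ∈ a.support, a.coeff i ∣ a.coeff j := by
    have gen : ∀ s : Finset (σ →₀ ℕ), s.Nonempty → ∃ i ∈ s, ∀ j ∈ s, a.coeff i ∣ a.coeff j := by
      intro s hs
      induction hs using Finset.Nonempty.cons_induction with
      | singleton x => exact ⟨x, by simp, by simp⟩
      | cons x s hx hs ih =>
        obtain ⟨i, hi, h⟩ := ih
        rcases ValuationRing.dvd_total (a.coeff i) (a.coeff x) with h' | h'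
        · refine ⟨i, by simp [hi], ?_⟩
          intro j hj
          rcases Finset.mem_cons.mp hj with rfl | hj
          · exact h'
          · exact h j hj
        · refine ⟨x, by simp, ?_⟩
          intro j hj
          rcases Finset.mem_cons.mp hj with rfl | hj
          · exact dvd_rfl
          · exact h'.trans (h j hj)
    exact gen _ hs
  obtain ⟨i, hi, h⟩ := this
  have hi0 : a.coeff i ≠ 0 := by simpa using hi
  have : MvPolynomial.C (a.coeff i) ∣ a := by
    rw [MvPolynomial.C_dvd_iff_dvd_coeff]
    intro j
    by_cases hj : j ∈ a.support
    · exact h j hj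
    · simp at hj; simp [hj]
  obtain ⟨a1, h1⟩ := this
  refine ⟨_, a1, hi0, h1, fun h0 => ?_⟩
  have h2 := congrArg (MvPolynomial.coeff i) h1
  rw [MvPolynomial.coeff_C_mul] at h2
  have h3 : a1.coeff i = 1 := by
    apply mul_left_cancel₀ hi0; rw [← h2, mul_one]
  have h4 := congrArg (MvPolynomial.coeff i) h0
  rw [MvPolynomial.coeff_map, h3] at h4
  simp at h4

theorem C_dvd_of {R : Type u} [CommRing R] [IsDomain R] [ValuationRing R] {σ : Type*}
    (h u v : MvPolynomial σ R) (r : R) 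
    (hh : MvPolynomial.map (Ideal.Quotient.mk (IsLocalRing.maximalIdeal R)) h ≠ 0)
    (e : h * u = MvPolynomial.C r * v) : MvPolynomial.C r ∣ u := by
  by_cases hu : u = 0
  · simp [hu]
  obtain ⟨c, a1, hc, rfl, h1⟩ := exists_content u hu
  rcases ValuationRing.dvd_total r c with ⟨x, rfl⟩ | ⟨x, rfl⟩
  · exact ⟨MvPolynomial.C x * a1, by rw [map_mul, mul_assoc]⟩
  · have e2 : h * a1 = MvPolynomial.C x * v := by
      have : (MvPolynomial.C c : MvPolynomial σ R) ≠ 0 := by simpa using hc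
      apply mul_left_cancel₀ this
      rw [map_mul] at e
      linear_combination e
    by_cases hx : IsUnit x
    · obtain ⟨y, hy⟩ := hx.exists_right_inv
      refine ⟨MvPolynomial.C y * a1, ?_⟩
      rw [← mul_assoc, ← map_mul, mul_assoc, hy, mul_one]
    · exfalso
      have := congrArg (MvPolynomial.map (Ideal.Quotient.mk (IsLocalRing.maximalIdeal R))) e2
      rw [map_mul, map_mul, MvPolynomial.map_C, (Ideal.Quotient.eq_zero_iff_mem).2
        ((IsLocalRing.mem_maximalIdeal x).2 hx), map_zero, zero_mul] at this
      exact (mul_ne_zero hh h1) this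

theorem exists_mul_eq {R A : Type u} [CommRing R] [IsDomain R] 
    [CommRing A] [IsDomain A] [Algebra R A] 
    (hinj : Function.Injective (algebraMap R A))
    (f : A)
    (hf : IsUnit ((Algebra.TensorProduct.includeRight :
        A →ₐ[R] TensorProduct R (FractionRing R) A) f)) : 
    ∃ (r : R) (g : A), r ≠ 0 ∧ f * g = algebraMap R A r := by
  obtain ⟨z, hz⟩ := hf.exists_right_inv
  obtain ⟨⟨g, r⟩, hr⟩ := IsLocalizedModule.surj (nonZeroDivisors R)
    (TensorProduct.mk R (FractionRing R) A 1) z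
  have : TensorProduct.mk R (FractionRing R) A 1 (f * g) =
      TensorProduct.mk R (FractionRing R) A 1 (algebraMap R A r) := by
    change Algebra.TensorProduct.includeRight (R := R) (A := FractionRing R) (f * g) =
      Algebra.TensorProduct.includeRight (R := R) (A := FractionRing R) (algebraMap R A r)
    change r.1 • z = Algebra.TensorProduct.includeRight (R := R) (A := FractionRing R) g at hr
    rw [map_mul, ← hr, mul_smul_comm, hz, AlgHom.commutes, Algebra.smul_def, mul_one]
  obtain ⟨c, hc⟩ := (IsLocalizedModule.eq_iff_exists (nonZeroDivisors R) _).1 this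
  refine ⟨r, g, nonZeroDivisors.ne_zero r.2, ?_⟩
  change c.1 • (f * g) = c.1 • (algebraMap R A r) at hc
  rw [Algebra.smul_def, Algebra.smul_def] at hc
  refine mul_left_cancel₀ ?_ hc
  rw [Ne, map_eq_zero_iff _ hinj]
  exact nonZeroDivisors.ne_zero c.2

theorem exists_notMem_mul_pow_mem {A : Type*} [CommRing A] (I p : Ideal A)
    (hp : p ∈ I.minimalPrimes) (h : A) (hh : h ∈ p) : ∃ t ∉ p, ∃ n : ℕ, t * h ^ n ∈ I := by
  have := hp.1.1
  by_contra! H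
  have hd : Disjoint (I : Set A) ((p.primeCompl ⊔ Submonoid.powers h : Submonoid A) : Set A) := by
    rw [Set.disjoint_left]
    intro x hx hx'
    obtain ⟨t, ht, y, ⟨n, rfl⟩, rfl⟩ := Submonoid.mem_sup.1 hx'
    exact H t ht n hx
  obtain ⟨q, hq, hIq, hqd⟩ := Ideal.exists_le_prime_disjoint I _ hd
  have hqp : q ≤ p := by
    intro x hx
    by_contra hxp
    exact Set.disjoint_left.1 hqd hx (Submonoid.mem_sup_left (show x ∈ p.primeCompl from hxp))
  have hpq := hp.2 ⟨hq, hIq⟩ hqp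
  exact Set.disjoint_left.1 hqd (hpq hh)
    (Submonoid.mem_sup_right (Submonoid.mem_powers h))

/-- Lifted Noether normalization of the special fibre. -/
theorem exists_lift {R A : Type u} [CommRing R] [IsDomain R] [ValuationRing R]
    [CommRing A] [IsDomain A] [Algebra R A] [Algebra.FiniteType R A]
    (hinj : Function.Injective (algebraMap R A))
    (hne : (IsLocalRing.maximalIdeal R).map (algebraMap R A) ≠ ⊤) :
    ∃ (n : ℕ) (φ : MvPolynomial (Fin n) R →ₐ[R] A), Function.Injective φ ∧
      ((Ideal.Quotient.mk ((IsLocalRing.maximalIdeal R).map (algebraMap R A))).comp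
        φ.toRingHom).Finite := by
  set m := IsLocalRing.maximalIdeal R
  set J := m.map (algebraMap R A)
  letI : Field (R ⧸ m) := Ideal.Quotient.field m
  have : Nontrivial (A ⧸ J) := Ideal.Quotient.nontrivial_iff.2 hne
  have : Algebra.FiniteType R (A ⧸ J) :=
    Algebra.FiniteType.of_surjective (Ideal.Quotient.mkₐ R J) Ideal.Quotient.mk_surjective
  have : Algebra.FiniteType (R ⧸ m) (A ⧸ J) := Algebra.FiniteType.of_restrictScalars_finiteType R _ _
  obtain ⟨n, g, ginj, gfin⟩ := exists_finite_inj_algHom_of_fg (R ⧸ m) (A ⧸ J)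
  choose x hx using fun i => Ideal.Quotient.mk_surjective (I := J) (g (MvPolynomial.X i))
  let φ : MvPolynomial (Fin n) R →ₐ[R] A := MvPolynomial.aeval x
  have hcomp : (Ideal.Quotient.mk J).comp φ.toRingHom =
      g.toRingHom.comp (MvPolynomial.map (Ideal.Quotient.mk m)) := by
    apply MvPolynomial.ringHom_ext
    · intro r
      simp only [φ, RingHom.comp_apply, AlgHom.toRingHom_eq_coe, RingHom.coe_coe,
        MvPolynomial.map_C, MvPolynomial.algHom_C]
      rfl
    · intro i
      simp [φ, hx]
  refine ⟨n, φ, ?_, ?_⟩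
  · rw [injective_iff_map_eq_zero]
    intro a ha
    by_contra ha0
    obtain ⟨c, a1, hc, rfl, h1⟩ := exists_content a ha0
    rw [map_mul, MvPolynomial.algHom_C, mul_eq_zero, map_eq_zero_iff _ hinj] at ha
    have h2 := congrArg (fun F => F a1) hcomp
    simp only [RingHom.comp_apply, AlgHom.toRingHom_eq_coe, RingHom.coe_coe,
      ha.resolve_left hc, map_zero] at h2
    exact h1 ((map_eq_zero_iff _ ginj).1 h2.symm)
  · rw [hcomp]
    exact RingHom.Finite.comp gfin (RingHom.Finite.of_surjective _
      (MvPolynomial.map_surjective _ Ideal.Quotient.mk_surjective))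

theorem mvpoly_mem {R A : Type u} [CommRing R] [CommRing A] [Algebra R A] {n : ℕ} (m : Ideal R)
    (φ : MvPolynomial (Fin n) R →ₐ[R] A) (a : MvPolynomial (Fin n) R)
    (ha : MvPolynomial.map (Ideal.Quotient.mk m) a = 0) : φ a ∈ m.map (algebraMap R A) := by
  rw [a.as_sum, map_sum]
  refine Ideal.sum_mem _ fun i _ => ?_
  rw [← mul_one (a.coeff i), ← MvPolynomial.C_mul_monomial, map_mul, MvPolynomial.algHom_C]
  refine Ideal.mul_mem_right _ _ (Ideal.mem_map_of_mem _ ?_)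
  have := congrArg (MvPolynomial.coeff i) ha
  rw [MvPolynomial.coeff_map, MvPolynomial.coeff_zero] at this
  exact Ideal.Quotient.eq_zero_iff_mem.1 this

/-- Let `R` be a valuation ring of rank 1 (a valuation domain of Krull dimension 1) with
maximal ideal `m` and fraction field `K`, and let `A` be an integral domain that is a finitely
generated `R`-algebra with injective structure map.  If `f ∈ A` becomes a unit in `A ⊗_R K`
(so `V(f)` does not meet the generic fiber), then every prime of `A` minimal over `(f)` is a
minimal prime over the extended ideal `m·A`: every irreducible component of `V(f)` is an
irreducible component of the special fiber. -/
theorem components_of_principal_subscheme_missing_generic_fiber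
    {R A : Type u} [CommRing R] [IsDomain R] [ValuationRing R]
    (hrank : ringKrullDim R = 1)
    [CommRing A] [IsDomain A] [Algebra R A] [Algebra.FiniteType R A]
    (hinj : Function.Injective (algebraMap R A))
    (f : A)
    (hf : IsUnit ((Algebra.TensorProduct.includeRight :
        A →ₐ[R] TensorProduct R (FractionRing R) A) f)) :
    ∀ p ∈ (Ideal.span {f}).minimalPrimes,
      p ∈ ((IsLocalRing.maximalIdeal R).map (algebraMap R A)).minimalPrimes := by
  intro p hp
  have hpp : p.IsPrime := hp.1.1
  have hfp : f ∈ p := hp.1.2 (Ideal.mem_span_singleton_self f)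
  obtain ⟨r, g, hr, hfg⟩ := exists_mul_eq hinj f hf
  have hrp : algebraMap R A r ∈ p := hfg ▸ p.mul_mem_right g hfp
  have hmp : (IsLocalRing.maximalIdeal R).map (algebraMap R A) ≤ p := by
    rw [Ideal.map_le_iff_le_comap]
    refine ((ringKrullDim_eq_one_iff_of_isLocalRing_isDomain.1 hrank).2 r hr).trans ?_
    rw [(hpp.comap (algebraMap R A)).radical_le_iff, Ideal.span_singleton_le_iff_mem]
    exact hrp
  obtain ⟨n, φ, φinj, φfin⟩ := exists_lift hinj (fun h => hpp.ne_top (top_le_iff.1 (h ▸ hmp)))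
  letI : Algebra (MvPolynomial (Fin n) R) A := φ.toRingHom.toAlgebra
  have hφ : ∀ a, algebraMap (MvPolynomial (Fin n) R) A a = φ a := fun _ => rfl
  have : IsScalarTower R (MvPolynomial (Fin n) R) A :=
    IsScalarTower.of_algebraMap_eq fun x => (φ.commutes x).symm
  have : Algebra.FiniteType (MvPolynomial (Fin n) R) A :=
    Algebra.FiniteType.of_restrictScalars_finiteType R _ _
  have : FaithfulSMul (MvPolynomial (Fin n) R) A := (faithfulSMul_iff_algebraMap_injective _ _).2 φinj
  have : IsIntegrallyClosed (MvPolynomial (Fin n) R) := mvpoly_intClosed n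
  have hmJ : (IsLocalRing.maximalIdeal R).map (algebraMap R A) ≤
      (p.under (MvPolynomial (Fin n) R)).map (algebraMap (MvPolynomial (Fin n) R) A) := by
    rw [Ideal.map_le_iff_le_comap]
    intro x hx
    have h1 : algebraMap R A x ∈ p := hmp (Ideal.mem_map_of_mem _ hx)
    rw [Ideal.mem_comap, IsScalarTower.algebraMap_apply R (MvPolynomial (Fin n) R) A]
    apply Ideal.mem_map_of_mem
    rw [Ideal.mem_comap, ← IsScalarTower.algebraMap_apply]
    exact h1
  have : Module.Finite (MvPolynomial (Fin n) R)
      (A ⧸ (p.under (MvPolynomial (Fin n) R)).map (algebraMap (MvPolynomial (Fin n) R) A)) := by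
    have h := RingHom.Finite.comp (RingHom.Finite.of_surjective (Ideal.Quotient.factor hmJ)
      (Ideal.Quotient.factor_surjective hmJ)) φfin
    rw [← RingHom.finite_algebraMap]
    exact h
  have hwq : Algebra.WeaklyQuasiFiniteAt (MvPolynomial (Fin n) R) p := by
    delta Algebra.WeaklyQuasiFiniteAt
    infer_instance
  -- elements of `P ∩ p` vanish modulo `m`
  have hkey : ∀ h : MvPolynomial (Fin n) R, φ h ∈ p →
      MvPolynomial.map (Ideal.Quotient.mk (IsLocalRing.maximalIdeal R)) h = 0 := by
    intro h hhp
    by_contra hh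
    obtain ⟨t, ht, N, hN⟩ := exists_notMem_mul_pow_mem _ p hp _ hhp
    obtain ⟨u0, hu0⟩ := Ideal.mem_span_singleton.1 hN
    obtain ⟨s, hs, hsi, hsx⟩ := Algebra.zariskisMainProperty_iff.1
      (Algebra.ZariskisMainProperty.of_finiteType_of_weaklyQuasiFiniteAt
        (R := MvPolynomial (Fin n) R) p)
    obtain ⟨m1, hm1⟩ := hsx (t * g)
    obtain ⟨m2, hm2⟩ := hsx u0
    have hh0 : h ≠ 0 := by rintro rfl; simp at hh
    have hpow : MvPolynomial.map (Ideal.Quotient.mk (IsLocalRing.maximalIdeal R)) (h ^ N) ≠ 0 := by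
      rw [map_pow]; exact pow_ne_zero _ hh
    obtain ⟨d, hd⟩ := core_dvd (MvPolynomial.C r) (h ^ N) (by simpa using hr) (pow_ne_zero _ hh0)
      (fun i x y e => by
        rw [← map_pow] at e ⊢
        exact C_dvd_of _ x y _ (by rw [map_pow]; exact pow_ne_zero _ hpow) e)
      (s ^ m2 * (s ^ m1 * (t * g))) (s ^ m1 * (s ^ m2 * u0)) (s ^ m2 * s ^ m1 * t) f
      ((hsi.pow _).mul hm1) ((hsi.pow _).mul hm2)
      (by
        rw [Algebra.smul_def, hφ, MvPolynomial.algHom_C, ← hfg]; ring)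
      (by
        rw [Algebra.smul_def, Algebra.smul_def, hφ, hφ, MvPolynomial.algHom_C, ← hfg, map_pow]
        linear_combination (s ^ m2 * s ^ m1 * g) * hu0)
    have := hpp.mem_of_pow_mem _ (p.mem_of_dvd hd hfp)
    rcases hpp.mem_or_mem this with h1 | h1
    · rcases hpp.mem_or_mem h1 with h1 | h1 <;> exact hs (hpp.mem_of_pow_mem _ h1)
    · exact ht h1
  refine ⟨⟨hpp, hmp⟩, ?_⟩
  rintro q ⟨hq, hmq⟩ hqp
  have hu : q.under (MvPolynomial (Fin n) R) = p.under (MvPolynomial (Fin n) R) := by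
    refine le_antisymm (Ideal.comap_mono hqp) fun a ha => ?_
    exact hmq (mvpoly_mem _ φ a (hkey a ha))
  have := hq
  exact (Algebra.WeaklyQuasiFiniteAt.eq_of_le_of_under_eq hqp hu).ge
end
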